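/- arXiv:1301.1512 — 2 statements merged into one kernel-verified Lean document; each statement's English description precedes it below -/
import Mathlib

section
/- Let G be a 2-connected graph which is not a cycle. If G is both K_{1,3}-f_1-heavy and Z_2-f_1-heavy, then G is pancyclic. -/
open SimpleGraph

/-- `G` contains a cycle of length `k`. -/
def HasCycleLength {V : Type} (G : SimpleGraph V) (k : ℕ) : Prop :=
  ∃ (v : V) (c : G.Walk v v), c.IsCycle ∧ c.length = k

/-- A graph on `n` vertices is pancyclic if it contains cycles of every length from 3 to `n`. -/
def IsPancyclic {V : Type} [Fintype V] (G : SimpleGraph V) : Prop :=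
  ∀ k : ℕ, 3 ≤ k → k ≤ Fintype.card V → HasCycleLength G k

/-- A graph is Hamiltonian if it contains a spanning cycle. -/
def IsHamiltonianGraph {V : Type} (G : SimpleGraph V) : Prop :=
  ∃ (v : V) (c : G.Walk v v), c.IsCycle ∧ ∀ u : V, u ∈ c.support

/-- A graph is 2-connected if it has at least 3 vertices and deleting any single
vertex leaves a connected graph. -/
def TwoConnected {V : Type} [Fintype V] (G : SimpleGraph V) : Prop :=
  3 ≤ Fintype.card V ∧ ∀ v : V, (G.induce {u : V | u ≠ v}).Connected

/-- A (finite) graph is a cycle iff it is connected and 2-regular. -/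
def IsCycleGraph {V : Type} [Fintype V] (G : SimpleGraph V) [DecidableRel G.Adj] : Prop :=
  G.Connected ∧ ∀ v : V, G.degree v = 2

/-- `G` is `R`-f₁-heavy: for every induced copy of `R` in `G` (given by a graph
embedding `f : R ↪g G`) and every pair of vertices at distance 2 in that copy,
one of them has degree at least `(n+1)/2` in `G`. -/
def F1Heavy {V W : Type} [Fintype V] (G : SimpleGraph V) [DecidableRel G.Adj]
    (R : SimpleGraph W) : Prop :=
  ∀ (f : R ↪g G) (a b : W), R.dist a b = 2 →
    Fintype.card V + 1 ≤ 2 * max (G.degree (f a)) (G.degree (f b))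

/-- `G` is `R`-f-heavy: as above but with degree at least `n/2`. -/
def FHeavy {V W : Type} [Fintype V] (G : SimpleGraph V) [DecidableRel G.Adj]
    (R : SimpleGraph W) : Prop :=
  ∀ (f : R ↪g G) (a b : W), R.dist a b = 2 →
    Fintype.card V ≤ 2 * max (G.degree (f a)) (G.degree (f b))

/-- `G` is `R`-free: no induced subgraph of `G` is isomorphic to `R`. -/
def RFree {V W : Type} (G : SimpleGraph V) (R : SimpleGraph W) : Prop :=
  IsEmpty (R ↪g G)

/-- The claw `K_{1,3}`: vertex `0` is the center, adjacent to `1`, `2`, `3`. -/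
def claw : SimpleGraph (Fin 4) := SimpleGraph.fromRel (fun a _ => a = 0)

/-- `Z_i`: the path `0 1 2 ... (i+2)` together with the chord `{0,2}`,
i.e. a triangle `0 1 2` with a path of `i` edges attached at vertex `2`. -/
def Zgraph (i : ℕ) : SimpleGraph (Fin (i + 3)) :=
  SimpleGraph.fromRel (fun a b => b.val = a.val + 1 ∨ (a.val = 0 ∧ b.val = 2))

/-- The net `N`: triangle `0 1 2` with pendant edges `0-3`, `1-4`, `2-5`. -/
def netGraph : SimpleGraph (Fin 6) :=
  SimpleGraph.fromRel (fun a b =>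
    (a.val = 0 ∧ b.val = 1) ∨ (a.val = 1 ∧ b.val = 2) ∨ (a.val = 0 ∧ b.val = 2) ∨
    (a.val = 0 ∧ b.val = 3) ∨ (a.val = 1 ∧ b.val = 4) ∨ (a.val = 2 ∧ b.val = 5))

/-- The wounded `W`: triangle `0 1 2` with a pendant edge `0-3` and a pendant
path `1-4-5` of two edges. -/
def woundedGraph : SimpleGraph (Fin 6) :=
  SimpleGraph.fromRel (fun a b =>
    (a.val = 0 ∧ b.val = 1) ∨ (a.val = 1 ∧ b.val = 2) ∨ (a.val = 0 ∧ b.val = 2) ∨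
    (a.val = 0 ∧ b.val = 3) ∨ (a.val = 1 ∧ b.val = 4) ∨ (a.val = 4 ∧ b.val = 5))


/-- Path list from `a` to `b` (not necessarily without repetition). -/
inductive Pa {V : Type} (G : SimpleGraph V) : V → List V → V → Prop
  | one (a : V) : Pa G a [a] a
  | cons {a c b : V} {l : List V} : G.Adj a c → Pa G c l b → Pa G a (a :: l) b

theorem Pa.hd {V : Type} {G : SimpleGraph V} {a b : V} {l : List V} (h : Pa G a l b) :
    ∃ l', l = a :: l' := by
  cases h <;> exact ⟨_, rfl⟩

theorem Pa.ne {V : Type} {G : SimpleGraph V} {a b : V} {l : List V} (h : Pa G a l b) :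
    l ≠ [] := by
  cases h <;> simp

theorem Pa.lst {V : Type} {G : SimpleGraph V} {a b : V} {l : List V} (h : Pa G a l b) :
    ∃ l', l = l' ++ [b] := by
  induction h with
  | one a => exact ⟨[], rfl⟩
  | @cons a c b l _ _ ih =>
    obtain ⟨l', rfl⟩ := ih
    exact ⟨a :: l', rfl⟩

theorem Pa.mem_hd {V : Type} {G : SimpleGraph V} {a b : V} {l : List V} (h : Pa G a l b) :
    a ∈ l := by obtain ⟨l', rfl⟩ := h.hd; simp

theorem Pa.mem_lst {V : Type} {G : SimpleGraph V} {a b : V} {l : List V} (h : Pa G a l b) :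
    b ∈ l := by obtain ⟨l', rfl⟩ := h.lst; simp

theorem Pa.app {V : Type} {G : SimpleGraph V} {a b c d : V} {l m : List V} (h : Pa G a l b)
    (e : G.Adj b c) (h' : Pa G c m d) : Pa G a (l ++ m) d := by
  induction h with
  | one a => exact Pa.cons e h'
  | cons e' _ ih => exact Pa.cons e' (ih e)

theorem Pa.snoc {V : Type} {G : SimpleGraph V} {a b c : V} {l : List V} (h : Pa G a l b)
    (e : G.Adj b c) : Pa G a (l ++ [c]) c := h.app e (Pa.one c)

theorem Pa.rev {V : Type} {G : SimpleGraph V} {a b : V} {l : List V} (h : Pa G a l b) :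
    Pa G b l.reverse a := by
  induction h with
  | one a => exact Pa.one a
  | cons e' _ ih =>
    rw [List.reverse_cons]
    exact ih.app e'.symm (Pa.one _)

theorem Pa.split {V : Type} {G : SimpleGraph V} {a d : V} {l m : List V}
    (h : Pa G a (l ++ m) d) (hl : l ≠ []) (hm : m ≠ []) :
    ∃ b c, Pa G a l b ∧ G.Adj b c ∧ Pa G c m d := by
  induction l generalizing a with
  | nil => exact absurd rfl hl
  | cons x l ih =>
    cases l with
    | nil =>
      cases h with
      | one => exact absurd rfl hm
      | cons e h => exact ⟨_, _, Pa.one _, e, h⟩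
    | cons y l =>
      cases h with
      | cons e h =>
        obtain ⟨b, c, h1, h2, h3⟩ := ih h (by simp)
        exact ⟨b, c, Pa.cons e h1, h2, h3⟩

theorem Pa.consD {V : Type} {G : SimpleGraph V} {a d x : V} {m : List V}
    (h : Pa G a (x :: m) d) (hm : m ≠ []) :
    a = x ∧ ∃ c, G.Adj x c ∧ Pa G c m d := by
  cases h with
  | one => exact absurd rfl hm
  | cons e h => exact ⟨rfl, _, e, h⟩

theorem Pa.hd_eq {V : Type} {G : SimpleGraph V} {a d x : V} {m : List V}
    (h : Pa G a (x :: m) d) : a = x := by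
  cases h <;> rfl

theorem Pa.lst_eq {V : Type} {G : SimpleGraph V} {a d x : V} {m : List V}
    (h : Pa G a (m ++ [x]) d) : d = x := by
  have := h.rev
  simp at this
  exact this.hd_eq

theorem Pa.of_chain {V : Type} {G : SimpleGraph V} {l : List V} (h : l.IsChain G.Adj)
    (hl : l ≠ []) : Pa G (l.head hl) l (l.getLast hl) := by
  induction l with
  | nil => exact absurd rfl hl
  | cons x l ih =>
    cases l with
    | nil => exact Pa.one x
    | cons y l =>
      rw [List.isChain_cons_cons] at h
      have := ih h.2 (by simp)
      rw [List.getLast_cons (by simp)]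
      exact Pa.cons h.1 this

theorem Pa.chain {V : Type} {G : SimpleGraph V} {a b : V} {l : List V} (h : Pa G a l b) :
    l.IsChain G.Adj := by
  induction h with
  | one a => simp
  | @cons a c b l e h ih =>
    obtain ⟨l', rfl⟩ := h.hd
    rw [List.isChain_cons_cons]
    exact ⟨e, ih⟩

/-- Cycle list. -/
def Cyc {V : Type} (G : SimpleGraph V) (l : List V) : Prop :=
  ∃ a b, Pa G a l b ∧ G.Adj b a ∧ l.Nodup ∧ 3 ≤ l.length

/-- `G` has a cycle of length `k`. -/
def HasCyc {V : Type} (G : SimpleGraph V) (k : ℕ) : Prop := ∃ l, Cyc G l ∧ l.length = k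

theorem Cyc.mk' {V : Type} {G : SimpleGraph V} {a b : V} {l l' : List V} (h : Pa G a l b)
    (e : G.Adj b a) (hp : l.Perm l') (hn : l'.Nodup) (h3 : 3 ≤ l'.length) : Cyc G l :=
  ⟨a, b, h, e, hp.nodup_iff.2 hn, by rw [hp.length_eq]; exact h3⟩

theorem Cyc.nodup {V : Type} {G : SimpleGraph V} {l : List V} (h : Cyc G l) : l.Nodup := by
  obtain ⟨_, _, _, _, h, _⟩ := h; exact h

theorem Cyc.len {V : Type} {G : SimpleGraph V} {l : List V} (h : Cyc G l) : 3 ≤ l.length := by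
  obtain ⟨_, _, _, _, _, h⟩ := h; exact h

theorem Cyc.rot {V : Type} {G : SimpleGraph V} {l m : List V} (h : Cyc G (l ++ m)) :
    Cyc G (m ++ l) := by
  rcases eq_or_ne l [] with rfl | hl
  · simpa using h
  rcases eq_or_ne m [] with rfl | hm
  · simpa using h
  obtain ⟨a, b, hp, e, hn, h3⟩ := h
  obtain ⟨c, d, h1, h2, h4⟩ := hp.split hl hm
  exact Cyc.mk' (h4.app e h1) h2 List.perm_append_comm hn h3

theorem Cyc.rev {V : Type} {G : SimpleGraph V} {l : List V} (h : Cyc G l) :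
    Cyc G l.reverse := by
  obtain ⟨a, b, hp, e, hn, h3⟩ := h
  exact Cyc.mk' hp.rev e.symm (List.reverse_perm _) hn h3

theorem Cyc.rot_to {V : Type} {G : SimpleGraph V} {l : List V} (h : Cyc G l) {u : V}
    (hu : u ∈ l) : ∃ L, Cyc G (u :: L) ∧ (u :: L).Perm l := by
  obtain ⟨s, t, rfl⟩ := List.append_of_mem hu
  exact ⟨t ++ s, h.rot, by
    have := List.perm_append_comm (l₁ := u :: t) (l₂ := s); simpa using this⟩

theorem Cyc.rot_to2 {V : Type} {G : SimpleGraph V} {l : List V} (h : Cyc G l) {u w : V}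
    (hu : u ∈ l) (hw : w ∈ l) (huw : u ≠ w) :
    ∃ L M, Cyc G (u :: L ++ w :: M) ∧ (u :: L ++ w :: M).Perm l := by
  obtain ⟨L, hc, hp⟩ := h.rot_to hu
  have : w ∈ L := by
    have := hp.mem_iff.2 hw
    simp at this
    rcases this with h | h
    · exact absurd h.symm huw
    · exact h
  obtain ⟨s, t, rfl⟩ := List.append_of_mem this
  exact ⟨s, t, hc, hp⟩

theorem HasCyc.to {V : Type} {G : SimpleGraph V} {k : ℕ} (h : HasCyc G k) :
    ∃ (v : V) (c : G.Walk v v), c.IsCycle ∧ c.length = k := by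
  obtain ⟨l, ⟨a, b, hp, e, hn, h3⟩, rfl⟩ := h
  have key : ∀ {a b : V} {l : List V}, Pa G a l b → ∃ p : G.Walk a b, p.support = l := by
    intro a b l hp
    induction hp with
    | one a => exact ⟨Walk.nil, rfl⟩
    | cons e _ ih =>
      obtain ⟨p, hp⟩ := ih
      exact ⟨Walk.cons e p, by simp [hp]⟩
  obtain ⟨p, rfl⟩ := key hp
  refine ⟨b, Walk.cons e p, ?_, by simp⟩
  rw [Walk.cons_isCycle_iff]
  refine ⟨(Walk.isPath_def p).2 hn, fun he => ?_⟩
  have hpath : p.IsPath := (Walk.isPath_def p).2 hn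
  cases p with
  | nil => simp at h3
  | cons e' q =>
    rename_i w
    rw [Walk.edges_cons, List.mem_cons] at he
    rcases he with he | he
    · have hbw : b = w := by
        rw [Sym2.eq_iff] at he
        rcases he with ⟨h1, h2⟩ | ⟨h1, h2⟩
        · exact absurd h1 e.ne
        · exact h1
      subst hbw
      have hq : q.IsPath := hpath.of_cons
      obtain rfl := (Walk.isPath_iff_nil.1 hq).eq_nil
      simp at h3
    · have := Walk.snd_mem_support_of_mem_edges q he
      simp at hn
      exact hn.1 this



/-- No induced claw with two light leaves. -/
def NC {V : Type} (G : SimpleGraph V) (H : V → Prop) : Prop :=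
  ∀ c x y z, G.Adj c x → G.Adj c y → G.Adj c z → ¬ G.Adj x y → ¬ G.Adj x z → ¬ G.Adj y z →
    x ≠ y → x ≠ z → y ≠ z → ¬ H x → ¬ H y → False

/-- Heaviness of the induced copies of `Z_2`. -/
def NZ {V : Type} (G : SimpleGraph V) (H : V → Prop) : Prop :=
  ∀ a1 a2 a3 a4 a5, G.Adj a1 a2 → G.Adj a1 a3 → G.Adj a2 a3 → G.Adj a3 a4 → G.Adj a4 a5 →
    ¬ G.Adj a1 a4 → ¬ G.Adj a2 a4 → ¬ G.Adj a1 a5 → ¬ G.Adj a2 a5 → ¬ G.Adj a3 a5 →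
    (H a4 ∨ (H a1 ∧ H a2)) ∧ (H a3 ∨ H a5)

/-- No extension of `C` by `x`. -/
structure NN {V : Type} (G : SimpleGraph V) (H : V → Prop) (x : V) (C : List V) : Prop where
  c : ∀ {l a b D}, Pa G a l b → G.Adj b a → D.Perm C → l.Perm (x :: D) → False
  p : ∀ {l a b D}, Pa G a l b → H a → H b → D.Perm C → l.Perm (x :: D) → False

theorem cfg_c1 {V : Type} {G : SimpleGraph V} {H : V → Prop} {x : V} {C : List V}
    (hN : NN G H x C) {u w t1 t2 s1 s2 : V} {L1 L2 : List V}
    (hp : (u :: L1 ++ w :: L2).Perm C) (h1 : Pa G t1 L1 t2) (h2 : Pa G s1 L2 s2)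
    (ut1 : G.Adj u t1) (t2w : G.Adj t2 w) (ws1 : G.Adj w s1) (s2u : G.Adj s2 u)
    (xu : G.Adj x u) (xw : G.Adj x w) :
    ¬ G.Adj x t1 ∧ ¬ G.Adj x t2 ∧ ¬ G.Adj x s1 ∧ ¬ G.Adj x s2 := by
  classical
  refine ⟨fun h => ?_, fun h => ?_, fun h => ?_, fun h => ?_⟩
  · refine hN.c (Pa.cons xu.symm (Pa.cons h (h1.app t2w (Pa.cons ws1 h2)))) s2u hp ?_
    simp [List.perm_iff_count, List.count_cons] <;> omega
  · refine hN.c (Pa.cons ut1 (h1.app h.symm (Pa.cons xw (Pa.cons ws1 h2)))) s2u hp ?_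
    simp [List.perm_iff_count, List.count_cons] <;> omega
  · refine hN.c (Pa.cons ut1 (h1.app t2w (Pa.cons xw.symm (Pa.cons h h2)))) s2u hp ?_
    simp [List.perm_iff_count, List.count_cons] <;> omega
  · refine hN.c (Pa.cons xu (Pa.cons ut1 (h1.app t2w (Pa.cons ws1 h2)))) h.symm hp ?_
    exact List.Perm.refl _

theorem cfg_c2 {V : Type} {G : SimpleGraph V} {H : V → Prop} {x : V} {C : List V}
    (hN : NN G H x C) {u w t1 t2 s1 s2 : V} {L1 L2 : List V}
    (hp : (u :: L1 ++ w :: L2).Perm C) (h1 : Pa G t1 L1 t2) (h2 : Pa G s1 L2 s2)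
    (ut1 : G.Adj u t1) (t2w : G.Adj t2 w) (ws1 : G.Adj w s1) (s2u : G.Adj s2 u)
    (xu : G.Adj x u) (xw : G.Adj x w) :
    ¬ (H t1 ∧ H s1) ∧ ¬ (H t2 ∧ H s2) := by
  classical
  refine ⟨fun ⟨h, h'⟩ => ?_, fun ⟨h, h'⟩ => ?_⟩
  · refine hN.p (h1.app t2w (Pa.cons xw.symm (Pa.cons xu (Pa.cons s2u.symm h2.rev)))) h h' hp ?_
    simp [List.perm_iff_count, List.count_cons] <;> omega
  · refine hN.p (h1.rev.app ut1.symm (Pa.cons xu.symm (Pa.cons xw (Pa.cons ws1 h2)))) h h' hp ?_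
    simp [List.perm_iff_count, List.count_cons] <;> omega

theorem cfg_c3 {V : Type} {G : SimpleGraph V} {H : V → Prop} {x : V} {C : List V}
    (hN : NN G H x C) {u w t1 t2 s1 s2 : V} {L1 L2 : List V}
    (hp : (u :: L1 ++ w :: L2).Perm C) (h1 : Pa G t1 L1 t2) (h2 : Pa G s1 L2 s2)
    (ut1 : G.Adj u t1) (s2u : G.Adj s2 u)
    (xu : G.Adj x u) (xw : G.Adj x w) (ts : G.Adj t2 s1) :
    ¬ G.Adj w t1 ∧ ¬ G.Adj w s2 := by
  classical
  refine ⟨fun h => ?_, fun h => ?_⟩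
  · refine hN.c (Pa.cons xu.symm (Pa.cons xw (Pa.cons h (h1.app ts h2)))) s2u hp ?_
    simp [List.perm_iff_count, List.count_cons] <;> omega
  · refine hN.c (Pa.cons xu (Pa.cons ut1 (h1.app ts (h2.snoc h.symm)))) xw.symm hp ?_
    simp [List.perm_iff_count, List.count_cons] <;> omega

theorem cfg_c4 {V : Type} {G : SimpleGraph V} {H : V → Prop} {x : V} {C : List V}
    (hN : NN G H x C) {u w t1 t2 s1 s2 : V} {L1 L2 : List V}
    (hp : (u :: L1 ++ w :: L2).Perm C) (h1 : Pa G t1 L1 t2) (h2 : Pa G s1 L2 s2)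
    (ut1 : G.Adj u t1) (t2w : G.Adj t2 w) (ws1 : G.Adj w s1)
    (xu : G.Adj x u) (xw : G.Adj x w) (semi : G.Adj s2 t1 ∨ (H t1 ∧ H s2)) :
    ¬ G.Adj u s1 ∧ ¬ G.Adj u t2 := by
  classical
  refine ⟨fun h => ?_, fun h => ?_⟩
  · rcases semi with st | ⟨ht, hs⟩
    · refine hN.c (Pa.cons xw.symm (Pa.cons xu (Pa.cons h (h2.app st h1)))) t2w hp ?_
      simp [List.perm_iff_count, List.count_cons] <;> omega
    · refine hN.p (h1.app t2w (Pa.cons xw.symm (Pa.cons xu (Pa.cons h h2)))) ht hs hp ?_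
      simp [List.perm_iff_count, List.count_cons] <;> omega
  · rcases semi with st | ⟨ht, hs⟩
    · refine hN.c (Pa.cons xw (Pa.cons ws1 (h2.app st (h1.snoc h.symm)))) xu.symm hp ?_
      simp [List.perm_iff_count, List.count_cons] <;> omega
    · refine hN.p (h1.app h.symm (Pa.cons xu.symm (Pa.cons xw (Pa.cons ws1 h2)))) ht hs hp ?_
      simp [List.perm_iff_count, List.count_cons] <;> omega

theorem cfg_S3 {V : Type} {G : SimpleGraph V} {H : V → Prop} {x : V} {C : List V}
    (hN : NN G H x C) (hZ : NZ G H) (hx : ¬ H x) {u w s2 t1 : V}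
    (s2u : G.Adj s2 u) (xu : G.Adj x u) (xw : G.Adj x w) (uw : G.Adj u w) (ht1 : H t1)
    (ut1 : G.Adj u t1) (semi : G.Adj s2 t1 ∨ (H t1 ∧ H s2)) (L2 : List V) :
    ∀ (L1 : List V) (t2 s1 : V), (u :: L1 ++ w :: L2).Perm C → Pa G t1 L1 t2 → Pa G s1 L2 s2 →
    G.Adj t2 w → G.Adj w s1 → G.Adj t2 s1 → False := by
  classical
  induction L2 with
  | nil => intro L1 t2 s1 _ _ h _ _ _; exact h.ne rfl
  | cons y L2 ih =>
    intro L1 t2 s1 hp h1 h2 t2w ws1 ts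
    have c1 := cfg_c1 hN hp h1 h2 ut1 t2w ws1 s2u xu xw
    have c2 := cfg_c2 hN hp h1 h2 ut1 t2w ws1 s2u xu xw
    have c3 := cfg_c3 hN hp h1 h2 ut1 s2u xu xw ts
    have c4 := cfg_c4 hN hp h1 h2 ut1 t2w ws1 xu xw semi
    cases h2 with
    | one => exact c3.2 ws1
    | @cons _ s1' _ _ e h2 =>
      have hs1 : ¬ H y := fun h => c2.1 ⟨ht1, h⟩
      by_cases k1 : G.Adj x s1'
      · refine hN.c (Pa.cons ut1 (h1.app ts (Pa.cons ws1.symm (Pa.cons xw.symm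
          (Pa.cons k1 h2))))) s2u hp ?_
        simp [List.perm_iff_count, List.count_cons] <;> omega
      by_cases k2 : G.Adj u s1'
      · have hq := h1.app ts (Pa.cons ws1.symm (Pa.cons xw.symm (Pa.cons xu (Pa.cons k2 h2))))
        rcases semi with st | ⟨ht, hs⟩
        · refine hN.c hq st hp ?_
          simp [List.perm_iff_count, List.count_cons] <;> omega
        · refine hN.p hq ht hs hp ?_
          simp [List.perm_iff_count, List.count_cons] <;> omega
      by_cases k3 : G.Adj w s1'
      · refine ih (L1 ++ [y]) y s1' ?_ (h1.snoc ts) h2 ws1.symm k3 e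
        refine List.Perm.trans ?_ hp
        simp [List.perm_iff_count, List.count_cons] <;> omega
      have := hZ x u w y s1' xu xw uw ws1 e c1.2.2.1 c4.1 k1 k2 k3
      tauto

theorem cfg_main {V : Type} {G : SimpleGraph V} {H : V → Prop} {x : V} {C : List V}
    (hN : NN G H x C) (hZ : NZ G H) (hx : ¬ H x) {u w s1 t2 : V}
    (xu : G.Adj x u) (xw : G.Adj x w) (uw : G.Adj u w) 
    (t2w : G.Adj t2 w) (ws1 : G.Adj w s1) (ts : G.Adj t2 s1) (L1 : List V) :
    ∀ (L2 : List V) (t1 s2 : V), (u :: L1 ++ w :: L2).Perm C → Pa G t1 L1 t2 → Pa G s1 L2 s2 →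
    G.Adj u t1 → G.Adj s2 u → G.Adj s2 t1 → False := by
  classical
  induction L1 with
  | nil => intro L1 t2 s1 _ h _ _ _ _; exact h.ne rfl
  | cons y L1 ih =>
    intro L2 t1 s2 hp h1 h2 ut1 s2u st
    by_cases ht1 : H t1
    · exact cfg_S3 hN hZ hx s2u xu xw uw ht1 ut1 (Or.inl st) L2 _ _ _ hp h1 h2 t2w ws1 ts
    have c1 := cfg_c1 hN hp h1 h2 ut1 t2w ws1 s2u xu xw
    have c3 := cfg_c3 hN hp h1 h2 ut1 s2u xu xw ts
    have c4 := cfg_c4 hN hp h1 h2 ut1 t2w ws1 xu xw (Or.inl st)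
    cases h1 with
    | one => exact c4.2 ut1
    | @cons _ t1' _ _ e h1 =>
      by_cases k1 : G.Adj x t1'
      · refine hN.c (Pa.cons ut1.symm (Pa.cons xu.symm (Pa.cons k1 (h1.app t2w
          (Pa.cons ws1 h2))))) st hp ?_
        simp [List.perm_iff_count, List.count_cons] <;> omega
      by_cases k2 : G.Adj w t1'
      · refine hN.c (Pa.cons ut1.symm (Pa.cons xu.symm (Pa.cons xw (Pa.cons k2 (h1.app ts
          h2))))) st hp ?_
        simp [List.perm_iff_count, List.count_cons] <;> omega
      by_cases k3 : G.Adj u t1'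
      · refine ih (L2 ++ [y]) t1' y ?_ h1 (h2.snoc st) k3 ut1.symm e
        refine List.Perm.trans ?_ hp
        simp [List.perm_iff_count, List.count_cons] <;> omega
      have := hZ x w u y t1' xw xu uw.symm ut1 e c1.1 c3.1 k1 k2 k3
      tauto

/-- The final contradiction for a vertex `x` with two attachments. -/
theorem cfg_final {V : Type} {G : SimpleGraph V} {H : V → Prop} {x : V} {C : List V}
    (hN : NN G H x C) (hZ : NZ G H) (hx : ¬ H x) {u w s1 s2 t1 t2 : V} {L1 L2 : List V}
    (hp : (u :: L1 ++ w :: L2).Perm C) (h1 : Pa G t1 L1 t2) (h2 : Pa G s1 L2 s2)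
    (ut1 : G.Adj u t1) (t2w : G.Adj t2 w) (ws1 : G.Adj w s1) (s2u : G.Adj s2 u)
    (xu : G.Adj x u) (xw : G.Adj x w) 
    (semi : G.Adj s2 t1 ∨ (H t1 ∧ H s2)) (ts : G.Adj t2 s1) (hw : ¬ (H t2 ∧ H s1)) : False := by
  have c1 := cfg_c1 hN hp h1 h2 ut1 t2w ws1 s2u xu xw
  have c4 := cfg_c4 hN hp h1 h2 ut1 t2w ws1 xu xw semi
  have uw : G.Adj u w := by
    by_contra k
    have := hZ t2 s1 w x u ts t2w ws1.symm xw.symm xu (fun h => c1.2.1 h.symm)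
      (fun h => c1.2.2.1 h.symm) (fun h => c4.2 h.symm) (fun h => c4.1 h.symm)
      (fun h => k h.symm)
    tauto
  rcases semi with st | ⟨ht, hs⟩
  · exact cfg_main hN hZ hx xu xw uw t2w ws1 ts L1 _ _ _ hp h1 h2 ut1 s2u st
  · exact cfg_S3 hN hZ hx s2u xu xw uw ht ut1 (Or.inr ⟨ht, hs⟩) L2 _ _ _ hp h1 h2 t2w ws1 ts


/-- 2-connectivity, cut-set form. -/
def TC {V : Type} (G : SimpleGraph V) : Prop :=
  ∀ (v : V) (S : V → Prop), (∃ x, x ≠ v ∧ S x) → (∃ y, y ≠ v ∧ ¬ S y) →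
    ∃ x y, x ≠ v ∧ y ≠ v ∧ S x ∧ ¬ S y ∧ G.Adj x y

theorem Pa.pre {V : Type} {G : SimpleGraph V} {a b c : V} {s t : List V}
    (h : Pa G a (s ++ c :: t) b) : Pa G a (s ++ [c]) c := by
  rcases eq_or_ne s [] with rfl | hs
  · have := h.hd_eq; subst this; exact Pa.one _
  · obtain ⟨d, e, h1, h2, h3⟩ := h.split hs (by simp)
    have := h3.hd_eq; subst this
    exact h1.snoc h2

theorem Pa.suf {V : Type} {G : SimpleGraph V} {a b c : V} {s t : List V}
    (h : Pa G a (s ++ c :: t) b) : Pa G c (c :: t) b := by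
  rcases eq_or_ne s [] with rfl | hs
  · have := h.hd_eq; subst this; exact h
  · obtain ⟨d, e, h1, h2, h3⟩ := h.split hs (by simp)
    have := h3.hd_eq; subst this
    exact h3

theorem Pa.ends_ne {V : Type} {G : SimpleGraph V} {a b : V} {l : List V}
    (h : Pa G a l b) (hn : l.Nodup) (h2 : 2 ≤ l.length) : a ≠ b := by
  cases h with
  | one => simp at h2
  | cons e h =>
    rintro rfl
    have := h.mem_lst
    simp at hn
    exact hn.1 this

theorem reach_path {V : Type} {G : SimpleGraph V} {Q : V → Prop} {r r' : V}
    (h : Relation.ReflTransGen (fun a b => G.Adj a b ∧ Q a ∧ Q b) r r') (hr : Q r) :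
    ∃ P, Pa G r P r' ∧ P.Nodup ∧ ∀ y ∈ P, Q y := by
  classical
  induction h with
  | refl => exact ⟨[r], Pa.one r, by simp, by simpa using hr⟩
  | @tail b c _ hbc ih =>
    obtain ⟨P, hP, hn, hQ⟩ := ih
    by_cases hc : c ∈ P
    · obtain ⟨s, t, rfl⟩ := List.append_of_mem hc
      refine ⟨s ++ [c], hP.pre, ?_, ?_⟩
      · exact hn.sublist (by simp)
      · intro y hy; apply hQ; simp at hy ⊢; tauto
    · refine ⟨P ++ [c], hP.snoc hbc.1, ?_, ?_⟩
      · rw [List.nodup_append]; refine ⟨hn, by simp, ?_⟩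
        intro a ha b hb hab; simp at hb; subst hb; subst hab; exact hc ha
      · intro y hy; simp at hy; rcases hy with hy | rfl
        · exact hQ y hy
        · exact hbc.2.2

theorem att {V : Type} {G : SimpleGraph V} {H : V → Prop} {x : V} {C : List V}
    (hN : NN G H x C) (hNC : NC G H) (hx : ¬ H x) (hn : C.Nodup) (h3 : 3 ≤ C.length)
    {u t s : V} {L : List V} (hxC : x ∉ C)
    (hp : (u :: L).Perm C) (h1 : Pa G t L s) (ut : G.Adj u t) (su : G.Adj s u)
    (xu : G.Adj x u) : ¬ G.Adj x t ∧ ¬ G.Adj x s ∧ (G.Adj s t ∨ (H t ∧ H s)) := by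
  classical
  have a1 : ¬ G.Adj x t := by
    intro h
    refine hN.c (Pa.cons xu.symm (Pa.cons h h1)) su hp ?_
    simp [List.perm_iff_count, List.count_cons] <;> omega
  have a2 : ¬ G.Adj x s := by
    intro h
    exact hN.c (Pa.cons xu (Pa.cons ut h1)) h.symm hp (List.Perm.refl _)
  refine ⟨a1, a2, ?_⟩
  by_contra hcon
  push Not at hcon
  have hst : t ≠ s := by
    apply h1.ends_ne
    · exact (hp.nodup_iff.2 hn).of_cons
    · have := hp.length_eq; simp at this; omega
  have hxt : x ≠ t := by
    rintro rfl; exact hxC (hp.mem_iff.1 (by simp [h1.mem_hd]))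
  have hxs : x ≠ s := by
    rintro rfl; exact hxC (hp.mem_iff.1 (by simp [h1.mem_lst]))
  by_cases ht : H t
  · exact hNC u x s t xu.symm su.symm ut a2 a1 hcon.1 hxs hxt hst.symm hx (hcon.2 ht)
  · exact hNC u x t s xu.symm ut su.symm a1 a2 (fun h => hcon.1 h.symm) hxt hxs hst hx ht

theorem lemE1 {V : Type} {G : SimpleGraph V} {H : V → Prop} {x : V} {C : List V}
    (hN : NN G H x C) (hNC : NC G H) (hZ : NZ G H) (hx : ¬ H x) (hn : C.Nodup)
    (h3 : 3 ≤ C.length) (hxC : x ∉ C) {u w t1 s2 s1 t2 : V} {L1 L2 : List V}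
    (hp : (u :: L1 ++ w :: L2).Perm C) (h1 : Pa G t1 (L1 ++ w :: L2) s2)
    (h2 : Pa G s1 (L2 ++ u :: L1) t2) (ut : G.Adj u t1) (su : G.Adj s2 u)
    (ws : G.Adj w s1) (tw : G.Adj t2 w) (xu : G.Adj x u) (xw : G.Adj x w)
    (hw : ¬ (H s1 ∧ H t2)) : False := by
  have hp' : (w :: (L2 ++ u :: L1)).Perm C :=
    (List.perm_append_comm (l₁ := w :: L2) (l₂ := u :: L1)).trans hp
  have b1 := att hN hNC hx hn h3 hxC hp h1 ut su xu
  have b2 := att hN hNC hx hn h3 hxC hp' h2 ws tw xw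
  rcases eq_or_ne L1 [] with rfl | hL1
  · have := h1.hd_eq; subst this; exact b1.1 xw
  rcases eq_or_ne L2 [] with rfl | hL2
  · have := h2.hd_eq; subst this; exact b2.1 xu
  obtain ⟨p, q, e1, e2, e3⟩ := h1.split hL1 (by simp)
  obtain ⟨_, q2, f2, f3⟩ := e3.consD hL2
  obtain ⟨p', q', g1, g2, g3⟩ := h2.split hL2 (by simp)
  obtain ⟨_, q2', k2, k3⟩ := g3.consD hL1
  have w1 : s1 = q2 := by
    obtain ⟨m, rfl⟩ := g1.hd; exact (f3.hd_eq).symm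
  subst w1
  have w2 : p = t2 := by
    obtain ⟨m, rfl⟩ := k3.lst; exact (e1.lst_eq)
  subst w2
  exact cfg_final hN hZ hx hp e1 f3 ut tw ws su xu xw b1.2.2 
    (b2.2.2.resolve_right hw) (fun h => hw h.symm)

theorem Cyc.parts {V : Type} {G : SimpleGraph V} {u : V} {L : List V} (h : Cyc G (u :: L)) :
    ∃ t s, Pa G t L s ∧ G.Adj u t ∧ G.Adj s u := by
  obtain ⟨a, b, hp, e, hn, h3⟩ := h
  have hL : L ≠ [] := by rintro rfl; simp at h3
  obtain ⟨rfl, c, h1, h2⟩ := hp.consD hL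
  exact ⟨c, b, h2, h1, e⟩

theorem lemE {V : Type} {G : SimpleGraph V} {H : V → Prop} {C : List V} (hT : TC G)
    (hNC : NC G H) (hZ : NZ G H) (hC : Cyc G C) (hH : ∀ h, H h → h ∈ C) {x0 : V}
    (hx0 : x0 ∉ C) :
    (∃ x, x ∉ C ∧ ∃ l, Cyc G l ∧ l.Perm (x :: C)) ∨
    (∃ l s t, Pa G s l t ∧ l.Nodup ∧ H s ∧ H t ∧ C ⊆ l ∧ C.length < l.length) ∨
    (∃ u u' M r r', Cyc G (u :: u' :: M) ∧ (u :: u' :: M).Perm C ∧ r ∉ C ∧ r' ∉ C ∧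
      G.Adj r u ∧ G.Adj r' u' ∧ G.Adj r r') := by
  classical
  by_contra hcon
  rw [not_or, not_or] at hcon
  obtain ⟨N1, N2, N3⟩ := hcon
  have hn := hC.nodup
  have h3 := hC.len
  have hNN : ∀ x, x ∉ C → NN G H x C := by
    intro x hx
    have aux : ∀ {l D : List V}, D.Perm C → l.Perm (x :: D) → l.Perm (x :: C) :=
      fun h1 h2 => h2.trans (h1.cons x)
    have nd : (x :: C).Nodup := List.nodup_cons.2 ⟨hx, hn⟩
    constructor
    · intro l a b D h1 h2 h3' h4
      exact N1 ⟨x, hx, l, Cyc.mk' h1 h2 (aux h3' h4) nd (by simp; omega), aux h3' h4⟩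
    · intro l a b D h1 ha hb h3' h4
      have hp := aux h3' h4
      refine N2 ⟨l, a, b, h1, hp.nodup_iff.2 nd, ha, hb, ?_, ?_⟩
      · intro y hy; exact hp.mem_iff.2 (by simp [hy])
      · rw [hp.length_eq]; simp
  have hlight : ∀ x, x ∉ C → ¬ H x := fun x hx h => hx (hH x h)
  set R : V → V → Prop := Relation.ReflTransGen (fun a b => G.Adj a b ∧ a ∉ C ∧ b ∉ C) with hR
  have Rout : ∀ r, R x0 r → r ∉ C := by
    intro r hr
    induction hr with
    | refl => exact hx0
    | tail _ h _ => exact h.2.2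
  have Rsymm : ∀ a b, R a b → R b a := by
    intro a b h
    induction h with
    | refl => exact Relation.ReflTransGen.refl
    | tail _ h ih => exact (Relation.ReflTransGen.single ⟨h.1.symm, h.2.2, h.2.1⟩).trans ih
  -- one good attachment
  have spread : ∀ {u L t s}, Cyc G (u :: L) → (u :: L).Perm C → Pa G t L s → G.Adj u t →
      G.Adj s u → ¬ (H t ∧ H s) → ∀ r r', R x0 r → R x0 r' → G.Adj r u → G.Adj r' u := by
    intro u L t s hcy hp h1 ut su hg r r' hr hr' hru
    have : R r r' := (Rsymm _ _ hr).trans hr'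
    induction this with
    | refl => exact hru
    | @tail b c hb hbc ih =>
      have hbu := ih (hr.trans hb)
      by_contra hcu
      obtain ⟨b1, b2, b3⟩ := att (hNN b hbc.2.1) hNC (hlight b hbc.2.1) hn h3 hbc.2.1 hp h1 ut su hbu
      have b3' := b3.resolve_right hg
      have k1 : ¬ G.Adj t c := by
        intro h
        obtain ⟨M, rfl⟩ := h1.hd
        exact N3 ⟨u, t, M, b, c, hcy, hp, hbc.2.1, hbc.2.2, hbu, h.symm, hbc.1⟩
      have k2 : ¬ G.Adj s c := by
        intro h
        obtain ⟨M, hM⟩ := h1.rev.hd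
        have hcy' : Cyc G (u :: L.reverse) := by
          have := hcy.rev
          simp at this
          have := this.rot
          simpa using this
        have hp' : (u :: L.reverse).Perm C := ((List.reverse_perm L).cons u).trans hp
        rw [hM] at hcy' hp'
        exact N3 ⟨u, s, M, b, c, hcy', hp', hbc.2.1, hbc.2.2, hbu, h.symm, hbc.1⟩
      have := hZ s t u b c b3' su ut.symm hbu.symm hbc.1 (fun h => b2 h.symm) (fun h => b1 h.symm)
        k2 k1 (fun h => hcu h.symm)
      have := hlight b hbc.2.1
      tauto
  -- attachments
  have attach : ∀ v, v ∈ C → ∃ u r, u ≠ v ∧ u ∈ C ∧ R x0 r ∧ G.Adj r u := by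
    intro v hv
    obtain ⟨L, hcy, hp⟩ := hC.rot_to hv
    obtain ⟨t, s, h1, e1, e2⟩ := hcy.parts
    obtain ⟨r, y, _, hy, hr, hyr, hry⟩ := hT v (fun r => R x0 r)
      ⟨x0, by rintro rfl; exact hx0 hv, Relation.ReflTransGen.refl⟩
      ⟨t, e1.ne', fun h => Rout t h (hp.mem_iff.1 (by simp [h1.mem_hd]))⟩
    refine ⟨y, r, hy, ?_, hr, hry⟩
    by_contra hyC
    exact hyr (Relation.ReflTransGen.tail hr ⟨hry, Rout r hr, hyC⟩)
  obtain ⟨c0, hc0⟩ : ∃ c, c ∈ C := by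
    cases C with
    | nil => simp at h3
    | cons a _ => exact ⟨a, by simp⟩
  obtain ⟨u, r, _, huC, hr, hru⟩ := attach c0 hc0
  obtain ⟨w, r', hwu, hwC, hr', hrw⟩ := attach u huC
  obtain ⟨L1, L2, hcy, hp⟩ := hC.rot_to2 huC hwC hwu.symm
  have hcy' : Cyc G (w :: L2 ++ u :: L1) := hcy.rot
  have hp' : (w :: L2 ++ u :: L1).Perm C := List.perm_append_comm.trans hp
  obtain ⟨t1, s2, h1, ut, su⟩ := Cyc.parts hcy
  obtain ⟨s1, t2, h2, ws, tw⟩ := Cyc.parts hcy'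
  by_cases g1 : H s1 ∧ H t2
  · by_cases g2 : H t1 ∧ H s2
    · obtain ⟨P, hP, hPn, hPC⟩ := reach_path (Q := fun a => a ∉ C)
        ((Rsymm _ _ hr').trans hr) (Rout r' hr')
      have hpp := (h1.pre).app hrw.symm (hP.app hru h2.pre.rev)
      have hper : ((L1 ++ [w]) ++ (P ++ (L2 ++ [u]).reverse)).Perm (P ++ C) := by
        refine List.Perm.trans ?_ (hp.append_left P)
        simp [List.perm_iff_count, List.count_cons] <;> omega
      refine N2 ⟨_, _, _, hpp, hper.nodup_iff.2 ?_, g2.1, g1.1, ?_, ?_⟩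
      · rw [List.nodup_append]
        refine ⟨hPn, hn, ?_⟩
        intro a ha b hb hab; subst hab; exact hPC a ha hb
      · intro y hy; exact hper.mem_iff.2 (by simp [hy])
      · rw [hper.length_eq]
        have := List.length_pos_iff.2 hP.ne
        simp; omega
    · have := spread hcy hp h1 ut su g2 r r' hr hr' hru
      exact lemE1 (hNN _ (Rout _ hr')) hNC hZ (hlight _ (Rout _ hr')) hn h3 (Rout _ hr') hp' h2 h1
        ws tw ut su hrw this g2
  · have := spread hcy' hp' h2 ws tw g1 r' r hr' hr hrw
    exact lemE1 (hNN _ (Rout _ hr)) hNC hZ (hlight _ (Rout _ hr)) hn h3 (Rout _ hr) hp h1 h2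
        ut su ws tw hru this g1


open Classical in
/-- Number of neighbours of `v` in the list `l`. -/
noncomputable def cn {V : Type} (G : SimpleGraph V) (v : V) (l : List V) : ℕ :=
  l.countP (fun y => decide (G.Adj v y))

/-- Degree. -/
noncomputable def dg {V : Type} [Fintype V] (G : SimpleGraph V) (v : V) : ℕ :=
  cn G v Finset.univ.toList

theorem cn_nil {V : Type} (G : SimpleGraph V) (v : V) : cn G v [] = 0 := rfl

open Classical in
theorem cn_cons {V : Type} (G : SimpleGraph V) (v x : V) (l : List V) :
    cn G v (x :: l) = cn G v l + if G.Adj v x then 1 else 0 := by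
  unfold cn; rw [List.countP_cons]; simp

theorem cn_cons_pos {V : Type} {G : SimpleGraph V} {v x : V} (h : G.Adj v x) (l : List V) :
    cn G v (x :: l) = cn G v l + 1 := by
  rw [cn_cons, if_pos h]

theorem cn_cons_neg {V : Type} {G : SimpleGraph V} {v x : V} (h : ¬ G.Adj v x) (l : List V) :
    cn G v (x :: l) = cn G v l := by
  rw [cn_cons, if_neg h]; rfl

theorem cn_cons_le {V : Type} (G : SimpleGraph V) (v x : V) (l : List V) :
    cn G v (x :: l) ≤ cn G v l + 1 := by
  classical
  rw [cn_cons]; split_ifs <;> omega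

theorem cn_append {V : Type} (G : SimpleGraph V) (v : V) (l m : List V) :
    cn G v (l ++ m) = cn G v l + cn G v m := by
  unfold cn; rw [List.countP_append]

theorem cn_perm {V : Type} (G : SimpleGraph V) (v : V) {l m : List V} (h : l.Perm m) :
    cn G v l = cn G v m := h.countP_eq _

theorem cn_le {V : Type} (G : SimpleGraph V) (v : V) (l : List V) :
    cn G v l ≤ l.length := List.countP_le_length

theorem cn_zero {V : Type} {G : SimpleGraph V} {v : V} {l : List V} (h : ∀ y ∈ l, ¬ G.Adj v y) :
    cn G v l = 0 := by
  unfold cn; rw [List.countP_eq_zero]; simpa using h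

theorem cn_pos {V : Type} {G : SimpleGraph V} {v : V} {l : List V} (h : 0 < cn G v l) :
    ∃ y ∈ l, G.Adj v y := by
  by_contra hc; push Not at hc
  rw [cn_zero hc] at h; omega

theorem full_perm {V : Type} [Fintype V] {l : List V} (hn : l.Nodup) (hf : ∀ x, x ∈ l) :
    l.Perm Finset.univ.toList := by
  rw [List.perm_ext_iff_of_nodup hn (Finset.nodup_toList _)]
  intro a; simp [hf]

theorem dg_full {V : Type} [Fintype V] (G : SimpleGraph V) (v : V) {l : List V} (hn : l.Nodup)
    (hf : ∀ x, x ∈ l) : dg G v = cn G v l := (cn_perm G v (full_perm hn hf)).symm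

theorem card_full {V : Type} [Fintype V] {l : List V} (hn : l.Nodup)
    (hf : ∀ x, x ∈ l) : l.length = Fintype.card V := by
  rw [(full_perm hn hf).length_eq]; simp [Finset.card_univ]

theorem outside {V : Type} [Fintype V] {P : List V} (hn : P.Nodup) :
    ∃ O, (P ++ O).Nodup ∧ ∀ x, x ∈ P ++ O := by
  classical
  refine ⟨(Finset.univ \ P.toFinset).toList, ?_, ?_⟩
  · rw [List.nodup_append]
    refine ⟨hn, Finset.nodup_toList _, ?_⟩
    intro a ha b hb hab; subst hab; simp at hb; exact hb ha
  · intro x; by_cases h : x ∈ P <;> simp [h]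

theorem len_le_card {V : Type} [Fintype V] {P : List V} (hn : P.Nodup) :
    P.length ≤ Fintype.card V := by
  obtain ⟨O, h1, h2⟩ := outside hn
  rw [← card_full h1 h2]; simp

theorem cn_two_le {V : Type} {G : SimpleGraph V} {s t : V} {O : List V}
    (h : ∀ y ∈ O, G.Adj s y → G.Adj t y → False) : cn G s O + cn G t O ≤ O.length := by
  classical
  induction O with
  | nil => simp [cn_nil]
  | cons y O ih =>
    have := ih (fun z hz => h z (by simp [hz]))
    have h' := h y (by simp)
    rw [cn_cons, cn_cons, List.length_cons]
    by_cases k1 : G.Adj s y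
    · rw [if_pos k1, if_neg (fun k => h' k1 k)]; omega
    · rw [if_neg k1]; split_ifs <;> omega

theorem crossing {V : Type} {G : SimpleGraph V} {s t : V} (l : List V) (p : V)
    (h : ∀ A x y B, p :: l = A ++ x :: y :: B → G.Adj t x → G.Adj s y → False) :
    cn G s l + cn G t (p :: l).dropLast ≤ l.length := by
  classical
  induction l generalizing p with
  | nil => simp [cn_nil]
  | cons q l ih =>
    have := ih q (fun A x y B hh => h (p :: A) x y B (by rw [hh]; rfl))
    have h' := h [] p q l rfl
    rw [List.dropLast_cons_cons, cn_cons, cn_cons, List.length_cons]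
    by_cases k1 : G.Adj s q
    · rw [if_pos k1, if_neg (fun k => h' k k1)]; omega
    · rw [if_neg k1]; split_ifs <;> omega

theorem closure_lem {V : Type} [Fintype V] {G : SimpleGraph V} {P : List V} {s t : V}
    (hP : Pa G s P t) (hn : P.Nodup) (h3 : 3 ≤ P.length) (hd : Fintype.card V ≤ dg G s + dg G t) :
    ∃ l, Cyc G l ∧ P ⊆ l := by
  classical
  by_cases st : G.Adj t s
  · exact ⟨P, ⟨s, t, hP, st, hn, h3⟩, fun _ h => h⟩
  by_cases hy : ∃ y, y ∉ P ∧ G.Adj s y ∧ G.Adj t y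
  · obtain ⟨y, hy, h1, h2⟩ := hy
    exact ⟨y :: P, ⟨y, t, Pa.cons h1.symm hP, h2, List.nodup_cons.2 ⟨hy, hn⟩, by simp; omega⟩,
      by simp⟩
  by_cases hcr : ∃ A x y B, P = A ++ x :: y :: B ∧ G.Adj t x ∧ G.Adj s y
  · obtain ⟨A, x, y, B, rfl, hx, hy⟩ := hcr
    have h1 := hP.pre
    have h2 : Pa G y (y :: B) t := by
      have : A ++ x :: y :: B = (A ++ [x]) ++ y :: B := by simp
      rw [this] at hP
      exact hP.suf
    have hper : ((A ++ [x]) ++ (y :: B).reverse).Perm (A ++ x :: y :: B) := by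
      simp [List.perm_iff_count, List.count_cons] <;> omega
    refine ⟨_, Cyc.mk' (h1.app hx.symm h2.rev) hy.symm hper hn h3, ?_⟩
    intro z hz; exact hper.mem_iff.2 hz
  exfalso
  obtain ⟨O, hO1, hO2⟩ := outside hn
  obtain ⟨P', rfl⟩ := hP.hd
  have key := crossing (G := G) (s := s) (t := t) P' s (fun A x y B h1 h2 h3 =>
    hcr ⟨A, x, y, B, h1, h2, h3⟩)
  have key2 := cn_two_le (G := G) (s := s) (t := t) (O := O) (by
    intro y hyO h1 h2
    refine hy ⟨y, ?_, h1, h2⟩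
    intro hyP
    rw [List.nodup_append] at hO1
    exact hO1.2.2 y hyP y hyO rfl)
  have e1 : cn G s (s :: P') = cn G s P' := cn_cons_neg (by simp) _
  have e2 : cn G t (s :: P') = cn G t (s :: P').dropLast := by
    obtain ⟨Q, hQ⟩ := hP.lst
    rw [hQ, cn_append, List.dropLast_concat, cn_cons_neg (by simp), cn_nil]; rfl
  have hc := card_full hO1 hO2
  rw [dg_full G s hO1 hO2, dg_full G t hO1 hO2, cn_append, cn_append, e1, e2, ← hc] at hd
  simp only [List.length_append, List.length_cons] at *
  omega

theorem edge_cycle {V : Type} [Fintype V] {G : SimpleGraph V} (hT : TC G)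
    (h3 : 3 ≤ Fintype.card V) {x u : V} (xu : G.Adj x u) :
    ∃ l, Cyc G l ∧ x ∈ l ∧ u ∈ l := by
  classical
  obtain ⟨y, hyx, hyu⟩ : ∃ y, y ≠ x ∧ y ≠ u := by
    by_contra hc; push Not at hc
    have : Fintype.card V ≤ ({x, u} : Finset V).card := by
      rw [← Finset.card_univ]; apply Finset.card_le_card
      intro y _; simp; by_cases h : y = x
      · exact Or.inl h
      · exact Or.inr (hc y h)
    have := Finset.card_le_two (a := x) (b := u)
    omega
  obtain ⟨u', a, _, hax, rfl, _, hua⟩ := hT x (fun z => z = u) ⟨u, xu.ne', rfl⟩ ⟨y, hyx, hyu⟩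
  have hr : Relation.ReflTransGen (fun a b => G.Adj a b ∧ a ≠ u' ∧ b ≠ u') x a := by
    by_contra hc
    obtain ⟨p, q, hp, hq, h1, h2, h3⟩ := hT u'
      (fun z => Relation.ReflTransGen (fun a b => G.Adj a b ∧ a ≠ u' ∧ b ≠ u') x z)
      ⟨x, xu.ne, Relation.ReflTransGen.refl⟩ ⟨a, hua.ne', hc⟩
    exact h2 (h1.tail ⟨h3, hp, hq⟩)
  obtain ⟨P, hP, hn, hQ⟩ := reach_path (Q := fun z => z ≠ u') hr xu.ne
  refine ⟨u' :: P, ⟨u', a, Pa.cons xu.symm hP, hua.symm, ?_, ?_⟩, ?_, by simp⟩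
  · rw [List.nodup_cons]; exact ⟨fun h => hQ u' h rfl, hn⟩
  · cases hP with
    | one => exact absurd rfl hax
    | cons e h => 
      have := List.length_pos_iff.2 h.ne
      simp; omega
  · simp [hP.mem_hd]

theorem exists_max {α : Type} (p : α → Prop) (f : α → ℕ) (B : ℕ) (hB : ∀ a, p a → f a ≤ B)
    (hp : ∃ a, p a) : ∃ a, p a ∧ ∀ b, p b → f b ≤ f a := by
  classical
  obtain ⟨a0, h0⟩ := hp
  have hex : ∃ k, ∃ a, p a ∧ B - f a = k := ⟨_, a0, h0, rfl⟩
  obtain ⟨a, ha, hk⟩ := Nat.find_spec hex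
  refine ⟨a, ha, fun b hb => ?_⟩
  have := Nat.find_min' hex ⟨b, hb, rfl⟩
  have h1 := hB a ha
  have h2 := hB b hb
  omega

theorem sub_len {V : Type} {l m : List V} (hn : l.Nodup) (h : l ⊆ m) : l.length ≤ m.length :=
  (hn.subperm h).length_le

open Classical in
theorem countH_lt {V : Type} {H : V → Prop} {l m : List V} (hl : l.Nodup)
    (h : ∀ y ∈ l, H y → y ∈ m) {x : V} (hx : H x) (hxm : x ∈ m) (hxl : x ∉ l) :
    l.countP (fun y => decide (H y)) < m.countP (fun y => decide (H y)) := by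
  rw [List.countP_eq_length_filter, List.countP_eq_length_filter]
  have : (x :: l.filter (fun y => decide (H y))).length ≤ (m.filter (fun y => decide (H y))).length := by
    apply sub_len
    · rw [List.nodup_cons]; exact ⟨by simp [hxl], hl.filter _⟩
    · intro y hy; simp at hy ⊢
      rcases hy with rfl | ⟨h1, h2⟩
      · exact ⟨hxm, hx⟩
      · exact ⟨h y h1 h2, h2⟩
  simpa using this

theorem last_split {V : Type} {H : V → Prop} (l : List V) (h : ∃ y ∈ l, H y) :
    ∃ A y B, l = A ++ y :: B ∧ H y ∧ ∀ z ∈ B, ¬ H z := by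
  induction l with
  | nil => simp at h
  | cons a l ih =>
    by_cases hl : ∃ y ∈ l, H y
    · obtain ⟨A, y, B, rfl, h1, h2⟩ := ih hl
      exact ⟨a :: A, y, B, rfl, h1, h2⟩
    · push Not at hl
      obtain ⟨y, hy, hHy⟩ := h
      simp at hy
      rcases hy with rfl | hy
      · exact ⟨[], y, l, rfl, hHy, hl⟩
      · exact absurd hHy (hl y hy)

theorem exists_nbr {V : Type} [Fintype V] {G : SimpleGraph V} (hT : TC G)
    (h3 : 3 ≤ Fintype.card V) (x : V) : ∃ y, G.Adj x y := by
  classical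
  have : 1 < Fintype.card V := by omega
  obtain ⟨v, hv⟩ := Fintype.exists_ne_of_one_lt_card this x
  have : ∃ y, y ≠ v ∧ y ≠ x := by
    by_contra hc; push Not at hc
    have : Fintype.card V ≤ ({v, x} : Finset V).card := by
      rw [← Finset.card_univ]; apply Finset.card_le_card
      intro y _; simp; by_cases h : y = v
      · exact Or.inl h
      · exact Or.inr (hc y h)
    have := Finset.card_le_two (a := v) (b := x)
    omega
  obtain ⟨y, hy1, hy2⟩ := this
  obtain ⟨p, q, _, _, h1, _, h2⟩ := hT v (fun z => z = x) ⟨x, hv.symm, rfl⟩ ⟨y, hy1, hy2⟩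
  subst h1; exact ⟨q, h2⟩

theorem cyc_all_H {V : Type} [Fintype V] {G : SimpleGraph V} {H : V → Prop} (hT : TC G)
    (h3 : 3 ≤ Fintype.card V)
    (hd : ∀ u w, H u → H w → u ≠ w → Fintype.card V ≤ dg G u + dg G w) :
    ∃ C, Cyc G C ∧ ∀ h, H h → h ∈ C := by
  classical
  have hne : Nonempty V := Fintype.card_pos_iff.1 (by omega)
  obtain ⟨z0⟩ := hne
  obtain ⟨z1, hz⟩ := exists_nbr hT h3 z0
  obtain ⟨C0, hC0, _⟩ := edge_cycle hT h3 hz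
  obtain ⟨C, hC, hmax⟩ := exists_max (Cyc G) (fun l => l.countP (fun y => decide (H y)))
    (Fintype.card V) (fun l hl => le_trans List.countP_le_length (len_le_card hl.nodup)) ⟨C0, hC0⟩
  refine ⟨C, hC, ?_⟩
  by_contra hc; push Not at hc
  obtain ⟨x, hx, hxC⟩ := hc
  have contra : ∀ l, Cyc G l → (∀ y ∈ C, H y → y ∈ l) → x ∈ l → False := by
    intro l hl h1 h2
    have := countH_lt hC.nodup h1 hx h2 hxC
    have := hmax l hl
    omega
  by_cases hHC : ∃ y ∈ C, H y
  · -- path from x to C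
    have hreach : ∃ u r, u ∈ C ∧ Relation.ReflTransGen (fun a b => G.Adj a b ∧ a ∉ C ∧ b ∉ C) x r ∧
        G.Adj r u := by
      have h3' := hC.len
      obtain ⟨v, C', rfl⟩ : ∃ v C', C = v :: C' := by
        cases C with
        | nil => simp at h3'
        | cons a l => exact ⟨a, l, rfl⟩
      set C := v :: C' with hCdef
      obtain ⟨t, s, h1, e1, e2⟩ := hC.parts
      have Rout : ∀ r, Relation.ReflTransGen (fun a b => G.Adj a b ∧ a ∉ C ∧ b ∉ C) x r → r ∉ C := by
        intro r hr
        induction hr with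
        | refl => exact hxC
        | tail _ h _ => exact h.2.2
      obtain ⟨r, y, _, hy, hr, hyr, hry⟩ := hT v
        (fun r => Relation.ReflTransGen (fun a b => G.Adj a b ∧ a ∉ C ∧ b ∉ C) x r)
        ⟨x, by rintro rfl; exact hxC (by simp [hCdef]), Relation.ReflTransGen.refl⟩
        ⟨t, e1.ne', fun h => Rout t h (by simp [hCdef, h1.mem_hd])⟩
      refine ⟨y, r, ?_, hr, hry⟩
      by_contra hyC
      exact hyr (hr.tail ⟨hry, Rout r hr, hyC⟩)
    obtain ⟨u, r, huC, hr, hru⟩ := hreach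
    obtain ⟨P, hP, hPn, hPC⟩ := reach_path (Q := fun a => a ∉ C) hr hxC
    obtain ⟨L, hcy, hp⟩ := hC.rot_to huC
    obtain ⟨A, h, B, hL, hh, hB⟩ := last_split (H := H) (u :: L) (by
      obtain ⟨y, hy, hHy⟩ := hHC
      exact ⟨y, hp.mem_iff.2 hy, hHy⟩)
    have hhC : h ∈ C := hp.mem_iff.1 (by rw [hL]; simp)
    have hxh : x ≠ h := by rintro rfl; exact hxC hhC
    have hcyn := hcy.nodup
    obtain ⟨a, b, hpa, _, _, _⟩ := hcy
    have := hpa.hd_eq; subst this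
    rw [hL] at hpa hp hcyn
    have hQ := hP.app hru hpa.pre
    have hQn : (P ++ (A ++ [h])).Nodup := by
      rw [List.nodup_append]
      refine ⟨hPn, hcyn.sublist (by simp), ?_⟩
      intro p hp' q hq hpq
      subst hpq
      refine hPC p hp' (hp.mem_iff.1 ?_)
      simp at hq ⊢; tauto
    have hsub : ∀ y ∈ C, H y → y ∈ P ++ (A ++ [h]) := by
      intro y hy hHy
      have := hp.mem_iff.2 hy
      simp at this ⊢
      rcases this with h' | h' | h'
      · tauto
      · tauto
      · exact absurd hHy (hB y h')
    have hxP := hP.mem_hd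
    by_cases hlen : 3 ≤ (P ++ (A ++ [h])).length
    · obtain ⟨l, hl, hsubl⟩ := closure_lem hQ hQn hlen (hd x h hx hh hxh)
      exact contra l hl (fun y h1 h2 => hsubl (hsub y h1 h2)) (hsubl (by simp [hxP]))
    · have hP1 := List.length_pos_iff.2 hP.ne
      have hA : A = [] := by
        rw [← List.length_eq_zero_iff]; simp at hlen; omega
      have hP1 : P = [x] := by
        obtain ⟨P', rfl⟩ := hP.hd
        have : P' = [] := by
          rw [← List.length_eq_zero_iff]; simp at hlen; omega
        rw [this]
      subst hA; subst hP1
      have hxh' : G.Adj x h := by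
        have := (hQ.consD (by simp)).2
        obtain ⟨c, h1, h2⟩ := this
        have := h2.hd_eq; subst this; exact h1
      obtain ⟨l, hl, h1, h2⟩ := edge_cycle hT h3 hxh'
      refine contra l hl (fun y hy hHy => ?_) h1
      have := hsub y hy hHy
      simp at this
      rcases this with rfl | rfl <;> assumption
  · push Not at hHC
    obtain ⟨y, hy⟩ := exists_nbr hT h3 x
    obtain ⟨l, hl, h1, h2⟩ := edge_cycle hT h3 hy
    exact contra l hl (fun y hy hHy => absurd hHy (hHC y hy)) h1

theorem ham_thm {V : Type} [Fintype V] {G : SimpleGraph V} {H : V → Prop} (hT : TC G)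
    (h3 : 3 ≤ Fintype.card V) (hNC : NC G H) (hZ : NZ G H)
    (hd : ∀ u w, H u → H w → u ≠ w → Fintype.card V ≤ dg G u + dg G w) :
    ∃ C, Cyc G C ∧ ∀ v, v ∈ C := by
  classical
  obtain ⟨C0, hC0⟩ := cyc_all_H hT h3 hd
  obtain ⟨C, ⟨hC, hH⟩, hmax⟩ := exists_max (fun l => Cyc G l ∧ ∀ h, H h → h ∈ l)
    (fun l => l.length) (Fintype.card V) (fun l hl => len_le_card hl.1.nodup) ⟨C0, hC0⟩
  refine ⟨C, hC, ?_⟩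
  by_contra hc; push Not at hc
  obtain ⟨x0, hx0⟩ := hc
  have hCl := hC.len
  rcases lemE hT hNC hZ hC hH hx0 with ⟨x, hx, l, hl, hp⟩ | ⟨l, s, t, hl, hn, hs, ht, hsub, hlen⟩ |
    ⟨u, u', M, r, r', hcy, hp, hr, hr', e1, e2, e3⟩
  · have := hmax l ⟨hl, fun h hh => hp.mem_iff.2 (by simp [hH h hh])⟩
    have := hp.length_eq
    simp at *; omega
  · obtain ⟨l', hl', hsub'⟩ := closure_lem hl hn (by omega)
      (hd s t hs ht (hl.ends_ne hn (by omega)))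
    have := hmax l' ⟨hl', fun h hh => hsub' (hsub (hH h hh))⟩
    have := sub_len hn hsub'
    simp at *; omega
  · obtain ⟨t, s, h1, ut, su⟩ := hcy.parts
    have := h1.hd_eq; subst this
    have hper : (u :: r :: r' :: t :: M).Perm (r :: r' :: C) := by
      refine List.Perm.trans ?_ ((hp.cons r').cons r)
      simp [List.perm_iff_count, List.count_cons] <;> omega
    have hl : Cyc G (u :: r :: r' :: t :: M) := by
      refine Cyc.mk' (Pa.cons e1.symm (Pa.cons e3 (Pa.cons e2 h1))) su hper ?_ (by simp; omega)
      rw [List.nodup_cons, List.nodup_cons]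
      refine ⟨?_, hr', hC.nodup⟩
      simp; exact ⟨e3.ne, hr⟩
    have := hmax _ ⟨hl, fun h hh => hper.mem_iff.2 (by simp [hH h hh])⟩
    have := hper.length_eq
    simp at *; omega


theorem nil_or_snoc {V : Type} (l : List V) : l = [] ∨ ∃ m x, l = m ++ [x] := by
  rcases List.eq_nil_or_concat l with h | ⟨m, x, h⟩
  · exact Or.inl h
  · exact Or.inr ⟨m, x, by rw [h, List.concat_eq_append]⟩

theorem cn_ge {V : Type} {G : SimpleGraph V} {v : V} {m l : List V} (hm : m.Nodup) (hs : m ⊆ l)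
    (ha : ∀ y ∈ m, G.Adj v y) : m.length ≤ cn G v l := by
  unfold cn
  rw [List.countP_eq_length_filter]
  apply sub_len hm
  intro y hy; simp [hs hy, ha y hy]

theorem cn_two {V : Type} {G : SimpleGraph V} {v : V} {l : List V} (hl : l.Nodup)
    (h : 2 ≤ cn G v l) : ∃ x y, x ∈ l ∧ y ∈ l ∧ x ≠ y ∧ G.Adj v x ∧ G.Adj v y := by
  classical
  unfold cn at h
  rw [List.countP_eq_length_filter] at h
  have hn := hl.filter (fun y => decide (G.Adj v y))
  have hm : ∀ z, z ∈ l.filter (fun y => decide (G.Adj v y)) → z ∈ l ∧ G.Adj v z := by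
    intro z hz; simpa using hz
  match hf : l.filter (fun y => decide (G.Adj v y)), h with
  | x :: y :: m, _ =>
    rw [hf] at hn hm
    simp at hn
    have h1 := hm x (by simp)
    have h2 := hm y (by simp)
    exact ⟨x, y, h1.1, h2.1, hn.1.1, h1.2, h2.2⟩

theorem cn_three {V : Type} {G : SimpleGraph V} {v : V} {l : List V} (hl : l.Nodup)
    (h : 3 ≤ cn G v l) : ∃ x y z, x ∈ l ∧ y ∈ l ∧ z ∈ l ∧ x ≠ y ∧ x ≠ z ∧ y ≠ z ∧
      G.Adj v x ∧ G.Adj v y ∧ G.Adj v z := by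
  classical
  unfold cn at h
  rw [List.countP_eq_length_filter] at h
  have hn := hl.filter (fun y => decide (G.Adj v y))
  have hm : ∀ z, z ∈ l.filter (fun y => decide (G.Adj v y)) → z ∈ l ∧ G.Adj v z := by
    intro z hz; simpa using hz
  match hf : l.filter (fun y => decide (G.Adj v y)), h with
  | x :: y :: z :: m, _ =>
    rw [hf] at hn hm
    simp at hn
    have h1 := hm x (by simp)
    have h2 := hm y (by simp)
    have h3 := hm z (by simp)
    exact ⟨x, y, z, h1.1, h2.1, h3.1, hn.1.1, hn.1.2.1, hn.2.1.1, h1.2, h2.2, h3.2⟩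

theorem light_ext {V : Type} [Fintype V] {G : SimpleGraph V} (hT : TC G)
    (hNC : NC G (fun _ => False)) (hZ : NZ G (fun _ => False)) {k : ℕ} (hk : HasCyc G k)
    (hkn : k < Fintype.card V) : HasCyc G (k + 1) := by
  classical
  by_contra hno
  obtain ⟨C, hC, rfl⟩ := hk
  have hx0 : ∃ x0, x0 ∉ C := by
    by_contra hc; push Not at hc
    have := card_full hC.nodup hc
    omega
  obtain ⟨x0, hx0⟩ := hx0
  rcases lemE hT hNC hZ hC (by simp) hx0 with ⟨x, hx, l, hl, hp⟩ | ⟨l, s, t, hl, hn, hs, ht, _⟩ |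
    ⟨u, u', M, r, r', hcy, hp, hr, hr', e1, e2, e3⟩
  · exact hno ⟨l, hl, by rw [hp.length_eq]; simp⟩
  · exact hs
  rw [← hp.length_eq] at hno
  replace hr : r ∉ u :: u' :: M := fun h => hr (hp.mem_iff.1 h)
  replace hr' : r' ∉ u :: u' :: M := fun h => hr' (hp.mem_iff.1 h)
  clear hp hC hkn hx0 C
  have hNN : ∀ x, x ∉ u :: u' :: M → NN G (fun _ => False) x (u :: u' :: M) := by
    intro x hx
    constructor
    · intro l a b D h1 h2 h3 h4
      have h5 := h4.trans (h3.cons x)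
      exact hno ⟨l, Cyc.mk' h1 h2 h5 (List.nodup_cons.2 ⟨hx, hcy.nodup⟩) (by simp), by
        rw [h5.length_eq]; simp⟩
    · intro l a b D h1 h2 h3 h4; exact h2.elim
  have hn := hcy.nodup
  have h3 := hcy.len
  have hMne : M ≠ [] := by rintro rfl; simp at h3
  obtain ⟨_, t1, hpa, uu', t1u⟩ := hcy.parts
  have := hpa.hd_eq; subst this
  rename_i u'
  obtain ⟨_, s, u's, hM⟩ := hpa.consD hMne
  have A1 := att (hNN r hr) hNC (by simp) hn h3 hr (List.Perm.refl _) hpa uu' t1u e1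
  have hper2 : (u' :: (M ++ [u])).Perm (u :: u' :: M) := by
    simp [List.perm_iff_count, List.count_cons] <;> omega
  have A2 := att (hNN r' hr') hNC (by simp) hn h3 hr' hper2 (hM.snoc t1u) u's uu' e2
  obtain ⟨ru', rt1, B1⟩ := A1
  obtain ⟨r's, r'u, B2⟩ := A2
  replace B1 : G.Adj t1 u' := by simpa using B1
  replace B2 : G.Adj u s := by simpa using B2
  have nodB : (r :: r' :: u :: u' :: M).Nodup := by
    rw [List.nodup_cons, List.nodup_cons]
    refine ⟨?_, hr', hn⟩
    rw [List.mem_cons, not_or]; exact ⟨e3.ne, hr⟩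
  have fin : ∀ {l a b} (y), Pa G a l b → G.Adj b a → (y :: l).Perm (r :: r' :: u :: u' :: M) →
      False := by
    intro l a b y h1 h2 h4
    have hlen := h4.length_eq
    simp at hlen
    have hM1 := List.length_pos_iff.2 hMne
    refine hno ⟨l, ⟨a, b, h1, h2, (h4.nodup_iff.2 nodB).of_cons, by omega⟩, by simp; omega⟩
  rcases nil_or_snoc M with rfl | ⟨M1, z1, rfl⟩
  · exact hMne rfl
  have := hM.lst_eq; subst this
  rcases nil_or_snoc M1 with rfl | ⟨Q, t2, rfl⟩
  · -- length 3
    have := hM.hd_eq; subst this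
    refine fin s (Pa.cons e1.symm (Pa.cons e3 (Pa.cons e2 (Pa.one u')))) uu'.symm ?_
    simp [List.perm_iff_count, List.count_cons] <;> omega
  rcases nil_or_snoc Q with rfl | ⟨N, t3, rfl⟩
  · have := hM.hd_eq; subst this
    refine fin t1 (Pa.cons B2.symm (Pa.cons e1.symm (Pa.cons e3 (Pa.cons e2 (Pa.one u'))))) u's ?_
    simp [List.perm_iff_count, List.count_cons] <;> omega
  have hM' := hM
  rw [List.append_assoc] at hM
  obtain ⟨w3, w2, hQ, t32, hM2⟩ := hM.split (by simp) (by simp)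
  have := hM2.hd_eq; subst this
  obtain ⟨_, w1, t21, hM3⟩ := hM2.consD (by simp)
  have := hM3.hd_eq; subst this
  have := hQ.lst_eq; subst this
  have k1 : ¬ G.Adj u w2 := by
    intro h
    refine fin w1 (hQ.app t32 (Pa.cons h.symm (Pa.cons e1.symm (Pa.cons e3 (Pa.cons e2
      (Pa.one u')))))) u's ?_
    simp [List.perm_iff_count, List.count_cons] <;> omega
  have k2 : ¬ G.Adj u' w2 := by
    intro h
    refine fin w1 (hQ.app t32 (Pa.cons h.symm (Pa.cons e2.symm (Pa.cons e3.symm (Pa.cons e1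
      (Pa.one u)))))) B2 ?_
    simp [List.perm_iff_count, List.count_cons] <;> omega
  have k3 : ¬ G.Adj w1 w3 := by
    intro h
    refine fin w2 (hQ.app h.symm (Pa.cons t1u (Pa.cons e1.symm (Pa.cons e3 (Pa.cons e2
      (Pa.one u')))))) u's ?_
    simp [List.perm_iff_count, List.count_cons] <;> omega
  have k0 : ¬ G.Adj r' w1 := by
    intro h
    refine fin r (hQ.app t32 (Pa.cons t21 (Pa.cons h.symm (Pa.cons e2 (Pa.cons uu'.symm
      (Pa.one u)))))) B2 ?_
    simp [List.perm_iff_count, List.count_cons] <;> omega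
  have k4 : ¬ G.Adj r w3 := by
    intro h
    refine fin w2 (hQ.app h.symm (Pa.cons e3 (Pa.cons e2 (Pa.cons B1.symm (Pa.cons t1u
      (Pa.one u)))))) B2 ?_
    simp [List.perm_iff_count, List.count_cons] <;> omega
  have k5 : ¬ G.Adj r' w3 := by
    intro h
    refine fin w2 (hQ.app h.symm (Pa.cons e3.symm (Pa.cons e1 (Pa.cons t1u.symm (Pa.cons B1
      (Pa.one u')))))) u's ?_
    simp [List.perm_iff_count, List.count_cons] <;> omega
  have hne13 : w1 ≠ w3 := by
    rintro rfl; simp [List.nodup_append] at nodB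
  have hr13 : r ≠ w3 := by rintro rfl; simp at hr
  have hr11 : r ≠ w1 := by rintro rfl; simp at hr
  have hr'13 : r' ≠ w3 := by rintro rfl; simp at hr'
  have hr'11 : r' ≠ w1 := by rintro rfl; simp at hr'
  have k6 : ¬ G.Adj u w3 := by
    intro h
    exact hNC u r w3 w1 e1.symm h t1u.symm k4 rt1 (fun h => k3 h.symm) hr13 hr11 hne13.symm
      (by simp) (by simp)
  have k7 : ¬ G.Adj u' w3 := by
    intro h
    exact hNC u' r' w3 w1 e2.symm h B1.symm k5 k0 (fun h => k3 h.symm) hr'13 hr'11 hne13.symm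
      (by simp) (by simp)
  have := hZ u u' w1 w2 w3 uu' t1u.symm B1.symm t21.symm t32.symm k1 k2 k6 k7 k3
  simp at this

theorem dg_ge_two {V : Type} [Fintype V] {G : SimpleGraph V} (hT : TC G)
    (h3 : 3 ≤ Fintype.card V) (v : V) : 2 ≤ dg G v := by
  classical
  obtain ⟨y, hy⟩ := exists_nbr hT h3 v
  obtain ⟨l, hl, hv, _⟩ := edge_cycle hT h3 hy
  obtain ⟨L, hc, hp⟩ := hl.rot_to hv
  obtain ⟨t, s, h1, h2, h4⟩ := hc.parts
  have hne : t ≠ s := h1.ends_ne hc.nodup.of_cons (by have := hc.len; simp at this; omega)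
  refine cn_ge (m := [t, s]) (by simpa using hne) (by intro y _; simp) ?_
  intro z hz; simp at hz
  rcases hz with rfl | rfl
  · exact h2
  · exact h4.symm

theorem light_pan {V : Type} [Fintype V] {G : SimpleGraph V} (hT : TC G)
    (h3 : 3 ≤ Fintype.card V)
    (hNC : NC G (fun _ => False)) (hZ : NZ G (fun _ => False)) :
    (∀ k, 3 ≤ k → k ≤ Fintype.card V → HasCyc G k) ∨ ∀ v, dg G v = 2 := by
  classical
  by_cases hd : ∀ v, dg G v = 2
  · exact Or.inr hd
  left
  push Not at hd
  obtain ⟨v, hv⟩ := hd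
  have hv3 : 3 ≤ dg G v := by have := dg_ge_two hT h3 v; omega
  obtain ⟨x, y, z, _, _, _, xy, xz, yz, ax, ay, az⟩ := cn_three (Finset.nodup_toList _) hv3
  have tri : ∀ {a b}, G.Adj v a → G.Adj v b → G.Adj a b → HasCyc G 3 := by
    intro a b h1 h2 h3
    exact ⟨[v, a, b], ⟨v, b, Pa.cons h1 (Pa.cons h3 (Pa.one b)), h2.symm, by
      simp [h1.ne, h2.ne, h3.ne], by simp⟩, rfl⟩
  have h3c : HasCyc G 3 := by
    by_contra hc
    exact hNC v x y z ax ay az (fun h => hc (tri ax ay h)) (fun h => hc (tri ax az h))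
      (fun h => hc (tri ay az h)) xy xz yz (by simp) (by simp)
  intro k hk
  induction k, hk using Nat.le_induction with
  | base => intro _; exact h3c
  | succ m hm ih => intro h; exact light_ext hT hNC hZ (ih (by omega)) (by omega)

theorem cross2 {V : Type} {G : SimpleGraph V} {a b : V} (l m : List V) (hlen : l.length = m.length)
    (h : l.length < cn G a l + cn G b m) :
    ∃ (i : ℕ) (h1 : i < l.length) (h2 : i < m.length), G.Adj a l[i] ∧ G.Adj b m[i] := by
  classical
  induction l generalizing m with
  | nil =>
    cases m with
    | nil => simp [cn_nil] at h
    | cons _ _ => simp at hlen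
  | cons x l ih =>
    cases m with
    | nil => simp at hlen
    | cons y m =>
      by_cases hxy : G.Adj a x ∧ G.Adj b y
      · exact ⟨0, by simp, by simp, hxy.1, hxy.2⟩
      · have hlen' : l.length = m.length := by simpa using hlen
        have : l.length < cn G a l + cn G b m := by
          rw [cn_cons, cn_cons, List.length_cons] at h
          split_ifs at h <;> first | tauto | omega
        obtain ⟨i, h1, h2, h3, h4⟩ := ih m hlen' this
        exact ⟨i + 1, by simp; omega, by simp; omega, by simpa using h3, by simpa using h4⟩

theorem split1 {V : Type} (l : List V) (i : ℕ) (h : i < l.length) :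
    ∃ A B, l = A ++ l[i] :: B ∧ A.length = i := by
  refine ⟨l.take i, l.drop (i + 1), ?_, by simp; omega⟩
  rw [List.getElem_cons_drop, List.take_append_drop]

theorem split2 {V : Type} (l : List V) (i j : ℕ) (hij : i < j) (h : j < l.length) :
    ∃ A M B, l = A ++ l[i] :: M ++ l[j] :: B ∧ A.length = i ∧ M.length = j - i - 1 := by
  obtain ⟨A, B, h1, h2⟩ := split1 l i (by omega)
  obtain ⟨A', B', h3, h4⟩ := split1 l j h
  refine ⟨A, (A'.drop (i + 1)), B', ?_, h2, by simp; omega⟩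
  have hA : A' = A ++ l[i] :: A'.drop (i + 1) := by
    have e1 : l.take (i + 1) = A ++ [l[i]] := by
      conv_lhs => rw [h1]
      rw [List.take_append, h2, List.take_of_length_le (by omega)]; simp
    have e2 : l.take (i + 1) = A'.take (i + 1) := by
      conv_lhs => rw [h3]
      rw [List.take_append_of_le_length (by omega)]
    conv_lhs => rw [← List.take_append_drop (i + 1) A', ← e2, e1]
    simp
  rw [← hA]; exact h3

theorem shift_lem {V : Type} {G : SimpleGraph V} {C : List V} (hC : Cyc G C) {v : V}
    (hv : v ∉ C) (hd : C.length < 2 * cn G v C) {k : ℕ} (hk : 3 ≤ k) (hkc : k ≤ C.length + 1) :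
    HasCyc G k := by
  have hrot : (C.rotate (k - 2)).Perm C := List.rotate_perm C _
  obtain ⟨i, h1, h2, h3, h4⟩ := cross2 (G := G) (a := v) (b := v) C (C.rotate (k - 2)) (by simp)
    (by rw [cn_perm G v hrot]; omega)
  rw [List.getElem_rotate] at h4
  have hD : Cyc G (C.rotate i) := by
    rw [List.rotate_eq_drop_append_take (by omega)]
    apply Cyc.rot; rw [List.take_append_drop]; exact hC
  have hDl : (C.rotate i).length = C.length := by simp
  have e0 : (C.rotate i)[0]'(by omega) = C[i] := by
    rw [List.getElem_rotate]; congr 1; rw [Nat.zero_add, Nat.mod_eq_of_lt h1]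
  have e1 : (C.rotate i)[k - 2]'(by omega) = C[(i + (k - 2)) % C.length]'(Nat.mod_lt _ (by omega)) := by
    rw [List.getElem_rotate]; congr 1; rw [Nat.add_comm]
  obtain ⟨A, B, hs, hA⟩ := split1 (C.rotate i) (k - 2) (by omega)
  have hvD : v ∉ C.rotate i := fun h => hv ((List.rotate_perm C i).mem_iff.1 h)
  obtain ⟨a, b, hp, _, hn, _⟩ := hD
  have ha : a = C[i] := by
    rw [← e0]
    obtain ⟨D', hD'⟩ := hp.hd
    simp [hD']
  rw [e1] at hs
  rw [hs] at hp hn hvD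
  refine ⟨v :: (A ++ [C[(i + (k - 2)) % C.length]'(Nat.mod_lt _ (by omega))]), ⟨v, _, Pa.cons (ha ▸ h3) hp.pre, h4.symm, ?_, ?_⟩, ?_⟩
  · rw [List.nodup_cons]
    refine ⟨?_, hn.sublist (by simp)⟩
    intro hh; apply hvD
    rw [List.mem_append] at hh ⊢
    rcases hh with hh | hh
    · exact Or.inl hh
    · right; simp at hh; simp [hh]
  · simp; omega
  · simp; omega

theorem hakimi {V : Type} {G : SimpleGraph V} {l : List V} {a b : V} (hp : Pa G a l b)
    (hba : G.Adj b a) (hn : l.Nodup) (h3 : 3 ≤ l.length)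
    (hd : l.length + 1 ≤ cn G a l + cn G b l) {k : ℕ} (hk : 3 ≤ k) (hkl : k ≤ l.length) :
    HasCyc G k := by
  classical
  obtain ⟨l', rfl⟩ := hp.hd
  rcases nil_or_snoc l' with rfl | ⟨m, b', rfl⟩
  · simp at h3
  have hb : b = b' := by
    have := hp.lst_eq (m := a :: m) (x := b'); exact this
  subst hb
  have hml : m ≠ [] := by rintro rfl; simp at h3
  obtain ⟨_, c, ac, hp2⟩ := hp.consD (by simp)
  obtain ⟨d, b', hm, db, hb⟩ := hp2.split hml (by simp)
  obtain rfl := hb.hd_eq.symm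
  have ca : cn G a (a :: (m ++ [b])) = cn G a m + 1 := by
    rw [cn_cons_neg (by simp), cn_append, cn_cons_pos hba.symm, cn_nil]
  have cb : cn G b (a :: (m ++ [b])) = cn G b m + 1 := by
    rw [cn_cons_pos hba, cn_append, cn_cons_neg (by simp), cn_nil]
  rw [ca, cb] at hd
  simp only [List.length_cons, List.length_append, List.length_nil] at hd h3 hkl
  have hrot : (m.rotate (k - 3)).Perm m := List.rotate_perm m _
  obtain ⟨i, h1, h2, h4, h5⟩ := cross2 (G := G) (a := a) (b := b) m (m.rotate (k - 3)) (by simp)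
    (by rw [cn_perm G b hrot]; omega)
  rw [List.getElem_rotate] at h5
  rcases Nat.lt_or_ge (i + (k - 3)) m.length with hlt | hge
  · have em : (i + (k - 3)) % m.length = i + (k - 3) := Nat.mod_eq_of_lt hlt
    simp only [em] at h5
    rcases Nat.eq_or_lt_of_le hk with rfl | hk'
    · simp only [Nat.sub_self, Nat.add_zero] at h5
      exact ⟨[a, m[i], b], ⟨a, b, Pa.cons h4 (Pa.cons h5.symm (Pa.one b)), hba, by
        simp [h4.ne, h5.ne', hba.ne'], by simp⟩, rfl⟩
    · obtain ⟨A, M, B, hs, hA, hM⟩ := split2 m i (i + (k - 3)) (by omega) hlt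
      generalize m[i] = x at *
      generalize m[i + (k - 3)] = y at *
      subst hs
      simp only [List.append_assoc, List.cons_append] at hm
      have hq := hm.suf
      have hq2 : Pa G x (x :: M ++ [y]) y := Pa.pre (s := x :: M) hq
      refine ⟨a :: ((x :: M ++ [y]) ++ [b]), ⟨a, b, Pa.cons h4 (hq2.snoc h5.symm), hba, ?_, by simp⟩, ?_⟩
      · refine hn.sublist ?_
        apply List.Sublist.cons_cons
        apply List.Sublist.append _ (List.Sublist.refl _)
        simp
      · simp; omega
  · have em : (i + (k - 3)) % m.length = i + (k - 3) - m.length := by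
      rw [Nat.mod_eq_sub_mod hge, Nat.mod_eq_of_lt (by omega)]
    simp only [em] at h5
    obtain ⟨x, y, A, M, B, hs, hbx, hay, hlen⟩ : ∃ x y A M B, m = A ++ x :: M ++ y :: B ∧
        G.Adj b x ∧ G.Adj a y ∧ A.length + B.length + 4 = k := by
      obtain ⟨A, M, B, hs, hA, hM⟩ := split2 m (i + (k - 3) - m.length) i (by omega) h1
      have hlen := congrArg List.length hs
      simp only [List.length_append, List.length_cons] at hlen
      exact ⟨_, _, A, M, B, hs, h5, h4, by omega⟩
    rw [hs] at hm hn
    simp only [List.append_assoc, List.cons_append] at hm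
    have hq1 := hm.pre
    have hq2 : Pa G y (y :: B) d := by
      have : A ++ x :: (M ++ y :: B) = (A ++ x :: M) ++ y :: B := by simp
      rw [this] at hm; exact hm.suf
    have hsub : (a :: ((A ++ [x]) ++ (y :: B ++ [b]))).Sublist (a :: (A ++ x :: M ++ y :: B ++ [b])) := by
      apply List.Sublist.cons_cons
      simp
    have hper : (a :: ((A ++ [x]) ++ (b :: (y :: B).reverse))).Perm
        (a :: ((A ++ [x]) ++ (y :: B ++ [b]))) := by
      simp [List.perm_iff_count, List.count_cons] <;> omega
    refine ⟨_, Cyc.mk' (Pa.cons ac (hq1.app hbx.symm (Pa.cons db.symm hq2.rev))) hay.symm hper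
      (hn.sublist hsub) ?_, ?_⟩
    · simp only [List.length_cons, List.length_append, List.length_nil]; omega
    · rw [hper.length_eq]; simp; omega


theorem Pa.map {V W : Type} {G : SimpleGraph V} {f : W → V} {a b : W} {l : List W}
    (h : Pa (G.comap f) a l b) : Pa G (f a) (l.map f) (f b) := by
  induction h with
  | one a => exact Pa.one _
  | cons e _ ih => exact Pa.cons e ih

theorem HasCyc.map {V W : Type} {G : SimpleGraph V} {f : W → V} (hf : Function.Injective f) {k : ℕ}
    (h : HasCyc (G.comap f) k) : HasCyc G k := by
  obtain ⟨l, ⟨a, b, hp, e, hn, h3⟩, rfl⟩ := h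
  exact ⟨l.map f, ⟨f a, f b, hp.map, e, hn.map hf, by simpa using h3⟩, by simp⟩

/-- The subgraph induced by a list. -/
abbrev ind {V : Type} (G : SimpleGraph V) (L : List V) : SimpleGraph {x // x ∈ L} :=
  G.comap Subtype.val

theorem ind_dg {V : Type} (G : SimpleGraph V) {L : List V} (hn : L.Nodup) [Fintype {x // x ∈ L}]
    (x : {x // x ∈ L}) : dg (ind G L) x = cn G x.1 L := by
  classical
  rw [dg_full (ind G L) x (l := L.attach) (List.nodup_attach.2 hn) (by simp)]
  have key : cn G x.1 (L.attach.map Subtype.val) = cn (ind G L) x L.attach := by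
    unfold cn
    rw [List.countP_map]
    rfl
  rw [List.attach_map_subtype_val] at key
  exact key.symm

theorem ind_card {V : Type} {L : List V} (hn : L.Nodup) [Fintype {x // x ∈ L}] :
    Fintype.card {x // x ∈ L} = L.length := by
  rw [← card_full (l := L.attach) (List.nodup_attach.2 hn) (by simp)]; simp

theorem chain_const {V : Type} {G : SimpleGraph V} {S : V → Prop} {a b : V} {l : List V}
    (h : Pa G a l b) (hs : ∀ x y, x ∈ l → y ∈ l → G.Adj x y → (S x ↔ S y)) :
    ∀ x ∈ l, (S x ↔ S a) := by
  induction h with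
  | one a => simp
  | @cons a c b l e h ih =>
    intro x hx
    have h1 := hs a c (by simp) (by simp [h.mem_hd]) e
    rcases List.mem_cons.1 hx with rfl | hx
    · rfl
    · rw [h1]
      exact ih (fun x y h1 h2 => hs x y (by simp [h1]) (by simp [h2])) x hx

/-- No vertex of the path is a cut of it. -/
def NoCut {V : Type} (G : SimpleGraph V) (L : List V) : Prop :=
  ∀ l1 u l2, L = l1 ++ u :: l2 → l1 ≠ [] → l2 ≠ [] → ∃ x ∈ l1, ∃ y ∈ l2, G.Adj x y

theorem ind_TC {V : Type} {G : SimpleGraph V} {L : List V} {a b : V} (hp : Pa G a L b)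
    (hn : L.Nodup) (hc : NoCut G L) : TC (ind G L) := by
  classical
  rintro ⟨v, hv⟩ S ⟨⟨x, hx⟩, hxv, hSx⟩ ⟨⟨y, hy⟩, hyv, hSy⟩
  by_contra hcon
  push Not at hcon
  have hxv : x ≠ v := fun h => hxv (Subtype.ext h)
  have hyv : y ≠ v := fun h => hyv (Subtype.ext h)
  let T : V → Prop := fun z => ∃ h : z ∈ L, S ⟨z, h⟩
  have hT : ∀ z w, z ∈ L → w ∈ L → z ≠ v → w ≠ v → G.Adj z w → (T z ↔ T w) := by
    intro z w hz hw hzv hwv e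
    constructor
    · rintro ⟨_, hs⟩
      by_contra hc
      exact hcon ⟨z, hz⟩ ⟨w, hw⟩ (by simpa using hzv) (by simpa using hwv) hs
        (fun h => hc ⟨hw, h⟩) e
    · rintro ⟨_, hs⟩
      by_contra hc
      exact hcon ⟨w, hw⟩ ⟨z, hz⟩ (by simpa using hwv) (by simpa using hzv) hs
        (fun h => hc ⟨hz, h⟩) e.symm
  have hTx : T x := ⟨hx, hSx⟩
  have hTy : ¬ T y := fun ⟨_, h⟩ => hSy h
  obtain ⟨l1, l2, rfl⟩ := List.append_of_mem hv
  have hv1 : v ∉ l1 := by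
    intro h; rw [List.nodup_append] at hn; exact hn.2.2 v h v (by simp) rfl
  have hv2 : v ∉ l2 := by
    intro h; rw [List.nodup_append] at hn; simp at hn; exact hn.2.1.1 h
  have hx' : x ∈ l1 ∨ x ∈ l2 := by simp at hx; tauto
  have hy' : y ∈ l1 ∨ y ∈ l2 := by simp at hy; tauto
  have ne1 : ∀ z ∈ l1, z ≠ v := fun z hz h => hv1 (h ▸ hz)
  have ne2 : ∀ z ∈ l2, z ≠ v := fun z hz h => hv2 (h ▸ hz)
  have k1 : ∀ z ∈ l1, ∀ w ∈ l1, (T z ↔ T w) := by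
    intro z hz w hw
    obtain ⟨_, _, h1, _, _⟩ := hp.split (List.ne_nil_of_mem hz) (by simp)
    have := chain_const (S := T) h1 (fun p q hp hq e => hT p q (by simp [hp]) (by simp [hq])
      (ne1 p hp) (ne1 q hq) e)
    rw [this z hz, this w hw]
  have k2 : ∀ z ∈ l2, ∀ w ∈ l2, (T z ↔ T w) := by
    intro z hz w hw
    have hp' : Pa G a ((l1 ++ [v]) ++ l2) b := by simpa using hp
    obtain ⟨_, _, _, _, h1⟩ := hp'.split (by simp) (List.ne_nil_of_mem hz)
    have := chain_const (S := T) h1 (fun p q hp hq e => hT p q (by simp [hp]) (by simp [hq])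
      (ne2 p hp) (ne2 q hq) e)
    rw [this z hz, this w hw]
  have k3 : ∀ z ∈ l1, ∀ w ∈ l2, (T z ↔ T w) := by
    intro z hz w hw
    obtain ⟨p, hp, q, hq, e⟩ := hc l1 v l2 rfl (List.ne_nil_of_mem hz) (List.ne_nil_of_mem hw)
    rw [k1 z hz p hp, k2 w hw q hq]
    exact hT p q (by simp [hp]) (by simp [hq]) (ne1 p hp) (ne2 q hq) e
  rcases hx' with hx' | hx' <;> rcases hy' with hy' | hy'
  · exact hTy ((k1 x hx' y hy').1 hTx)
  · exact hTy ((k3 x hx' y hy').1 hTx)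
  · exact hTy ((k3 y hy' x hx').2 hTx)
  · exact hTy ((k2 x hx' y hy').1 hTx)

theorem common {V : Type} [Fintype V] {G : SimpleGraph V} {u w p q : V}
    (hd : [u, w, p, q].Nodup) (huw : ¬ G.Adj u w)
    (h : ∀ y, G.Adj u y → G.Adj w y → y = p ∨ y = q) : dg G u + dg G w ≤ Fintype.card V := by
  obtain ⟨O, h1, h2⟩ := outside hd
  rw [dg_full G u h1 h2, dg_full G w h1 h2, ← card_full h1 h2]
  have hO := cn_two_le (G := G) (s := u) (t := w) (O := O) (by
    intro y hy a b
    rw [List.nodup_append] at h1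
    rcases h y a b with rfl | rfl
    · exact h1.2.2 y (by simp) y hy rfl
    · exact h1.2.2 y (by simp) y hy rfl)
  have hwu : ¬ G.Adj w u := fun h => huw h.symm
  simp only [List.cons_append, List.nil_append, List.length_cons]
  rw [cn_cons_neg (v := u) (x := u) (by simp), cn_cons_neg huw, cn_cons_neg hwu,
    cn_cons_neg (v := w) (x := w) (by simp)]
  have := cn_cons_le G u p (q :: O)
  have := cn_cons_le G u q O
  have := cn_cons_le G w p (q :: O)
  have := cn_cons_le G w q O
  omega


/-- Cycles of all lengths. -/
def Pan {V : Type} [Fintype V] (G : SimpleGraph V) : Prop :=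
  ∀ k, 3 ≤ k → k ≤ Fintype.card V → HasCyc G k

/-- The main claim for one graph. -/
def MTS {V : Type} [Fintype V] (G : SimpleGraph V) (H : V → Prop) : Prop :=
  TC G → 3 ≤ Fintype.card V → NC G H → NZ G H →
  (∀ u w, H u → H w → u ≠ w → Fintype.card V + 1 ≤ dg G u + dg G w) →
  Pan G ∨ ∀ v, dg G v = 2

theorem ind_ham {V : Type} {G : SimpleGraph V} {H : V → Prop} {L : List V} {a b : V}
    (hp : Pa G a L b) (hn : L.Nodup) (hc : NoCut G L) (h3 : 3 ≤ L.length) (hNC : NC G H)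
    (hNZ : NZ G H) (hs : ∀ u w, u ∈ L → w ∈ L → H u → H w → u ≠ w →
      L.length ≤ cn G u L + cn G w L) : ∃ C, Cyc G C ∧ C.Perm L := by
  classical
  obtain ⟨C, ⟨s, t, h1, h2, h4, h5⟩, hC⟩ := ham_thm (G := ind G L) (H := fun x => H x.1)
    (ind_TC hp hn hc) (by rw [ind_card hn]; exact h3)
    (fun c x y z h1 h2 h3 h4 h5 h6 h7 h8 h9 => hNC c.1 x.1 y.1 z.1 h1 h2 h3 h4 h5 h6
      (fun h => h7 (Subtype.ext h)) (fun h => h8 (Subtype.ext h)) (fun h => h9 (Subtype.ext h)))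
    (fun a1 a2 a3 a4 a5 => hNZ a1.1 a2.1 a3.1 a4.1 a5.1)
    (fun u w hu hw huw => by
      rw [ind_card hn, ind_dg G hn, ind_dg G hn]
      exact hs u.1 w.1 u.2 w.2 hu hw (fun h => huw (Subtype.ext h)))
  refine ⟨C.map Subtype.val, ⟨_, _, h1.map, h2, h4.map Subtype.val_injective, by simpa using h5⟩, ?_⟩
  rw [List.perm_ext_iff_of_nodup (h4.map Subtype.val_injective) hn]
  intro x
  constructor
  · intro hx
    obtain ⟨y, _, rfl⟩ := List.mem_map.1 hx
    exact y.2
  · intro hx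
    exact List.mem_map.2 ⟨⟨x, hx⟩, hC _, rfl⟩

theorem ind_pan {V : Type} {G : SimpleGraph V} {H : V → Prop} {L : List V} {a b : V}
    [Fintype V]
    (IH : ∀ (W : Type) [Fintype W] (G' : SimpleGraph W) (H' : W → Prop),
      Fintype.card W < Fintype.card V → MTS G' H')
    (hlt : L.length < Fintype.card V)
    (hp : Pa G a L b) (hn : L.Nodup) (hc : NoCut G L) (h3 : 3 ≤ L.length)
    (hNC : NC (ind G L) (fun x => H x.1))
    (hNZ : NZ (ind G L) (fun x => H x.1)) (hs : ∀ u w, u ∈ L → w ∈ L → H u → H w → u ≠ w →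
      L.length + 1 ≤ cn G u L + cn G w L) :
    (∀ k, 3 ≤ k → k ≤ L.length → HasCyc G k) ∨ ∀ x ∈ L, cn G x L = 2 := by
  classical
  rcases IH _ (ind G L) (fun x => H x.1) (by rw [ind_card hn]; exact hlt)
    (ind_TC hp hn hc) (by rw [ind_card hn]; exact h3) hNC hNZ
    (fun u w hu hw huw => by
      rw [ind_card hn, ind_dg G hn, ind_dg G hn]
      exact hs u.1 w.1 u.2 w.2 hu hw (fun h => huw (Subtype.ext h))) with h | h
  · left
    intro k hk hk'
    exact (h k hk (by rw [ind_card hn]; exact hk')).map Subtype.val_injective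
  · right
    intro x hx
    rw [← h ⟨x, hx⟩, ind_dg G hn]

theorem twin_lem {V : Type} {G : SimpleGraph V} {H : V → Prop} {z t : V} (htz : G.Adj t z)
    (ht : ¬ H t) (htw : ∀ x, x ≠ t → x ≠ z → (G.Adj t x ↔ G.Adj z x))
    (hNC : NC G H) (hNZ : NZ G H) :
    NC G (fun x => H x ∧ x ≠ z) ∧ NZ G (fun x => H x ∧ x ≠ z) := by
  classical
  have hne := htz.ne
  obtain ⟨σ, hσz, hσt, hσ⟩ : ∃ σ : V → V, σ z = t ∧ σ t = z ∧ ∀ x, x ≠ t → x ≠ z → σ x = x :=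
    ⟨fun x => if x = z then t else if x = t then z else x, by simp, by simp [hne],
      fun x h1 h2 => by simp [h1, h2]⟩
  have inj : ∀ x y, x ≠ y → σ x ≠ σ y := by
    intro x y hxy
    by_cases h1 : x = z <;> by_cases h2 : x = t <;> by_cases h3 : y = z <;> by_cases h4 : y = t <;>
      grind
  have adj : ∀ x y, G.Adj (σ x) (σ y) ↔ G.Adj x y := by
    intro x y
    have e1 := htw x
    have e2 := htw y
    have c1 := G.adj_comm x t
    have c2 := G.adj_comm x z
    have c3 := G.adj_comm t z
    have i1 : ¬ G.Adj z z := by simp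
    have i2 : ¬ G.Adj t t := by simp
    by_cases h1 : x = z
    · subst h1; rw [hσz]
      by_cases h3 : y = x
      · subst h3; rw [hσz]; tauto
      · by_cases h4 : y = t
        · subst h4; rw [hσt]; tauto
        · rw [hσ y h4 h3]; tauto
    · by_cases h2 : x = t
      · subst h2; rw [hσt]
        by_cases h3 : y = z
        · subst h3; rw [hσz]; tauto
        · by_cases h4 : y = x
          · subst h4; rw [hσt]; tauto
          · rw [hσ y h4 h3]; tauto
      · rw [hσ x h2 h1]
        by_cases h3 : y = z
        · subst h3; rw [hσz]; tauto
        · by_cases h4 : y = t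
          · subst h4; rw [hσt]; tauto
          · rw [hσ y h4 h3]
  have hH : ∀ x, H (σ x) → x = t ∨ (H x ∧ x ≠ z) := by
    intro x h
    by_cases h1 : x = z
    · subst h1; rw [hσz] at h; exact absurd h ht
    · by_cases h2 : x = t
      · exact Or.inl h2
      · rw [hσ x h2 h1] at h; exact Or.inr ⟨h, h1⟩
  have hz : ∀ x y, ¬ G.Adj x y → x = t → y = z → False := by
    rintro x y h rfl rfl; exact h htz
  have hz' : ∀ x y, ¬ G.Adj x y → x = z → y = t → False := by
    rintro x y h rfl rfl; exact h htz.symm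
  constructor
  · intro c x y w h1 h2 h3 h4 h5 h6 h7 h8 h9 lx ly
    by_cases hh : x = z ∨ y = z
    · refine hNC (σ c) (σ x) (σ y) (σ w) ((adj _ _).2 h1) ((adj _ _).2 h2) ((adj _ _).2 h3)
        (by rwa [adj]) (by rwa [adj]) (by rwa [adj]) (inj _ _ h7) (inj _ _ h8) (inj _ _ h9) ?_ ?_
      · intro h
        rcases hH x h with h | h
        · rcases hh with h' | h'
          · exact hne (h.symm.trans h')
          · exact hz _ _ h4 h h'
        · exact lx h
      · intro h
        rcases hH y h with h | h
        · rcases hh with h' | h'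
          · exact hz' _ _ h4 h' h
          · exact hne (h.symm.trans h')
        · exact ly h
    · push Not at hh
      exact hNC c x y w h1 h2 h3 h4 h5 h6 h7 h8 h9 (fun h => lx ⟨h, hh.1⟩) (fun h => ly ⟨h, hh.2⟩)
  · intro a1 a2 a3 a4 a5 h1 h2 h3 h4 h5 h6 h7 h8 h9 h10
    have A := hNZ a1 a2 a3 a4 a5 h1 h2 h3 h4 h5 h6 h7 h8 h9 h10
    have B := hNZ (σ a1) (σ a2) (σ a3) (σ a4) (σ a5) ((adj _ _).2 h1) ((adj _ _).2 h2)
      ((adj _ _).2 h3) ((adj _ _).2 h4) ((adj _ _).2 h5) (by rwa [adj]) (by rwa [adj])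
      (by rwa [adj]) (by rwa [adj]) (by rwa [adj])
    have q1 := hH a1
    have q2 := hH a2
    have q3 := hH a3
    have q4 := hH a4
    have q5 := hH a5
    have r1 := hz _ _ h6
    have r1' := hz' _ _ h6
    have r2 := hz _ _ h7
    have r2' := hz' _ _ h7
    have r3 := hz _ _ h10
    have r3' := hz' _ _ h10
    have s : ∀ x, x = t → x = z → False := fun x h h' => hne (h.symm.trans h')
    have s1 := s a1
    have s2 := s a2
    have s3 := s a3
    have s4 := s a4
    have s5 := s a5
    constructor
    · have A := A.1
      have B := B.1
      clear * - A B q1 q2 q4 r1 r1' r2 r2' s1 s2 s4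
      by_cases u : H a4 ∧ a4 ≠ z
      · exact Or.inl u
      · right; grind
    · have A := A.2
      have B := B.2
      clear * - A B q3 q5 r3 r3' s3 s5
      grind

theorem chain_prop {V : Type} {G : SimpleGraph V} {P : V → Prop} {a b : V} {l : List V}
    (h : Pa G a l b) (ha : P a) (hs : ∀ x y, x ∈ l → y ∈ l → G.Adj x y → P x → P y) :
    ∀ x ∈ l, P x := by
  intro x hx
  exact (chain_const (S := P) h (fun x y h1 h2 e => ⟨hs x y h1 h2 e, hs y x h2 h1 e.symm⟩) x hx).2 ha

theorem Pa.take {V : Type} {G : SimpleGraph V} {a b : V} {l : List V} (h : Pa G a l b) {t : ℕ}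
    (h1 : 1 ≤ t) (h2 : t ≤ l.length) : ∃ e ∈ l, Pa G a (l.take t) e := by
  obtain ⟨A, B, h3, h4⟩ := split1 l (t - 1) (by omega)
  generalize l[t - 1] = c at *
  subst h3
  refine ⟨c, by simp, ?_⟩
  have : (A ++ c :: B).take t = A ++ [c] := by
    have : t = (A ++ [c]).length := by simp; omega
    rw [this]
    have e : A ++ c :: B = (A ++ [c]) ++ B := by simp
    rw [e, List.take_left']
    rfl
  rw [this]
  exact h.pre

theorem Pa.drop {V : Type} {G : SimpleGraph V} {a b : V} {l : List V} (h : Pa G a l b) {t : ℕ}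
    (h2 : t < l.length) : ∃ e ∈ l, Pa G e (l.drop t) b := by
  obtain ⟨A, B, h3, h4⟩ := split1 l t (by omega)
  generalize l[t] = c at *
  subst h3
  refine ⟨c, by simp, ?_⟩
  rw [List.drop_left' h4]
  exact h.suf


/-- Type 1 configuration. -/
structure T1 {V : Type} (G : SimpleGraph V) (H : V → Prop) (v z : V) (D1 D2 : List V)
    (a a' b1 b : V) : Prop where
  p1 : Pa G a D1 a'
  p2 : Pa G b1 D2 b
  va : G.Adj v a
  az : G.Adj a' z
  zb : G.Adj z b1
  bv : G.Adj b v
  nd : (v :: (D1 ++ z :: D2)).Nodup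
  full : ∀ x, x ∈ v :: (D1 ++ z :: D2)
  no : ∀ x ∈ D1, ∀ y ∈ D2, ¬ G.Adj x y
  lt : ∀ y ∈ D2, ¬ H y
  nc : NC G H
  nz : NZ G H
  la : ¬ H a
  hv : H v

section
variable {V : Type} {G : SimpleGraph V} {H : V → Prop} {v z : V} {D1 D2 : List V} {a a' b1 b : V}

theorem T1.dis (h : T1 G H v z D1 D2 a a' b1 b) : v ∉ D1 ∧ v ≠ z ∧ v ∉ D2 ∧ z ∉ D1 ∧ z ∉ D2 ∧
    D1.Nodup ∧ D2.Nodup ∧ ∀ x ∈ D1, ∀ y ∈ D2, x ≠ y := by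
  have := h.nd
  simp only [List.nodup_cons, List.nodup_append, List.mem_append, List.mem_cons, not_or] at this
  obtain ⟨⟨h1, h2, h3⟩, h4, ⟨h5, h6⟩, h7⟩ := this
  exact ⟨h1, h2, h3, fun h => h7 z h z (by simp) rfl, h5, h4, h6,
    fun x hx y hy => h7 x hx y (by simp [hy])⟩

theorem T1.aD (h : T1 G H v z D1 D2 a a' b1 b) : a ∈ D1 := h.p1.mem_hd
theorem T1.bD (h : T1 G H v z D1 D2 a a' b1 b) : b ∈ D2 := h.p2.mem_lst

theorem T1.no' (h : T1 G H v z D1 D2 a a' b1 b) : ∀ x ∈ D1, ∀ y ∈ D2, ¬ G.Adj y x :=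
  fun x hx y hy e => h.no x hx y hy e.symm

theorem T1.f0 (h : T1 G H v z D1 D2 a a' b1 b) {x : V} (hx : x ∈ D1) (hxa : x ≠ a)
    (vx : G.Adj v x) : G.Adj a x := by
  by_contra hc
  obtain ⟨_, _, _, _, _, _, _, d⟩ := h.dis
  exact h.nc v a b x h.va h.bv.symm vx (h.no _ h.aD _ h.bD) hc (h.no' _ hx _ h.bD)
    (d _ h.aD _ h.bD) hxa.symm (d _ hx _ h.bD).symm h.la (h.lt _ h.bD)

theorem T1.dgv [Fintype V] (h : T1 G H v z D1 D2 a a' b1 b) (u : V) :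
    dg G u = cn G u [v] + cn G u D1 + cn G u [z] + cn G u D2 := by
  rw [dg_full G u h.nd h.full]
  have e : v :: (D1 ++ z :: D2) = [v] ++ D1 ++ [z] ++ D2 := by simp
  rw [e, cn_append, cn_append, cn_append]

theorem T1.card [Fintype V] (h : T1 G H v z D1 D2 a a' b1 b) :
    Fintype.card V = D1.length + D2.length + 2 := by
  rw [← card_full h.nd h.full]; simp; omega

theorem cn_one (G : SimpleGraph V) (u x : V) : cn G u [x] ≤ 1 := cn_le G u [x]
theorem cn_self (G : SimpleGraph V) (u : V) : cn G u [u] = 0 := by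
  rw [cn_cons_neg (by simp), cn_nil]

theorem T1.fz [Fintype V] (h : T1 G H v z D1 D2 a a' b1 b) (h1 : 2 ≤ D1.length)
    (h2 : 2 ≤ D2.length) (hd : Fintype.card V + 1 ≤ 2 * dg G v) :
    ∃ x ∈ D1, x ≠ a ∧ G.Adj v x := by
  by_contra hc
  push Not at hc
  obtain ⟨_, _, _, _, _, n1, n2, d⟩ := h.dis
  have e := h.dgv v
  rw [h.card] at hd
  have := cn_self G v
  have := cn_one G v z
  have p := h.p1
  obtain ⟨D, rfl⟩ := h.p1.hd
  have : cn G v (a :: D) ≤ 1 := by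
    have := cn_cons_le G v a D
    have : cn G v D = 0 := cn_zero (fun y hy => hc y (by simp [hy]) (by
      rintro rfl; simp [hy] at n1))
    omega
  have : 2 ≤ cn G v D2 := by omega
  obtain ⟨y1, y2, m1, m2, ne, e1, e2⟩ := cn_two n2 this
  have ha : a ∈ a :: D := by simp
  have hD : D ≠ [] := by rintro rfl; simp at h1
  obtain ⟨_, c, ac, pc⟩ := p.consD hD
  have hcD : c ∈ a :: D := by simp [pc.mem_hd]
  have e3 : G.Adj y1 y2 := by
    by_contra e3
    exact h.nc v y1 y2 a e1 e2 h.va e3 (h.no' _ ha _ m1) (h.no' _ ha _ m2) ne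
      (d _ ha _ m1).symm (d _ ha _ m2).symm (h.lt _ m1) (h.lt _ m2)
  have := h.nz y1 y2 v a c e3 e1.symm e2.symm h.va ac (h.no' _ ha _ m1) (h.no' _ ha _ m2)
    (h.no' _ hcD _ m1) (h.no' _ hcD _ m2) (hc c hcD ac.ne')
  rcases this.1 with h' | h'
  · exact h.la h'
  · exact h.lt _ m1 h'.1

theorem T1.fd (h : T1 G H v z D1 D2 a a' b1 b) {x : V} (hx : x ∈ D1) (hxa : x ≠ a)
    (vx : G.Adj v x) : ∀ y ∈ D2, G.Adj v y := by
  have hax := h.f0 hx hxa vx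
  intro y hy
  refine chain_prop (P := fun y => G.Adj v y) h.p2.rev h.bv.symm ?_ y (by simpa using hy)
  intro y w hy hw e vy
  simp only [List.mem_reverse] at hy hw
  by_contra hc
  have := h.nz a x v y w hax h.va.symm vx.symm vy e (h.no _ h.aD _ hy) (h.no _ hx _ hy)
    (h.no _ h.aD _ hw) (h.no _ hx _ hw) hc
  rcases this.1 with h' | h'
  · exact h.lt _ hy h'
  · exact h.la h'.1

theorem T1.f4 (h : T1 G H v z D1 D2 a a' b1 b) (h2 : 2 ≤ D2.length)
    (hD : ∀ y ∈ D2, G.Adj v y) {x w : V} (hx : x ∈ D1) (hw : w ∈ D1) (vx : G.Adj v x)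
    (lx : ¬ H x) (xw : G.Adj x w) : G.Adj v w := by
  by_contra hc
  have p := h.p2
  obtain ⟨D, rfl⟩ := h.p2.hd
  have hD' : D ≠ [] := by rintro rfl; simp at h2
  obtain ⟨_, c, bc, pc⟩ := p.consD hD'
  have hb : b1 ∈ b1 :: D := by simp
  have hcD : c ∈ b1 :: D := by simp [pc.mem_hd]
  have := h.nz b1 c v x w bc (hD _ hb).symm (hD _ hcD).symm vx xw (h.no' _ hx _ hb)
    (h.no' _ hx _ hcD) (h.no' _ hw _ hb) (h.no' _ hw _ hcD) hc
  rcases this.1 with h' | h'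
  · exact lx h'
  · exact h.lt _ hb h'.1

theorem T1.pL (h : T1 G H v z D1 D2 a a' b1 b) : Pa G a (D1 ++ [z]) z := h.p1.snoc h.az

theorem T1.ndL (h : T1 G H v z D1 D2 a a' b1 b) : (D1 ++ [z]).Nodup := by
  refine h.nd.sublist ?_
  apply List.Sublist.cons
  apply List.Sublist.append (List.Sublist.refl _)
  simp

theorem T1.dgx [Fintype V] (h : T1 G H v z D1 D2 a a' b1 b) {x : V} (hx : x ∈ D1) :
    dg G x ≤ cn G x (D1 ++ [z]) + 1 := by
  rw [h.dgv, cn_append, cn_zero (h.no x hx)]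
  have := cn_one G x v
  omega

theorem T1.dgz [Fintype V] (h : T1 G H v z D1 D2 a a' b1 b) :
    dg G z ≤ cn G z (D1 ++ [z]) + 1 + cn G z D2 := by
  rw [h.dgv, cn_append]
  have := cn_one G z v
  omega

open Classical in
theorem T1.sums [Fintype V] (h : T1 G H v z D1 D2 a a' b1 b)
    (hs : ∀ u w, H u → H w → u ≠ w → Fintype.card V + 1 ≤ dg G u + dg G w) {u w : V}
    (hu : u ∈ D1 ++ [z]) (hw : w ∈ D1 ++ [z]) (Hu : H u) (Hw : H w) (huw : u ≠ w) :
    D1.length + D2.length + 1 ≤ cn G u (D1 ++ [z]) + cn G w (D1 ++ [z]) +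
      if (u = z ∨ w = z) then cn G z D2 else 0 := by
  have := hs u w Hu Hw huw
  rw [h.card] at this
  have hz := h.dgz
  have hx := fun x => h.dgx (x := x)
  simp only [List.mem_append, List.mem_singleton] at hu hw
  split_ifs with hh
  · rcases hu with hu | rfl
    · rcases hw with hw | rfl
      · obtain ⟨_, _, _, d, _⟩ := h.dis
        rcases hh with rfl | rfl
        · exact absurd hu d
        · exact absurd hw d
      · have := hx u hu; omega
    · rcases hw with hw | rfl
      · have := hx w hw; omega
      · exact absurd rfl huw
  · push Not at hh
    have a1 := hx u (by tauto)
    have a2 := hx w (by tauto)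
    omega

theorem T1.ham (h : T1 G H v z D1 D2 a a' b1 b) : Cyc G (v :: (D1 ++ z :: D2)) :=
  ⟨v, b, Pa.cons h.va (h.p1.app h.az (Pa.cons h.zb h.p2)), h.bv, h.nd, by
    have := List.length_pos_of_mem h.aD
    have := List.length_pos_of_mem h.bD
    simp; omega⟩

theorem T1.q1 [Fintype V] (h : T1 G H v z D1 D2 a a' b1 b)
    (hs : ∀ u w, H u → H w → u ≠ w → Fintype.card V + 1 ≤ dg G u + dg G w)
    (h1 : 2 ≤ D1.length) (h2 : D2.length = 1) (hd : Fintype.card V + 1 ≤ 2 * dg G v)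
    (hcut : NoCut G (D1 ++ [z])) : Pan G := by
  have hc2 : ∀ u, cn G u D2 ≤ 1 := fun u => (cn_le G u D2).trans h2.le
  obtain ⟨C, hC, hp⟩ := ind_ham h.pL h.ndL hcut (by simp; omega) h.nc h.nz (by
    intro u w hu hw Hu Hw huw
    have := h.sums hs hu hw Hu Hw huw
    have := hc2 z
    simp only [List.length_append, List.length_cons, List.length_nil]
    split_ifs at * <;> omega)
  intro k hk hk'
  rcases Nat.eq_or_lt_of_le hk' with rfl | hlt
  · exact ⟨_, h.ham, card_full h.nd h.full⟩
  obtain ⟨d1, d2, d3, _⟩ := h.dis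
  have hl := hp.length_eq
  simp only [List.length_append, List.length_cons, List.length_nil] at hl
  rw [h.card] at hlt hd
  refine shift_lem hC (v := v) ?_ ?_ hk (by omega)
  · rw [hp.mem_iff]; simp [d1, d2]
  · rw [cn_perm G v hp]
    have e := h.dgv v
    have := hc2 v
    have := cn_self G v
    rw [cn_append]
    omega

theorem T1.long [Fintype V] (h : T1 G H v z D1 D2 a a' b1 b) (hD : ∀ y ∈ D2, G.Adj v y)
    {k : ℕ} (hk : D1.length + 3 ≤ k) (hk' : k ≤ Fintype.card V) : HasCyc G k := by
  rw [h.card] at hk'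
  obtain ⟨e, he, pe⟩ := h.p2.take (t := k - D1.length - 2) (by omega) (by omega)
  refine ⟨v :: (D1 ++ z :: D2.take (k - D1.length - 2)),
    ⟨v, e, Pa.cons h.va (h.p1.app h.az (Pa.cons h.zb pe)), (hD e he).symm, ?_, ?_⟩, ?_⟩
  · refine h.nd.sublist ?_
    apply List.Sublist.cons_cons
    apply List.Sublist.append (List.Sublist.refl _)
    apply List.Sublist.cons_cons
    exact List.take_sublist _ _
  · simp; omega
  · simp; omega

theorem T1.twin (h : T1 G H v z D1 D2 a a' b1 b) (la' : ¬ H a') (h2 : 2 ≤ cn G z D2) :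
    ∀ x ∈ D1, x ≠ a' → (G.Adj a' x ↔ G.Adj z x) := by
  obtain ⟨_, _, _, _, zD, n1, n2, d⟩ := h.dis
  obtain ⟨y1, y2, m1, m2, ne, e1, e2⟩ := cn_two n2 h2
  have ha : a' ∈ D1 := h.p1.mem_lst
  have e3 : G.Adj y1 y2 := by
    by_contra e3
    exact h.nc z y1 y2 a' e1 e2 h.az.symm e3 (h.no' _ ha _ m1) (h.no' _ ha _ m2) ne
      (d _ ha _ m1).symm (d _ ha _ m2).symm (h.lt _ m1) (h.lt _ m2)
  intro x hx hxa
  constructor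
  · intro e
    by_contra hc
    have := h.nz y1 y2 z a' x e3 e1.symm e2.symm h.az.symm e (h.no' _ ha _ m1) (h.no' _ ha _ m2)
      (h.no' _ hx _ m1) (h.no' _ hx _ m2) hc
    rcases this.1 with h' | h'
    · exact la' h'
    · exact h.lt _ m1 h'.1
  · intro e
    by_contra hc
    exact h.nc z a' y1 x h.az.symm e1 e (h.no _ ha _ m1) hc (h.no' _ hx _ m1)
      (d _ ha _ m1) hxa.symm (d _ hx _ m1).symm la' (h.lt _ m1)
end


section
variable {V : Type} {G : SimpleGraph V} {H : V → Prop} {v z : V} {D1 D2 : List V} {a a' b1 b : V}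

open Classical in
theorem T1.B [Fintype V] (h : T1 G H v z D1 D2 a a' b1 b)
    (IH : ∀ (W : Type) [Fintype W] (G' : SimpleGraph W) (H' : W → Prop),
      Fintype.card W < Fintype.card V → MTS G' H')
    (hs : ∀ u w, H u → H w → u ≠ w → Fintype.card V + 1 ≤ dg G u + dg G w)
    (hF : ∀ l x y, Pa G x l y → G.Adj y x → l.Nodup → (∀ u, u ∈ l) → ¬ (H x ∧ H y))
    (h1 : 2 ≤ D1.length) (h2 : 2 ≤ D2.length)
    (hcut : NoCut G (D1 ++ [z])) :
    (∀ k, 3 ≤ k → k ≤ D1.length + 1 → HasCyc G k) ∨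
      ∀ x ∈ D1 ++ [z], cn G x (D1 ++ [z]) = 2 := by
  obtain ⟨d1, d2, d3, d4, d5, d6, d7, d8⟩ := h.dis
  have hlen : (D1 ++ [z]).length = D1.length + 1 := by simp
  have hlt : (D1 ++ [z]).length < Fintype.card V := by rw [h.card, hlen]; omega
  have rNC : NC (ind G (D1 ++ [z])) (fun x => H x.1) :=
    (fun c x y z h1 h2 h3 h4 h5 h6 h7 h8 h9 => h.nc c.1 x.1 y.1 z.1 h1 h2 h3 h4 h5 h6
      (fun h => h7 (Subtype.ext h)) (fun h => h8 (Subtype.ext h)) (fun h => h9 (Subtype.ext h)))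
  have rNZ : NZ (ind G (D1 ++ [z])) (fun x => H x.1) :=
    (fun a1 a2 a3 a4 a5 => h.nz a1.1 a2.1 a3.1 a4.1 a5.1)
  rw [← hlen]
  by_cases hz : H z ∧ 2 ≤ cn G z D2
  · have la' : ¬ H a' := by
      intro Ha
      have hper : (z :: (D2 ++ v :: D1)).Perm (v :: (D1 ++ z :: D2)) := by
        simp [List.perm_iff_count, List.count_cons] <;> omega
      exact hF _ z a' (Pa.cons h.zb (h.p2.app h.bv (Pa.cons h.va h.p1))) h.az
        (hper.nodup_iff.2 h.nd) (fun u => hper.mem_iff.2 (h.full u)) ⟨hz.1, Ha⟩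
    have htw := h.twin la' hz.2
    have ha' : a' ∈ D1 := h.p1.mem_lst
    obtain ⟨nc', nz'⟩ := twin_lem (G := ind G (D1 ++ [z])) (H := fun x => H x.1)
      (z := ⟨z, by simp⟩) (t := ⟨a', by simp [ha']⟩) h.az la' (by
        rintro ⟨x, hx⟩ hx1 hx2
        simp only [List.mem_append, List.mem_singleton] at hx
        simp only [ne_eq, Subtype.mk.injEq] at hx1 hx2
        exact htw x (by tauto) hx1) rNC rNZ
    refine ind_pan (H := fun x => H x ∧ x ≠ z) IH hlt h.pL h.ndL hcut (by omega) ?_ ?_ ?_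
    · simpa [Subtype.ext_iff] using nc'
    · simpa [Subtype.ext_iff] using nz'
    · intro u w hu hw Hu Hw huw
      have := h.sums hs hu hw Hu.1 Hw.1 huw
      rw [if_neg (by push Not; exact ⟨Hu.2, Hw.2⟩)] at this
      omega
  · refine ind_pan (H := H) IH hlt h.pL h.ndL hcut (by omega) rNC rNZ ?_
    intro u w hu hw Hu Hw huw
    have := h.sums hs hu hw Hu Hw huw
    split_ifs at this with hh
    · have : H z := by
        rcases hh with rfl | rfl
        · exact Hu
        · exact Hw
      have : cn G z D2 ≤ 1 := by
        by_contra hc; exact hz ⟨this, by omega⟩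
      omega
    · omega

theorem T1.main [Fintype V] (h : T1 G H v z D1 D2 a a' b1 b)
    (IH : ∀ (W : Type) [Fintype W] (G' : SimpleGraph W) (H' : W → Prop),
      Fintype.card W < Fintype.card V → MTS G' H')
    (hs : ∀ u w, H u → H w → u ≠ w → Fintype.card V + 1 ≤ dg G u + dg G w)
    (hF : ∀ l x y, Pa G x l y → G.Adj y x → l.Nodup → (∀ u, u ∈ l) → ¬ (H x ∧ H y))
    (h1 : 2 ≤ D1.length) (hd : Fintype.card V + 1 ≤ 2 * dg G v)
    (hcut : NoCut G (D1 ++ [z])) : Pan G := by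
  classical
  obtain ⟨d1, d2, d3, d4, d5, d6, d7, d8⟩ := h.dis
  have := List.length_pos_of_mem h.bD
  by_cases hq : D2.length = 1
  · exact h.q1 hs h1 hq hd hcut
  have h2 : 2 ≤ D2.length := by omega
  obtain ⟨x2, hx2, hx2a, vx2⟩ := h.fz h1 h2 hd
  have hD := h.fd hx2 hx2a vx2
  have key : (∀ k, 3 ≤ k → k ≤ D1.length + 1 → HasCyc G k) ∧ HasCyc G (D1.length + 2) := by
    have p := h.p1
    have hcard := h.card
    obtain ⟨E, rfl⟩ : ∃ E, D1 = a :: E := h.p1.hd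
    have hE : E ≠ [] := by rintro rfl; simp at h1
    obtain ⟨_, c, ac, pE⟩ := p.consD hE
    have hcE : c ∈ a :: E := by simp [pE.mem_hd]
    have vc : G.Adj v c := h.f4 h2 hD h.aD hcE h.va h.la ac
    have tri : HasCyc G 3 := ⟨[v, a, c], ⟨v, c, Pa.cons h.va (Pa.cons ac (Pa.one c)), vc.symm, by
      simp [h.va.ne, vc.ne, ac.ne], by simp⟩, rfl⟩
    constructor
    · rcases h.B IH hs hF h1 h2 hcut with hB | hB
      · exact hB
      intro k hk hk'
      obtain ⟨F, rfl⟩ : ∃ F, E = c :: F := pE.hd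
      rcases eq_or_ne F [] with rfl | hF'
      · have : k = 3 := by simp at hk'; omega
        rw [this]; exact tri
      obtain ⟨_, d, cd, pF⟩ := pE.consD hF'
      obtain ⟨F, rfl⟩ := pF.hd
      -- d has three neighbours if it is adjacent to a
      have pr : Pa G d (d :: (F ++ [z])) z := pF.snoc h.az
      obtain ⟨_, r, dr, prr⟩ := pr.consD (by simp)
      have hr := prr.mem_hd
      have nL := h.ndL
      have hda : ¬ G.Adj d a := by
        intro hda
        have e := hB d (by simp)
        have : 3 ≤ cn G d ((a :: c :: d :: F) ++ [z]) := by
          refine cn_ge (m := [a, c, r]) ?_ ?_ ?_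
          · have : (a :: c :: r :: []).Sublist ((a :: c :: d :: F) ++ [z]) := by
              apply List.Sublist.cons_cons
              apply List.Sublist.cons_cons
              apply List.Sublist.cons
              simpa using hr
            exact nL.sublist this
          · intro y hy
            simp only [List.mem_cons, List.not_mem_nil, or_false] at hy
            rcases hy with rfl | rfl | rfl
            · simp
            · simp
            · have : y ∈ F ++ [z] := hr
              simp only [List.cons_append, List.mem_cons]
              tauto
          · intro y hy
            simp only [List.mem_cons, List.not_mem_nil, or_false] at hy
            rcases hy with rfl | rfl | rfl
            · exact hda
            · exact cd.symm
            · exact dr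
        omega
      have hdn : d ≠ a ∧ a ≠ c := by
        simp at d6; exact ⟨fun h => d6.1.2.1 h.symm, d6.1.1⟩
      have hvd : ¬ G.Adj v d := fun e => hda (h.f0 (by simp) hdn.1 e).symm
      have Hc : H c := by
        by_contra lc
        exact hvd (h.f4 h2 hD hcE (by simp) vc lc cd)
      have dgc := h.dgx hcE
      rw [hB c (by simp)] at dgc
      -- no third neighbour of v in D1
      have hX : ∀ t ∈ d :: F, ¬ G.Adj v t := by
        intro t ht vt
        have tD : t ∈ a :: c :: d :: F := by
          simp only [List.mem_cons] at ht ⊢; tauto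
        have tn : t ≠ a ∧ t ≠ c := by
          simp only [List.nodup_cons, List.mem_cons, not_or] at d6 ht
          constructor
          · rintro rfl; tauto
          · rintro rfl; tauto
        by_cases tc : G.Adj t c
        · have : 3 ≤ cn G c ((a :: c :: d :: F) ++ [z]) := by
            refine cn_ge (m := [a, d, t]) ?_ ?_ ?_
            · have : d ≠ t := by rintro rfl; exact hvd vt
              simp [hdn.1.symm, tn.1.symm, this]
            · intro y hy
              simp only [List.mem_cons, List.not_mem_nil, or_false] at hy
              rcases hy with rfl | rfl | rfl
              · simp
              · simp
              · simp only [List.mem_append]; exact Or.inl tD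
            · intro y hy
              simp only [List.mem_cons, List.not_mem_nil, or_false] at hy
              rcases hy with rfl | rfl | rfl
              · exact ac.symm
              · exact cd
              · exact tc.symm
          have := hB c (by simp)
          omega
        · have Ht : H t := by
            by_contra lt
            exact h.nc v t b c vt h.bv.symm vc (h.no _ tD _ h.bD) tc (h.no' _ hcE _ h.bD)
              (d8 _ tD _ h.bD) tn.2 (d8 _ hcE _ h.bD).symm lt (h.lt _ h.bD)
          have dgt := h.dgx tD
          rw [hB t (by simp only [List.mem_append]; exact Or.inl tD)] at dgt
          have := hs t c Ht Hc tn.2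
          simp at hcard
          omega
      have cvD : cn G v (a :: c :: d :: F) = 2 := by
        rw [cn_cons_pos h.va, cn_cons_pos vc, cn_zero hX]
      have e := h.dgv v
      have := cn_self G v
      have := cn_le G v D2
      have := hs v c h.hv Hc vc.ne
      have := cn_one G v z
      simp only [List.length_cons] at hcard hk'
      have hFl : F.length = 0 ∧ cn G v [z] = 1 := by omega
      have hF0 : F = [] := List.length_eq_zero_iff.1 hFl.1
      subst hF0
      have vz : G.Adj v z := by
        obtain ⟨y, hy, e'⟩ := cn_pos (G := G) (v := v) (l := [z]) (by omega)
        simp at hy; subst hy; exact e'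
      rcases Nat.eq_or_lt_of_le hk with rfl | hk3
      · exact tri
      · have : k = 4 := by simp at hk'; omega
        subst this
        refine ⟨[v, c, d, z], ⟨v, z, Pa.cons vc (Pa.cons cd (by simpa using pr)), vz.symm, ?_,
          by simp⟩, rfl⟩
        refine h.nd.sublist ?_
        simp
    · refine ⟨v :: (E ++ [z, b1]), ⟨v, b1, Pa.cons vc (pE.app h.az (Pa.cons h.zb (Pa.one _))),
        (hD b1 h.p2.mem_hd).symm, ?_, by simp⟩, by simp⟩
      refine h.nd.sublist ?_
      apply List.Sublist.cons_cons
      apply List.Sublist.cons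
      apply List.Sublist.append (List.Sublist.refl _)
      apply List.Sublist.cons_cons
      simpa using h.p2.mem_hd
  intro k hk hk'
  rcases Nat.lt_or_ge k (D1.length + 2) with hlt | hge
  · exact key.1 k hk (by omega)
  rcases Nat.eq_or_lt_of_le hge with he | hgt
  · rw [← he]; exact key.2
  · exact h.long hD hgt hk'
end


/-- Type 2 configuration. -/
structure T2 {V : Type} (G : SimpleGraph V) (H : V → Prop) (v z1 z2 : V) (Lf K Rt : List V)
    (a a2 r1 b : V) : Prop where
  pL : Pa G a Lf a2
  pK : Pa G z1 (z1 :: (K ++ [z2])) z2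
  pR : Pa G r1 Rt b
  va : G.Adj v a
  az : G.Adj a2 z1
  zr : G.Adj z2 r1
  bv : G.Adj b v
  nd : (v :: (Lf ++ z1 :: (K ++ z2 :: Rt))).Nodup
  full : ∀ x, x ∈ v :: (Lf ++ z1 :: (K ++ z2 :: Rt))
  noL : ∀ x ∈ Lf, ∀ y ∈ K ++ z2 :: Rt, ¬ G.Adj x y
  noR : ∀ x ∈ Lf ++ z1 :: K, ∀ y ∈ Rt, ¬ G.Adj x y
  ltL : ∀ y ∈ Lf, ¬ H y
  ltR : ∀ y ∈ Rt, ¬ H y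
  nc : NC G H
  nz : NZ G H
  hv : H v

section
variable {V : Type} {G : SimpleGraph V} {H : V → Prop} {v z1 z2 : V} {Lf K Rt : List V}
  {a a2 r1 b : V}

theorem T2.rev (h : T2 G H v z1 z2 Lf K Rt a a2 r1 b) :
    T2 G H v z2 z1 Rt.reverse K.reverse Lf.reverse b r1 a2 a := by
  classical
  have hper : (v :: (Rt.reverse ++ z2 :: (K.reverse ++ z1 :: Lf.reverse))).Perm
      (v :: (Lf ++ z1 :: (K ++ z2 :: Rt))) := by
    simp [List.perm_iff_count, List.count_cons] <;> omega
  refine ⟨h.pR.rev, by simpa using h.pK.rev, h.pL.rev, h.bv.symm, h.zr.symm, h.az.symm, h.va.symm,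
    hper.nodup_iff.2 h.nd, fun x => hper.mem_iff.2 (h.full x), ?_, ?_, ?_, ?_, h.nc, h.nz, h.hv⟩
  · intro x hx y hy e
    refine h.noR y ?_ x (by simpa using hx) e.symm
    simp only [List.mem_append, List.mem_cons, List.mem_reverse] at hy ⊢
    tauto
  · intro x hx y hy e
    refine h.noL y (by simpa using hy) x ?_ e.symm
    simp only [List.mem_append, List.mem_cons, List.mem_reverse] at hx ⊢
    tauto
  · intro y hy; exact h.ltR y (by simpa using hy)
  · intro y hy; exact h.ltL y (by simpa using hy)

theorem T2.ne (h : T2 G H v z1 z2 Lf K Rt a a2 r1 b) :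
    Lf.Nodup ∧ Rt.Nodup ∧ (∀ x ∈ Lf, ∀ y ∈ Rt, x ≠ y) ∧ (∀ x ∈ K, x ∉ Lf ∧ x ∉ Rt) ∧
    (z1 ∉ Lf ∧ z1 ∉ Rt) ∧ (v ≠ z1 ∧ v ≠ z2 ∧ z1 ≠ z2) ∧ (∀ x ∈ K, x ≠ v ∧ x ≠ z1 ∧ x ≠ z2) := by
  have := h.nd
  simp only [List.nodup_cons, List.nodup_append, List.mem_append, List.mem_cons, not_or] at this
  grind

theorem T2.card [Fintype V] (h : T2 G H v z1 z2 Lf K Rt a a2 r1 b) :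
    Fintype.card V = Lf.length + K.length + Rt.length + 3 := by
  rw [← card_full h.nd h.full]; simp; omega

theorem T2.dgv [Fintype V] (h : T2 G H v z1 z2 Lf K Rt a a2 r1 b) (u : V) :
    dg G u = cn G u [v] + cn G u Lf + cn G u [z1] + cn G u K + cn G u [z2] + cn G u Rt := by
  rw [dg_full G u h.nd h.full]
  have e : v :: (Lf ++ z1 :: (K ++ z2 :: Rt)) = [v] ++ Lf ++ [z1] ++ K ++ [z2] ++ Rt := by simp
  rw [e, cn_append, cn_append, cn_append, cn_append, cn_append]

theorem T2.aD (h : T2 G H v z1 z2 Lf K Rt a a2 r1 b) : a ∈ Lf := h.pL.mem_hd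
theorem T2.bD (h : T2 G H v z1 z2 Lf K Rt a a2 r1 b) : b ∈ Rt := h.pR.mem_lst
theorem T2.rD (h : T2 G H v z1 z2 Lf K Rt a a2 r1 b) : r1 ∈ Rt := h.pR.mem_hd

theorem T2.LR (h : T2 G H v z1 z2 Lf K Rt a a2 r1 b) {x y : V} (hx : x ∈ Lf) (hy : y ∈ Rt) :
    ¬ G.Adj x y := h.noL x hx y (by simp [hy])
theorem T2.LK (h : T2 G H v z1 z2 Lf K Rt a a2 r1 b) {x y : V} (hx : x ∈ Lf) (hy : y ∈ K) :
    ¬ G.Adj x y := h.noL x hx y (by simp [hy])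
theorem T2.Lz (h : T2 G H v z1 z2 Lf K Rt a a2 r1 b) {x : V} (hx : x ∈ Lf) :
    ¬ G.Adj x z2 := h.noL x hx z2 (by simp)
theorem T2.zR (h : T2 G H v z1 z2 Lf K Rt a a2 r1 b) {x : V} (hx : x ∈ Rt) :
    ¬ G.Adj z1 x := h.noR z1 (by simp) x hx
theorem T2.KR (h : T2 G H v z1 z2 Lf K Rt a a2 r1 b) {x y : V} (hx : x ∈ K) (hy : y ∈ Rt) :
    ¬ G.Adj x y := h.noR x (by simp [hx]) y hy

theorem nadj {x y : V} (h : ¬ G.Adj x y) : ¬ G.Adj y x := fun e => h e.symm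

theorem T2.vK (h : T2 G H v z1 z2 Lf K Rt a a2 r1 b) {x : V} (hx : x ∈ K) : ¬ G.Adj v x := by
  intro e
  obtain ⟨_, _, d, d', _⟩ := h.ne
  have := d' x hx
  exact h.nc v a b x h.va h.bv.symm e (h.LR h.aD h.bD) (h.LK h.aD hx) (nadj (h.KR hx h.bD))
    (d _ h.aD _ h.bD) (fun h' => this.1 (h' ▸ h.aD)) (fun h' => this.2 (h' ▸ h.bD))
    (h.ltL _ h.aD) (h.ltR _ h.bD)

theorem T2.ltK [Fintype V] (h : T2 G H v z1 z2 Lf K Rt a a2 r1 b)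
    (hs : ∀ u w, H u → H w → u ≠ w → Fintype.card V + 1 ≤ dg G u + dg G w) {x : V}
    (hx : x ∈ K) : ¬ H x := by
  intro Hx
  obtain ⟨_, _, d, d', _, d3, d4⟩ := h.ne
  obtain ⟨k1, k2, k3⟩ := d4 x hx
  have := hs x v Hx h.hv k1
  have := common (G := G) (u := x) (w := v) (p := z1) (q := z2)
    (by simp [k1, k2, k3, d3.1, d3.2.1, d3.2.2]) (nadj (h.vK hx)) (by
      intro y xy vy
      have := h.full y
      simp only [List.mem_cons, List.mem_append] at this
      rcases this with rfl | hy | rfl | hy | rfl | hy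
      · simp at vy
      · exact absurd xy.symm (h.LK hy hx)
      · simp
      · exact absurd vy (h.vK hy)
      · simp
      · exact absurd xy (h.KR hx hy))
  omega

theorem T2.fz (h : T2 G H v z1 z2 Lf K Rt a a2 r1 b) (vz : G.Adj v z1) : G.Adj a z1 := by
  by_contra hc
  obtain ⟨_, _, d, d', d2, _⟩ := h.ne
  exact h.nc v a b z1 h.va h.bv.symm vz (h.LR h.aD h.bD) hc (nadj (h.zR h.bD))
    (d _ h.aD _ h.bD) (fun h' => d2.1 (h' ▸ h.aD)) (fun h' => d2.2 (h' ▸ h.bD))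
    (h.ltL _ h.aD) (h.ltR _ h.bD)

theorem T2.half (h : T2 G H v z1 z2 Lf K Rt a a2 r1 b) (hc : 2 ≤ cn G v Lf) : G.Adj v z2 := by
  obtain ⟨n1, n2, d, d', d2, _⟩ := h.ne
  obtain ⟨y1, y2, m1, m2, ne, e1, e2⟩ := cn_two n1 hc
  have e3 : G.Adj y1 y2 := by
    by_contra e3
    exact h.nc v y1 y2 b e1 e2 h.bv.symm e3 (h.LR m1 h.bD) (h.LR m2 h.bD) ne
      (d _ m1 _ h.bD) (d _ m2 _ h.bD) (h.ltL _ m1) (h.ltL _ m2)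
  have hR : ∀ y ∈ Rt, G.Adj v y := by
    intro y hy
    refine chain_prop (P := fun y => G.Adj v y) h.pR.rev h.bv.symm ?_ y (by simpa using hy)
    intro y w hy hw e vy
    simp only [List.mem_reverse] at hy hw
    by_contra hc
    have := h.nz y1 y2 v y w e3 e1.symm e2.symm vy e (h.LR m1 hy) (h.LR m2 hy)
      (h.LR m1 hw) (h.LR m2 hw) hc
    rcases this.1 with h' | h'
    · exact h.ltR _ hy h'
    · exact h.ltL _ m1 h'.1
  by_contra hc
  have := h.nz y1 y2 v r1 z2 e3 e1.symm e2.symm (hR _ h.rD) h.zr.symm (h.LR m1 h.rD)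
    (h.LR m2 h.rD) (h.Lz m1) (h.Lz m2) hc
  rcases this.1 with h' | h'
  · exact h.ltR _ h.rD h'
  · exact h.ltL _ m1 h'.1

theorem T2.vz [Fintype V] (h : T2 G H v z1 z2 Lf K Rt a a2 r1 b)
    (hd : Fintype.card V + 1 ≤ 2 * dg G v) : G.Adj v z1 ∨ G.Adj v z2 := by
  by_contra hc
  push Not at hc
  have k1 : ¬ 2 ≤ cn G v Lf := fun h' => hc.2 (h.half h')
  have k2 : ¬ 2 ≤ cn G v Rt := fun h' => hc.1 (h.rev.half (by
    rw [cn_perm G v (List.reverse_perm Rt)]; exact h'))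
  have e := h.dgv v
  rw [cn_zero (l := K) (fun y hy => h.vK hy), cn_zero (l := [v]) (by simp),
    cn_zero (l := [z1]) (by simpa using hc.1), cn_zero (l := [z2]) (by simpa using hc.2)] at e
  rw [h.card] at hd
  have := List.length_pos_of_mem h.aD
  have := List.length_pos_of_mem h.bD
  omega

theorem T2.vR (h : T2 G H v z1 z2 Lf K Rt a a2 r1 b) (vz : G.Adj v z1) : ∀ y ∈ Rt, G.Adj v y := by
  intro y hy
  refine chain_prop (P := fun y => G.Adj v y) h.pR.rev h.bv.symm ?_ y (by simpa using hy)
  intro y w hy hw e vy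
  simp only [List.mem_reverse] at hy hw
  by_contra hc
  have := h.nz a z1 v y w (h.fz vz) h.va.symm vz.symm vy e (h.LR h.aD hy) (h.zR hy)
    (h.LR h.aD hw) (h.zR hw) hc
  rcases this.1 with h' | h'
  · exact h.ltR _ hy h'
  · exact h.ltL _ h.aD h'.1

theorem T2.glue (h : T2 G H v z1 z2 Lf K Rt a a2 r1 b) {s e : V} {l1 l2 l3 : List V}
    (s1 : l1.Sublist Lf) (s2 : l2.Sublist K) (s3 : l3.Sublist Rt) (vs : G.Adj v s)
    (q1 : Pa G s (l1 ++ [z1]) z1) (q2 : Pa G z1 (z1 :: (l2 ++ [z2])) z2)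
    (q3 : Pa G z2 (z2 :: l3) e) (ev : G.Adj e v) :
    HasCyc G (l1.length + l2.length + l3.length + 3) := by
  have c1 : Pa G s (l1 ++ z1 :: (l2 ++ [z2])) z2 := by
    obtain ⟨_, c, zc, pc⟩ := q2.consD (by simp)
    have := q1.app zc pc
    simpa using this
  have c2 : Pa G s (l1 ++ z1 :: (l2 ++ z2 :: l3)) e := by
    rcases eq_or_ne l3 [] with rfl | hl
    · have := q3.lst_eq (m := []); subst this; exact c1
    · obtain ⟨_, c, zc, pc⟩ := q3.consD hl
      have := c1.app zc pc
      simpa using this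
  refine ⟨v :: (l1 ++ z1 :: (l2 ++ z2 :: l3)), ⟨v, e, Pa.cons vs c2, ev, ?_, ?_⟩, ?_⟩
  · refine h.nd.sublist ?_
    exact (s1.append ((s2.append (s3.cons_cons _)).cons_cons _)).cons_cons _
  · simp; omega
  · simp; omega

theorem T2.part1 (h : T2 G H v z1 z2 Lf K Rt a a2 r1 b) (vz : G.Adj v z1)
    (vL : ∀ y ∈ Lf, G.Adj v y) {m : ℕ} (hm : m ≤ Lf.length) :
    ∃ l1 s, l1.Sublist Lf ∧ l1.length = m ∧ G.Adj v s ∧ Pa G s (l1 ++ [z1]) z1 := by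
  rcases Nat.eq_zero_or_pos m with rfl | hm0
  · exact ⟨[], z1, by simp, rfl, vz, Pa.one _⟩
  · obtain ⟨e, he, pe⟩ := h.pL.drop (t := Lf.length - m) (by omega)
    exact ⟨_, e, List.drop_sublist _ _, by simp; omega, vL e he, pe.snoc h.az⟩

theorem T2.part3 (h : T2 G H v z1 z2 Lf K Rt a a2 r1 b)
    (vR : ∀ y ∈ Rt, G.Adj v y) {m : ℕ} (hm0 : 1 ≤ m) (hm : m ≤ Rt.length) :
    ∃ l3 e, l3.Sublist Rt ∧ l3.length = m ∧ G.Adj e v ∧ Pa G z2 (z2 :: l3) e := by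
  obtain ⟨e, he, pe⟩ := h.pR.take hm0 hm
  exact ⟨_, e, List.take_sublist _ _, by simp; omega, (vR e he).symm, Pa.cons h.zr pe⟩

theorem T2.part2 (h : T2 G H v z1 z2 Lf K Rt a a2 r1 b) (zK : ∀ y ∈ K, G.Adj z1 y) {m : ℕ}
    (hm0 : 1 ≤ m) (hm : m ≤ K.length) :
    ∃ l2, l2.Sublist K ∧ l2.length = m ∧ Pa G z1 (z1 :: (l2 ++ [z2])) z2 := by
  have hK : K ≠ [] := by rintro rfl; simp at hm; omega
  obtain ⟨_, c, zc, pc⟩ := h.pK.consD (by simp)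
  obtain ⟨d, f, pd, df, pf⟩ := pc.split hK (by simp)
  obtain rfl := pf.hd_eq.symm
  obtain ⟨e, he, pe⟩ := pd.drop (t := K.length - m) (by omega)
  exact ⟨_, List.drop_sublist _ _, by simp; omega, Pa.cons (zK e he) (pe.snoc df)⟩

theorem T2.mainA [Fintype V] (h : T2 G H v z1 z2 Lf K Rt a a2 r1 b)
    (hs : ∀ u w, H u → H w → u ≠ w → Fintype.card V + 1 ≤ dg G u + dg G w)
    (vz1 : G.Adj v z1) (vz2 : G.Adj v z2) : Pan G := by
  have vR := h.vR vz1
  have vL : ∀ y ∈ Lf, G.Adj v y := fun y hy => h.rev.vR vz2 y (by simpa using hy)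
  have az := h.fz vz1
  have zK : ∀ y ∈ K, G.Adj z1 y := by
    intro y hy
    obtain ⟨_, c, zc, pc⟩ := h.pK.consD (by simp)
    obtain ⟨d, f, pd, df, pf⟩ := pc.split (List.ne_nil_of_mem hy) (by simp)
    refine chain_prop (P := fun y => G.Adj z1 y) pd zc ?_ y hy
    intro x w hx hw e zx
    by_contra hc
    have := h.nz a v z1 x w h.va.symm az vz1 zx e (h.LK h.aD hx) (h.vK hx) (h.LK h.aD hw)
      (h.vK hw) hc
    rcases this.1 with h' | h'
    · exact h.ltK hs hx h'
    · exact h.ltL _ h.aD h'.1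
  have p3 : ∀ m ≤ Rt.length, ∃ l3 e, l3.Sublist Rt ∧ l3.length = m ∧ G.Adj e v ∧
      Pa G z2 (z2 :: l3) e := by
    intro m hm
    rcases Nat.eq_zero_or_pos m with rfl | hm0
    · exact ⟨[], z2, by simp, rfl, vz2.symm, Pa.one _⟩
    · exact h.part3 vR hm0 hm
  have p2 : ∀ m ≤ K.length, (1 ≤ m ∨ K.length = 0) → ∃ l2, l2.Sublist K ∧ l2.length = m ∧
      Pa G z1 (z1 :: (l2 ++ [z2])) z2 := by
    intro m hm hm0
    rcases Nat.eq_zero_or_pos m with rfl | hm0'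
    · have : K = [] := List.length_eq_zero_iff.1 (by omega)
      subst this
      exact ⟨[], by simp, rfl, h.pK⟩
    · exact h.part2 zK hm0' hm
  have cyc : ∀ i j t, i ≤ Lf.length → j ≤ K.length → (1 ≤ j ∨ K.length = 0) → t ≤ Rt.length →
      HasCyc G (i + j + t + 3) := by
    intro i j t hi hj hj0 ht
    obtain ⟨l1, s, g1, rfl, g3, g4⟩ := h.part1 vz1 vL hi
    obtain ⟨l2, g5, rfl, g6⟩ := p2 j hj hj0
    obtain ⟨l3, e, g7, rfl, g8, g9⟩ := p3 t ht
    exact h.glue g1 g5 g7 g3 g4 g6 g9 g8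
  intro k hk hk'
  rw [h.card] at hk'
  rcases Nat.eq_or_lt_of_le hk with rfl | hk4
  · exact ⟨[v, a, z1], ⟨v, z1, Pa.cons h.va (Pa.cons az (Pa.one _)), vz1.symm, by
      simp [h.va.ne, vz1.ne, az.ne], by simp⟩, rfl⟩
  · obtain ⟨i, j, t, h1, h2, h3, h4, h5⟩ : ∃ i j t, i ≤ Lf.length ∧ j ≤ K.length ∧
        (1 ≤ j ∨ K.length = 0) ∧ t ≤ Rt.length ∧ i + j + t + 3 = k := by
      rcases Nat.lt_or_ge K.length (k - 3) with h1 | h1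
      · rcases Nat.lt_or_ge Lf.length (k - 3 - K.length) with h2 | h2
        · exact ⟨Lf.length, K.length, k - 3 - K.length - Lf.length, by omega, by omega, by omega,
            by omega, by omega⟩
        · exact ⟨k - 3 - K.length, K.length, 0, by omega, by omega, by omega, by omega, by omega⟩
      · exact ⟨0, k - 3, 0, by omega, by omega, by omega, by omega, by omega⟩
    rw [← h5]; exact cyc i j t h1 h2 h3 h4

theorem T2.mainB [Fintype V] (h : T2 G H v z1 z2 Lf K Rt a a2 r1 b)
    (hd : Fintype.card V + 1 ≤ 2 * dg G v)
    (vz1 : G.Adj v z1) (vz2 : ¬ G.Adj v z2) : Pan G := by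
  have vR := h.vR vz1
  have az := h.fz vz1
  have hcn : cn G v Lf ≤ 1 := by
    by_contra hc; exact vz2 (h.half (by omega))
  have zz : G.Adj z1 z2 := by
    by_contra hc
    have := h.nz a z1 v r1 z2 az h.va.symm vz1.symm (vR _ h.rD) h.zr.symm (h.LR h.aD h.rD)
      (h.zR h.rD) (h.Lz h.aD) hc vz2
    rcases this.1 with h' | h'
    · exact h.ltR _ h.rD h'
    · exact h.ltL _ h.aD h'.1
  have e := h.dgv v
  rw [cn_zero (l := K) (fun y hy => h.vK hy), cn_zero (l := [v]) (by simp),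
    cn_zero (l := [z2]) (by simpa using vz2)] at e
  have := cn_one G v z1
  have := cn_le G v Rt
  have hcard := h.card
  have hL1 : Lf.length = 1 := by
    have := List.length_pos_of_mem h.aD
    by_contra hL
    have p := h.pL
    have aD := h.aD
    have LR := @T2.LR _ _ _ _ _ _ _ _ _ _ _ _ _ h
    have ltL := h.ltL
    obtain ⟨E, hE⟩ := h.pL.hd
    have hE0 : E ≠ [] := by rintro rfl; simp [hE] at hL
    rw [hE] at p
    obtain ⟨_, c, ac, pc⟩ := p.consD hE0
    have hc : c ∈ Lf := by rw [hE]; simp [pc.mem_hd]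
    have vc : ¬ G.Adj v c := by
      intro vc
      have : 2 ≤ cn G v Lf := cn_ge (m := [a, c]) (by simp [ac.ne]) (by
        intro y hy; simp at hy; rcases hy with rfl | rfl
        · exact aD
        · exact hc) (by
        intro y hy; simp at hy; rcases hy with rfl | rfl
        · exact h.va
        · exact vc)
      omega
    have hR : Rt.length ≤ 1 := by
      by_contra hR
      have p := h.pR
      obtain ⟨E, hE⟩ := h.pR.hd
      have hE0 : E ≠ [] := by rintro rfl; simp [hE] at hR
      rw [hE] at p
      obtain ⟨_, r2, rr, pr⟩ := p.consD hE0
      have hr2 : r2 ∈ Rt := by rw [hE]; simp [pr.mem_hd]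
      have := h.nz r1 r2 v a c rr (vR _ h.rD).symm (vR _ hr2).symm h.va ac
        (nadj (LR aD h.rD)) (nadj (LR aD hr2)) (nadj (LR hc h.rD)) (nadj (LR hc hr2)) vc
      rcases this.1 with h' | h'
      · exact ltL _ aD h'
      · exact h.ltR _ h.rD h'.1
    omega
  have hRK : K.length + 1 ≤ Rt.length := by omega
  intro k hk hk'
  rcases Nat.eq_or_lt_of_le hk with rfl | hk4
  · exact ⟨[v, a, z1], ⟨v, z1, Pa.cons h.va (Pa.cons az (Pa.one _)), vz1.symm, by
      simp [h.va.ne, vz1.ne, az.ne], by simp⟩, rfl⟩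
  rcases Nat.lt_or_ge k (Rt.length + 4) with h1 | h1
  · obtain ⟨l3, e, g7, g, g8, g9⟩ := h.part3 vR (m := k - 3) (by omega) (by omega)
    have := h.glue (l1 := []) (l2 := []) (by simp) (by simp) g7 vz1 (Pa.one _)
      (Pa.cons zz (Pa.one _)) g9 g8
    have e : ([] : List V).length + ([] : List V).length + l3.length + 3 = k := by
      simp; omega
    rwa [e] at this
  · obtain ⟨l3, e, g7, g, g8, g9⟩ := h.part3 vR (m := k - K.length - 4) (by omega) (by omega)
    have := h.glue (List.Sublist.refl _) (List.Sublist.refl _) g7 h.va (h.pL.snoc h.az)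
      h.pK g9 g8
    have e : Lf.length + K.length + l3.length + 3 = k := by omega
    rwa [e] at this

theorem T2.main [Fintype V] (h : T2 G H v z1 z2 Lf K Rt a a2 r1 b)
    (hs : ∀ u w, H u → H w → u ≠ w → Fintype.card V + 1 ≤ dg G u + dg G w)
    (hd : Fintype.card V + 1 ≤ 2 * dg G v) : Pan G := by
  by_cases v1 : G.Adj v z1
  · by_cases v2 : G.Adj v z2
    · exact h.mainA hs v1 v2
    · exact h.mainB hd v1 v2
  · have v2 := (h.vz hd).resolve_left v1
    exact h.rev.mainB hd v2 v1
end


/-- Cut decomposition of a path. -/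
def Cut {V : Type} (G : SimpleGraph V) (l A : List V) (z : V) (B : List V) : Prop :=
  l = A ++ z :: B ∧ A ≠ [] ∧ B ≠ [] ∧ ∀ x ∈ A, ∀ y ∈ B, ¬ G.Adj x y

theorem decomp_lt {V : Type} {A B A' B' : List V} {z z' : V} (h : A ++ z :: B = A' ++ z' :: B')
    (hl : A.length < A'.length) : ∃ K, A' = A ++ z :: K ∧ B = K ++ z' :: B' := by
  rcases List.append_eq_append_iff.1 h with ⟨as, h1, h2⟩ | ⟨as, h1, h2⟩
  · cases as with
    | nil => simp at h1; subst h1; omega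
    | cons w K =>
      simp at h2
      obtain ⟨rfl, h2⟩ := h2
      exact ⟨K, h1, h2⟩
  · rw [h1] at hl; simp at hl

theorem few_H {V : Type} {G : SimpleGraph V} {H : V → Prop} (hNC : NC G H) (hNZ : NZ G H)
    (h : ∀ u w, H u → H w → u = w) : NC G (fun _ => False) ∧ NZ G (fun _ => False) := by
  constructor
  · intro c x y z h1 h2 h3 h4 h5 h6 h7 h8 h9 _ _
    by_cases Hx : H x
    · exact hNC c y z x h2 h3 h1 h6 (nadj h4) (nadj h5) h9 h7.symm h8.symm
        (fun h' => h7 (h _ _ Hx h')) (fun h' => h8 (h _ _ Hx h'))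
    · by_cases Hy : H y
      · exact hNC c x z y h1 h3 h2 h5 h4 (nadj h6) h8 h7 h9.symm Hx
          (fun h' => h9 (h _ _ Hy h'))
      · exact hNC c x y z h1 h2 h3 h4 h5 h6 h7 h8 h9 Hx Hy
  · intro a1 a2 a3 a4 a5 h1 h2 h3 h4 h5 h6 h7 h8 h9 h10
    exfalso
    obtain ⟨p, q⟩ := hNZ a1 a2 a3 a4 a5 h1 h2 h3 h4 h5 h6 h7 h8 h9 h10
    rcases p with p | ⟨p1, p2⟩
    · rcases q with q | q
      · exact h4.ne (h _ _ q p)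
      · exact h5.ne (h _ _ p q)
    · exact h1.ne (h _ _ p1 p2)

theorem cut_side {V : Type} [Fintype V] {G : SimpleGraph V} {H : V → Prop} {v z : V}
    {l A B : List V}
    (hs : ∀ u w, H u → H w → u ≠ w → Fintype.card V + 1 ≤ dg G u + dg G w)
    (nd : (v :: l).Nodup) (full : ∀ x, x ∈ v :: l) (hc : Cut G l A z B) {x y : V}
    (hx : x ∈ A) (hy : y ∈ B) (Hx : H x) (Hy : H y) : False := by
  obtain ⟨rfl, _, _, no⟩ := hc
  have nd' := nd
  simp only [List.nodup_cons, List.nodup_append, List.mem_append, List.mem_cons, not_or] at nd'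
  have e : [x, y, v, z].Nodup := by
    simp only [List.nodup_cons, List.mem_cons, List.not_mem_nil, or_false, not_or]
    grind
  have hxy : x ≠ y := by simp at e; tauto
  have := hs x y Hx Hy hxy
  have := common (G := G) e (no x hx y hy) (by
    intro w xw yw
    have := full w
    simp only [List.mem_append, List.mem_cons] at this
    rcases this with h | h | h | h
    · exact Or.inl h
    · exact absurd yw.symm (no w h y hy)
    · exact Or.inr h
    · exact absurd xw (no x hx w h))
  omega

theorem big {V : Type} [Fintype V] {G : SimpleGraph V} {H : V → Prop} {v s t : V} {l : List V}
    (IH : ∀ (W : Type) [Fintype W] (G' : SimpleGraph W) (H' : W → Prop),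
      Fintype.card W < Fintype.card V → MTS G' H')
    (hNC : NC G H) (hNZ : NZ G H)
    (hs : ∀ u w, H u → H w → u ≠ w → Fintype.card V + 1 ≤ dg G u + dg G w)
    (hF : ∀ l x y, Pa G x l y → G.Adj y x → l.Nodup → (∀ u, u ∈ l) → ¬ (H x ∧ H y))
    (hl : Pa G s l t) (vs : G.Adj v s) (tv : G.Adj t v) (nd : (v :: l).Nodup)
    (full : ∀ x, x ∈ v :: l) (h4 : 4 ≤ l.length) (Hv : H v)
    (hd : Fintype.card V + 1 ≤ 2 * dg G v) : Pan G := by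
  classical
  have hcard : Fintype.card V = l.length + 1 := by rw [← card_full nd full]; simp
  have lt : ¬ H t := fun Ht => hF _ v t (Pa.cons vs hl) tv nd full ⟨Hv, Ht⟩
  have ls : ¬ H s := by
    have hper : (v :: l).reverse.Perm (v :: l) := List.reverse_perm _
    have := (Pa.cons vs hl).rev
    intro Hs
    have hper2 : (v :: l.reverse).Perm (v :: l) := by
      simp [List.perm_iff_count, List.count_cons]
    exact hF _ v s (Pa.cons tv.symm hl.rev) vs.symm (hper2.nodup_iff.2 nd)
      (fun u => hper2.mem_iff.2 (full u)) ⟨Hv, Hs⟩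
  have side := fun A z B hc x y => @cut_side V _ G H v z l A B hs nd full hc x y
  have single_t : ∀ A z B, Cut G l A z B → ¬ 2 ≤ B.length → ∀ y ∈ B, ¬ H y := by
    rintro A z B ⟨e, _, hB, _⟩ h2 y hy
    have : B.length = 1 := by
      have := List.length_pos_of_mem hy; omega
    obtain ⟨w, rfl⟩ := List.length_eq_one_iff.1 this
    have : t = w := by
      rw [e] at hl
      exact Pa.lst_eq (m := A ++ [z]) (by simpa using hl)
    simp at hy; rw [hy, ← this]; exact lt
  by_cases hα : ∃ A, ∃ z B, Cut G l A z B ∧ 2 ≤ B.length ∧ ∀ x ∈ A, ¬ H x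
  · obtain ⟨A, ⟨z, B, hc, hB2, hA⟩, hmax⟩ := exists_max
      (fun A => ∃ z B, Cut G l A z B ∧ 2 ≤ B.length ∧ ∀ x ∈ A, ¬ H x)
      (fun A => A.length) l.length (by
        rintro A ⟨z, B, ⟨e, _⟩, _⟩
        rw [e]; simp) hα
    by_cases hβ : ∃ A' z' B', Cut G l A' z' B' ∧ A.length < A'.length
    · obtain ⟨A', z', B', hc', hlen⟩ := hβ
      have hB' : ∀ y ∈ B', ¬ H y := by
        by_cases h2 : 2 ≤ B'.length
        · intro y hy Hy
          have hA' : ∀ x ∈ A', ¬ H x := fun x hx Hx => side _ _ _ hc' x y hx hy Hx Hy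
          have := hmax A' ⟨z', B', hc', h2, hA'⟩
          omega
        · exact single_t _ _ _ hc' h2
      obtain ⟨e, hA0, hB0, no⟩ := hc
      obtain ⟨e', hA0', hB0', no'⟩ := hc'
      obtain ⟨K, rfl, rfl⟩ := decomp_lt (e.symm.trans e') hlen
      subst e
      obtain ⟨a2, c, pA, a2c, pc⟩ := hl.split hA0 (by simp)
      obtain rfl := pc.hd_eq
      have pc' : Pa G c ((c :: (K ++ [z'])) ++ B') t := by simpa using pc
      obtain ⟨d, r1, pd, dr, pr⟩ := pc'.split (by simp) hB0'
      have : d = z' := Pa.lst_eq (m := c :: K) (by simpa using pd)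
      subst this
      exact (T2.main (H := H) ⟨pA, pd, pr, vs, a2c, dr, tv, nd, full, no, no', hA, hB', hNC, hNZ, Hv⟩ hs hd)
    · obtain ⟨rfl, hA0, hB0, no⟩ := hc
      obtain ⟨a2, c, pA, a2c, pc⟩ := hl.split hA0 (by simp)
      obtain rfl := pc.hd_eq
      obtain ⟨_, d, cd, pB⟩ := pc.consD hB0
      have hper : (v :: (B.reverse ++ c :: A.reverse)).Perm (v :: (A ++ c :: B)) := by
        simp [List.perm_iff_count, List.count_cons] <;> omega
      have T : T1 G H v c B.reverse A.reverse t d a2 s :=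
        ⟨pB.rev, pA.rev, tv.symm, cd.symm, a2c.symm, vs.symm, hper.nodup_iff.2 nd,
          fun x => hper.mem_iff.2 (full x),
          fun x hx y hy e => no y (by simpa using hy) x (by simpa using hx) e.symm,
          fun y hy => hA y (by simpa using hy), hNC, hNZ, lt, Hv⟩
      refine T.main IH hs hF (by simpa using hB2) hd ?_
      intro l1 u l2 e h1 h2
      by_contra hno
      push Not at hno
      apply hβ
      have e2 := congrArg List.reverse e
      simp only [List.reverse_append, List.reverse_cons, List.reverse_reverse, List.reverse_nil,
        List.nil_append, List.append_assoc, List.cons_append] at e2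
      -- c :: B = l2.reverse ++ u :: l1.reverse
      have hl2 : l2.reverse ≠ [] := by simpa using h2
      obtain ⟨w, M, hM⟩ := List.exists_cons_of_ne_nil hl2
      rw [hM] at e2
      simp only [List.cons_append, List.cons.injEq] at e2
      obtain ⟨rfl, e2⟩ := e2
      refine ⟨A ++ c :: M, u, l1.reverse, ⟨?_, by simp, by simpa using h1, ?_⟩, by simp⟩
      · rw [e2]; simp
      · intro x hx y hy e
        have hyB : y ∈ B := by rw [e2]; simp at hy ⊢; tauto
        simp only [List.mem_append] at hx
        rcases hx with hx | hx
        · exact no x hx y hyB e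
        · rw [← hM] at hx
          exact hno y (by simpa using hy) x (by simpa using hx) e.symm
  · by_cases hβ : ∃ j, ∃ A z B, Cut G l A z B ∧ A.length = j
    · have hmin := fun j => @Nat.find_min _ _ hβ j
      obtain ⟨A, z, B, hc, hj⟩ := Nat.find_spec hβ
      have hB : ∀ y ∈ B, ¬ H y := by
        by_cases h2 : 2 ≤ B.length
        · intro y hy Hy
          exact hα ⟨A, z, B, hc, h2, fun x hx Hx => side _ _ _ hc x y hx hy Hx Hy⟩
        · exact single_t _ _ _ hc h2
      have hA2 : 2 ≤ A.length := by
        by_contra h2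
        apply hα
        refine ⟨A, z, B, hc, ?_, ?_⟩
        · have := hc.1
          rw [this] at h4
          simp at h4; omega
        · obtain ⟨e, hA, _⟩ := hc
          intro x hx
          have : A.length = 1 := by
            have := List.length_pos_of_mem hx; omega
          obtain ⟨w, rfl⟩ := List.length_eq_one_iff.1 this
          rw [e] at hl
          have := hl.hd_eq
          simp at hx; rw [hx, ← this]; exact ls
      obtain ⟨e, hA0, hB0, no⟩ := hc
      subst e
      obtain ⟨a2, c, pA, a2c, pc⟩ := hl.split hA0 (by simp)
      obtain rfl := pc.hd_eq
      obtain ⟨_, d, cd, pB⟩ := pc.consD hB0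
      have T : T1 G H v c A B s a2 d t :=
        ⟨pA, pB, vs, a2c, cd, tv, nd, full, no, hB, hNC, hNZ, ls, Hv⟩
      refine T.main IH hs hF hA2 hd ?_
      intro l1 u l2 e h1 h2
      by_contra hno
      push Not at hno
      rcases nil_or_snoc l2 with rfl | ⟨M, w, rfl⟩
      · exact h2 rfl
      have e2 : A ++ [c] = (l1 ++ u :: M) ++ [w] := by rw [e]; simp
      obtain ⟨e3, e4⟩ := List.append_inj' e2 rfl
      simp only [List.cons.injEq, and_true] at e4
      subst e4
      refine hmin l1.length ?_ ⟨l1, u, M ++ c :: B, ⟨by rw [e3]; simp, h1, by simp, ?_⟩, rfl⟩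
      · rw [← hj, e3]; simp
      · intro x hx y hy ee
        have hxA : x ∈ A := by rw [e3]; simp [hx]
        simp only [List.mem_append, List.mem_cons] at hy
        rcases hy with hy | rfl | hy
        · exact hno x hx y (by simp [hy]) ee
        · exact hno x hx y (by simp) ee
        · exact no x hxA y hy ee
    · have hNo : NoCut G l := by
        intro l1 u l2 e h1 h2
        by_contra hno
        push Not at hno
        exact hβ ⟨l1.length, l1, u, l2, ⟨e, h1, h2, hno⟩, rfl⟩
      have ndl := nd.of_cons
      have dle : ∀ x, dg G x ≤ cn G x l + 1 := by
        intro x; rw [dg_full G x nd full]; exact cn_cons_le _ _ _ _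
      obtain ⟨C, hC, hp⟩ := ind_ham hl ndl hNo (by omega) hNC hNZ (by
        intro u w hu hw Hu Hw huw
        have := hs u w Hu Hw huw
        have := dle u
        have := dle w
        omega)
      intro k hk hk'
      have hv : v ∉ l := by simp at nd; exact nd.1
      refine shift_lem hC (v := v) (by rwa [hp.mem_iff]) ?_ hk (by rw [hp.length_eq]; omega)
      rw [cn_perm G v hp, hp.length_eq]
      have : dg G v = cn G v l := by rw [dg_full G v nd full, cn_cons_neg (by simp)]
      omega

theorem MT : ∀ (n : ℕ) (V : Type) [Fintype V] (G : SimpleGraph V) (H : V → Prop),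
    Fintype.card V = n → MTS G H := by
  intro n
  induction n using Nat.strong_induction_on with
  | _ n ih =>
  intro V _ G H hn hT h3 hNC hNZ hs
  classical
  by_cases h2 : ∀ u w, H u → H w → u = w
  · obtain ⟨a, b⟩ := few_H hNC hNZ h2
    exact light_pan hT h3 a b
  left
  push Not at h2
  obtain ⟨u, w, Hu, Hw, huw⟩ := h2
  obtain ⟨v, Hv, hd⟩ : ∃ v, H v ∧ Fintype.card V + 1 ≤ 2 * dg G v := by
    have := hs u w Hu Hw huw
    rcases Nat.le_total (dg G u) (dg G w) with h | h
    · exact ⟨w, Hw, by omega⟩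
    · exact ⟨u, Hu, by omega⟩
  obtain ⟨C, hC, fullC⟩ := ham_thm hT h3 hNC hNZ (fun u w a b c => by
    have := hs u w a b c; omega)
  obtain ⟨l, hl, hp⟩ := hC.rot_to (fullC v)
  have full : ∀ x, x ∈ v :: l := fun x => hp.mem_iff.2 (fullC x)
  have nd := hl.nodup
  have hcard := card_full nd full
  obtain ⟨s, t, pl, vs, tv⟩ := hl.parts
  by_contra hP
  have hF : ∀ l x y, Pa G x l y → G.Adj y x → l.Nodup → (∀ u, u ∈ l) → ¬ (H x ∧ H y) := by
    rintro l x y p e nd full ⟨Hx, Hy⟩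
    apply hP
    intro k hk hk'
    have hc := card_full nd full
    refine hakimi p e nd (by omega) ?_ hk (by omega)
    rw [← dg_full G x nd full, ← dg_full G y nd full, hc]
    exact hs x y Hx Hy e.ne'
  simp only [List.length_cons] at hcard
  rcases Nat.lt_or_ge l.length 4 with h4 | h4
  · apply hP
    intro k hk hk'
    rcases Nat.eq_or_lt_of_le hk' with h | h
    · exact ⟨_, hl, by simp; omega⟩
    · have hk3 : k = 3 := by omega
      have hl3 : l.length = 3 := by omega
      subst hk3
      obtain ⟨x, y, z, rfl⟩ := List.length_eq_three.1 hl3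
      have e := dg_full G v nd full
      rw [cn_cons_neg (by simp)] at e
      obtain ⟨rfl, c, xc, pc⟩ := pl.consD (by simp)
      obtain rfl := pc.hd_eq
      have vc : G.Adj v c := by
        by_contra hc
        have := cn_cons_le G v s [c, z]
        rw [cn_cons_neg hc] at this
        have := cn_one G v z
        omega
      exact ⟨[v, s, c], ⟨v, c, Pa.cons vs (Pa.cons xc (Pa.one _)), vc.symm, by
        simp [vs.ne, vc.ne, xc.ne], by simp⟩, rfl⟩
  · exact hP (big (fun W _ G' H' hW => ih (Fintype.card W) (hn ▸ hW) W G' H' rfl) hNC hNZ hs hF pl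
      vs tv nd full h4 Hv hd)

theorem dg_eq_degree {V : Type} [Fintype V] (G : SimpleGraph V) [DecidableRel G.Adj] (v : V) :
    dg G v = G.degree v := by
  classical
  unfold dg cn
  rw [List.countP_eq_length_filter, ← G.card_neighborFinset_eq_degree v]
  have hnd : ((Finset.univ : Finset V).toList.filter
      (fun y => decide (G.Adj v y))).Nodup := (Finset.nodup_toList _).filter _
  have h2 : G.neighborFinset v = ((Finset.univ : Finset V).toList.filter
      (fun y => decide (G.Adj v y))).toFinset := by
    ext y; simp
  rw [h2, List.toFinset_card_of_nodup hnd]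
  congr 1
  apply List.filter_congr
  intro y _
  simp

theorem dist_two_of {W : Type} (R : SimpleGraph W) {a b c : W} (h1 : R.Adj a c) (h2 : R.Adj c b)
    (h3 : ¬ R.Adj a b) (h4 : a ≠ b) : R.dist a b = 2 := by
  have hle : R.dist a b ≤ 2 := by
    simpa using SimpleGraph.dist_le (Walk.cons h1 (Walk.cons h2 Walk.nil))
  have hr : R.Reachable a b := ⟨Walk.cons h1 (Walk.cons h2 Walk.nil)⟩
  have h0 : R.dist a b ≠ 0 := fun h => h4 (hr.dist_eq_zero_iff.1 h)
  have h1' : R.dist a b ≠ 1 := fun h => h3 (SimpleGraph.dist_eq_one_iff_adj.1 h)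
  omega

theorem TC_of_twoConnected {V : Type} [Fintype V] (G : SimpleGraph V) (h : TwoConnected G) :
    TC G := by
  intro v S ⟨x, hx, sx⟩ ⟨y, hy, sy⟩
  obtain ⟨p⟩ := (h.2 v).preconnected ⟨x, hx⟩ ⟨y, hy⟩
  obtain ⟨d, _, h1, h2⟩ := p.exists_boundary_dart {u | S u.1} sx sy
  exact ⟨d.fst.1, d.snd.1, d.fst.2, d.snd.2, h1, h2, d.adj⟩

theorem connected_of_twoConnected {V : Type} [Fintype V] (G : SimpleGraph V)
    (h : TwoConnected G) : G.Connected := by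
  classical
  have hc := h.1
  have hne : Nonempty V := Fintype.card_pos_iff.1 (by omega)
  refine { preconnected := ?_, nonempty := hne }
  intro x y
  have : ∃ v : V, v ∉ ({x, y} : Finset V) := by
    by_contra hcon
    push Not at hcon
    have h1 : (Finset.univ : Finset V) ⊆ {x, y} := fun v _ => hcon v
    have h2 := Finset.card_le_card h1
    have h3 := Finset.card_le_two (a := x) (b := y)
    rw [Finset.card_univ] at h2
    omega
  obtain ⟨v, hv⟩ := this
  simp only [Finset.mem_insert, Finset.mem_singleton, not_or] at hv
  have hr := (h.2 v).preconnected ⟨x, Ne.symm hv.1⟩ ⟨y, Ne.symm hv.2⟩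
  exact hr.map (Embedding.induce _).toHom

theorem max_split {N a b : ℕ} (h : N + 1 ≤ 2 * max a b) : N + 1 ≤ 2 * a ∨ N + 1 ≤ 2 * b := by
  omega

theorem NC_of_heavy {V : Type} [Fintype V] (G : SimpleGraph V) [DecidableRel G.Adj]
    (h : F1Heavy G claw) : NC G (fun v => Fintype.card V + 1 ≤ 2 * G.degree v) := by
  intro c x y z hx hy hz nxy nxz nyz dxy dxz dyz Hx Hy
  have e1 := hx.ne
  have e2 := hy.ne
  have e3 := hz.ne
  let f : claw ↪g G :=
    { toFun := ![c, x, y, z]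
      inj' := by
        intro i j hij
        fin_cases i <;> fin_cases j <;> simp_all [eq_comm]
      map_rel_iff' := by
        intro i j
        change G.Adj (![c, x, y, z] i) (![c, x, y, z] j) ↔ claw.Adj i j
        have s1 := hx.symm
        have s2 := hy.symm
        have s3 := hz.symm
        have t1 : ¬ G.Adj y x := fun h => nxy h.symm
        have t2 : ¬ G.Adj z x := fun h => nxz h.symm
        have t3 : ¬ G.Adj z y := fun h => nyz h.symm
        clear h
        fin_cases i <;> fin_cases j <;> simp_all [claw] }
  have hd : claw.dist 1 2 = 2 := by
    apply dist_two_of claw (c := 0) <;> simp [claw]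
  rcases max_split (h f 1 2 hd) with h1 | h1
  · exact Hx h1
  · exact Hy h1

theorem NZ_of_heavy {V : Type} [Fintype V] (G : SimpleGraph V) [DecidableRel G.Adj]
    (h : F1Heavy G (Zgraph 2)) : NZ G (fun v => Fintype.card V + 1 ≤ 2 * G.degree v) := by
  intro a1 a2 a3 a4 a5 h12 h13 h23 h34 h45 n14 n24 n15 n25 n35
  have e12 := h12.ne
  have e13 := h13.ne
  have e23 := h23.ne
  have e34 := h34.ne
  have e45 := h45.ne
  have e14 : a1 ≠ a4 := by rintro rfl; exact n24 h12.symm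
  have e24 : a2 ≠ a4 := by rintro rfl; exact n14 h12
  have e15 : a1 ≠ a5 := by rintro rfl; exact n14 h45.symm
  have e25 : a2 ≠ a5 := by rintro rfl; exact n24 h45.symm
  have e35 : a3 ≠ a5 := by rintro rfl; exact n15 h13
  let f : Zgraph 2 ↪g G :=
    { toFun := ![a1, a2, a3, a4, a5]
      inj' := by
        intro i j hij
        fin_cases i <;> fin_cases j <;> simp_all [eq_comm]
      map_rel_iff' := by
        intro i j
        change G.Adj (![a1, a2, a3, a4, a5] i) (![a1, a2, a3, a4, a5] j) ↔ (Zgraph 2).Adj i j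
        have s1 := h12.symm
        have s2 := h13.symm
        have s3 := h23.symm
        have s4 := h34.symm
        have s5 := h45.symm
        have t1 : ¬ G.Adj a4 a1 := fun h => n14 h.symm
        have t2 : ¬ G.Adj a4 a2 := fun h => n24 h.symm
        have t3 : ¬ G.Adj a5 a1 := fun h => n15 h.symm
        have t4 : ¬ G.Adj a5 a2 := fun h => n25 h.symm
        have t5 : ¬ G.Adj a5 a3 := fun h => n35 h.symm
        clear h
        fin_cases i <;> fin_cases j <;> simp_all [Zgraph] }
  have d1 : (Zgraph 2).dist 0 3 = 2 := by
    apply dist_two_of (Zgraph 2) (c := 2) <;> simp [Zgraph]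
  have d2 : (Zgraph 2).dist 1 3 = 2 := by
    apply dist_two_of (Zgraph 2) (c := 2) <;> simp [Zgraph]
  have d3 : (Zgraph 2).dist 2 4 = 2 := by
    apply dist_two_of (Zgraph 2) (c := 3) <;> simp [Zgraph]
  have r1 : Fintype.card V + 1 ≤ 2 * G.degree a1 ∨ Fintype.card V + 1 ≤ 2 * G.degree a4 :=
    max_split (h f 0 3 d1)
  have r2 : Fintype.card V + 1 ≤ 2 * G.degree a2 ∨ Fintype.card V + 1 ≤ 2 * G.degree a4 :=
    max_split (h f 1 3 d2)
  have r3 : Fintype.card V + 1 ≤ 2 * G.degree a3 ∨ Fintype.card V + 1 ≤ 2 * G.degree a5 :=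
    max_split (h f 2 4 d3)
  refine ⟨?_, r3⟩
  show Fintype.card V + 1 ≤ 2 * G.degree a4 ∨
    (Fintype.card V + 1 ≤ 2 * G.degree a1 ∧ Fintype.card V + 1 ≤ 2 * G.degree a2)
  tauto

theorem pancyclic_of_claw_Z2_f1_heavy {V : Type} [Fintype V] (G : SimpleGraph V)
    [DecidableRel G.Adj] (h2 : TwoConnected G) (hnc : ¬ IsCycleGraph G)
    (hclaw : F1Heavy G claw) (hZ2 : F1Heavy G (Zgraph 2)) :
    IsPancyclic G := by
  have hs : ∀ u w, Fintype.card V + 1 ≤ 2 * G.degree u → Fintype.card V + 1 ≤ 2 * G.degree w →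
      u ≠ w → Fintype.card V + 1 ≤ dg G u + dg G w := by
    intro u w hu hw _
    rw [dg_eq_degree, dg_eq_degree]
    omega
  rcases MT _ V G (fun v => Fintype.card V + 1 ≤ 2 * G.degree v) rfl (TC_of_twoConnected G h2) h2.1
    (NC_of_heavy G hclaw) (NZ_of_heavy G hZ2) hs with h | h
  · intro k h3 hk
    exact (h k h3 hk).to
  · exact absurd ⟨connected_of_twoConnected G h2, fun v => by rw [← dg_eq_degree]; exact h v⟩ hnc
end

section
/- Let G be a 2-connected graph. If G contains no induced subgraph isomorphic to K_{1,3} and no induced subgraph isomorphic to P_6, then G is Hamiltonian. -/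
open SimpleGraph

namespace ClawP6

variable {V : Type} {G : SimpleGraph V}

/-- `l` is (the vertex list of) a walk from `a` to `b`. -/
def Seg (G : SimpleGraph V) (a b : V) (l : List V) : Prop :=
  l.IsChain G.Adj ∧ l.head? = some a ∧ l.getLast? = some b

lemma Seg.single (a : V) : Seg G a a [a] := by simp [Seg]

lemma Seg.app {a b c d : V} {l m : List V} (h1 : Seg G a b l) (h : G.Adj b c)
    (h2 : Seg G c d m) : Seg G a d (l ++ m) := by
  obtain ⟨c1, e1, f1⟩ := h1
  obtain ⟨c2, e2, f2⟩ := h2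
  refine ⟨List.isChain_append.2 ⟨c1, c2, ?_⟩, by simp [e1], by simp [f2]⟩
  simp [f1, e2, h]

lemma Seg.cons {a c d : V} {m : List V} (h : G.Adj a c) (h2 : Seg G c d m) :
    Seg G a d (a :: m) := (Seg.single a).app h h2

lemma Seg.rev {a b : V} {l : List V} (h : Seg G a b l) : Seg G b a l.reverse := by
  obtain ⟨c1, e1, f1⟩ := h
  refine ⟨?_, by simp [f1], by simp [e1]⟩
  rw [List.isChain_reverse]
  exact c1.imp (fun a b h => h.symm)

lemma Seg.split {a b : V} {l m : List V} (h : Seg G a b (l ++ m)) (hl : l ≠ []) (hm : m ≠ []) :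
    ∃ c d, Seg G a c l ∧ G.Adj c d ∧ Seg G d b m := by
  obtain ⟨c1, e1, f1⟩ := h
  obtain ⟨c, hc⟩ := Option.ne_none_iff_exists'.1 (mt List.getLast?_eq_none_iff.1 hl)
  obtain ⟨d, hd⟩ := Option.ne_none_iff_exists'.1 (mt List.head?_eq_none_iff.1 hm)
  obtain ⟨e, he⟩ := Option.ne_none_iff_exists'.1 (mt List.getLast?_eq_none_iff.1 hm)
  obtain ⟨f, hf⟩ := Option.ne_none_iff_exists'.1 (mt List.head?_eq_none_iff.1 hl)
  obtain ⟨x, y, z⟩ := List.isChain_append.1 c1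
  refine ⟨c, d, ⟨x, ?_, hc⟩, z c (by simp [hc]) d (by simp [hd]), ⟨y, hd, ?_⟩⟩
  · simpa [hf] using e1
  · simpa [he] using f1

lemma Seg.head_eq {a b x : V} {l : List V} (h : Seg G a b (x :: l)) : x = a := by
  simpa using h.2.1

lemma Seg.tail {a b : V} {x y : V} {l : List V} (h : Seg G a b (x :: y :: l)) :
    x = a ∧ G.Adj x y ∧ Seg G y b (y :: l) := by
  obtain ⟨c, d, h1, h2, h3⟩ := Seg.split (l := [x]) (m := y :: l) h (by simp) (by simp)
  have e1 := h.head_eq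
  have e2 := h3.head_eq
  have e3 : x = c := by simpa using h1.2.2
  subst e2; subst e3
  exact ⟨e1, h2, h3⟩

lemma Seg.exists_cons {a b : V} {l : List V} (h : Seg G a b l) : ∃ m, l = a :: m := by
  obtain ⟨_, h, _⟩ := h
  cases l with
  | nil => simp at h
  | cons x m => exact ⟨m, by simpa using h⟩

lemma Seg.ne_nil {a b : V} {l : List V} (h : Seg G a b l) : l ≠ [] := by
  obtain ⟨m, rfl⟩ := h.exists_cons
  simp

lemma Seg.left_mem {a b : V} {l : List V} (h : Seg G a b l) : a ∈ l := by
  obtain ⟨m, rfl⟩ := h.exists_cons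
  simp

lemma Seg.right_mem {a b : V} {l : List V} (h : Seg G a b l) : b ∈ l := by
  simpa using h.rev.left_mem

lemma Seg.of_ne_nil {l : List V} (h : l.IsChain G.Adj) (hl : l ≠ []) : ∃ a b, Seg G a b l := by
  obtain ⟨c, hc⟩ := Option.ne_none_iff_exists'.1 (mt List.getLast?_eq_none_iff.1 hl)
  obtain ⟨d, hd⟩ := Option.ne_none_iff_exists'.1 (mt List.head?_eq_none_iff.1 hl)
  exact ⟨d, c, h, hd, hc⟩

lemma no_claw (hclaw : RFree G claw) {c x y z : V} (hx : G.Adj c x) (hy : G.Adj c y)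
    (hz : G.Adj c z) (nxy : x ≠ y) (nxz : x ≠ z) (nyz : y ≠ z) (h1 : ¬ G.Adj x y)
    (h2 : ¬ G.Adj x z) (h3 : ¬ G.Adj y z) : False := by
  refine hclaw.false ⟨⟨![c, x, y, z], ?_⟩, ?_⟩
  · have := hx.ne; have := hy.ne; have := hz.ne
    intro i j
    fin_cases i <;> fin_cases j <;> simp <;> grind
  · intro i j
    have h1' := mt G.adj_symm h1
    have h2' := mt G.adj_symm h2
    have h3' := mt G.adj_symm h3
    change G.Adj (![c, x, y, z] i) (![c, x, y, z] j) ↔ claw.Adj i j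
    fin_cases i <;> fin_cases j <;>
      simp [claw, hx, hy, hz, hx.symm, hy.symm, hz.symm, h1, h2, h3, h1', h2', h3']

lemma no_P6 (hP6 : RFree G (pathGraph 6)) {a b c d e f : V}
    (h1 : G.Adj a b) (h2 : G.Adj b c) (h3 : G.Adj c d) (h4 : G.Adj d e) (h5 : G.Adj e f)
    (n1 : ¬ G.Adj a c) (n2 : ¬ G.Adj a d) (n3 : ¬ G.Adj a e) (n4 : ¬ G.Adj a f)
    (n5 : ¬ G.Adj b d) (n6 : ¬ G.Adj b e) (n7 : ¬ G.Adj b f)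
    (n8 : ¬ G.Adj c e) (n9 : ¬ G.Adj c f) (n10 : ¬ G.Adj d f) : False := by
  have key : ∀ i j : Fin 6, G.Adj (![a, b, c, d, e, f] i) (![a, b, c, d, e, f] j) ↔
      (pathGraph 6).Adj i j := by
    intro i j
    have m1 := mt G.adj_symm n1
    have m2 := mt G.adj_symm n2
    have m3 := mt G.adj_symm n3
    have m4 := mt G.adj_symm n4
    have m5 := mt G.adj_symm n5
    have m6 := mt G.adj_symm n6
    have m7 := mt G.adj_symm n7
    have m8 := mt G.adj_symm n8
    have m9 := mt G.adj_symm n9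
    have m10 := mt G.adj_symm n10
    rw [pathGraph_adj]
    fin_cases i <;> fin_cases j <;>
      simp [h1, h2, h3, h4, h5, h1.symm, h2.symm, h3.symm, h4.symm, h5.symm,
        n1, n2, n3, n4, n5, n6, n7, n8, n9, n10, m1, m2, m3, m4, m5, m6, m7, m8, m9, m10]
  have tw : ∀ i j : Fin 6, (∀ k, (i.val + 1 = k.val ∨ k.val + 1 = i.val) ↔
      (j.val + 1 = (k : Fin 6).val ∨ k.val + 1 = j.val)) → i = j := by decide
  refine hP6.false ⟨⟨![a, b, c, d, e, f], ?_⟩, fun {i j} => key i j⟩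
  intro i j hij
  apply tw
  intro k
  rw [← pathGraph_adj, ← pathGraph_adj, ← key, ← key, hij]

/-- No cycle has more than `N` vertices (edges count as 2-cycles). -/
def CycBound (G : SimpleGraph V) (N : ℕ) : Prop :=
  ∀ a b l, Seg G a b l → G.Adj b a → l.Nodup → l.length ≤ N

/-- A longest cycle `u A v B` together with an ear `P` from `u` to `v`. -/
structure Conf (G : SimpleGraph V) (N : ℕ) (u : V) (A : List V) (v : V) (B P : List V)
    (a₁ a₂ b₁ b₂ p q : V) : Prop where
  sA : Seg G a₁ a₂ A
  sB : Seg G b₁ b₂ B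
  sP : Seg G p q P
  ua : G.Adj u a₁
  av : G.Adj a₂ v
  vb : G.Adj v b₁
  bu : G.Adj b₂ u
  up : G.Adj u p
  qv : G.Adj q v
  nd : (u :: A ++ v :: B ++ P).Nodup
  len : (u :: A ++ v :: B).length = N

section
variable {N : ℕ} {u v a₁ a₂ b₁ b₂ p q : V} {A B P : List V}

lemma perm_nodup {l m : List V} (h : l.Nodup) (e : List.Perm l m) : m.Nodup := e.nodup_iff.1 h

/-- Reverse the cycle. -/
lemma Conf.rev (h : Conf G N u A v B P a₁ a₂ b₁ b₂ p q) :
    Conf G N u B.reverse v A.reverse P b₂ b₁ a₂ a₁ p q := by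
  classical
  refine ⟨h.sB.rev, h.sA.rev, h.sP, h.bu.symm, h.vb.symm, h.av.symm, h.ua.symm, h.up, h.qv, ?_, ?_⟩
  · refine perm_nodup h.nd (List.perm_iff_count.2 fun a => ?_)
    simp [List.count_cons]; omega
  · have := h.len
    simp at this ⊢; omega

/-- Exchange the roles of `u` and `v`. -/
lemma Conf.swap (h : Conf G N u A v B P a₁ a₂ b₁ b₂ p q) :
    Conf G N v B u A P.reverse b₁ b₂ a₁ a₂ q p := by
  classical
  refine ⟨h.sB, h.sA, h.sP.rev, h.vb, h.bu, h.ua, h.av, h.qv.symm, h.up.symm, ?_, ?_⟩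
  · refine perm_nodup h.nd (List.perm_iff_count.2 fun a => ?_)
    simp [List.count_cons]; omega
  · have := h.len
    simp at this ⊢; omega

/-- A cycle on all of the vertices of the configuration is impossible. -/
lemma Conf.bad (hN : CycBound G N) (h : Conf G N u A v B P a₁ a₂ b₁ b₂ p q) {x y : V} {l : List V}
    (hl : Seg G x y l) (hyx : G.Adj y x) (hp : List.Perm (u :: A ++ v :: B ++ P) l) : False := by
  have h1 := hN x y l hl hyx (perm_nodup h.nd hp)
  have h2 := hp.length_eq
  have h3 := h.len
  have h4 := List.length_pos_of_ne_nil h.sP.ne_nil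
  simp at h1 h2 h3
  omega

lemma Conf.a1p (hN : CycBound G N) (h : Conf G N u A v B P a₁ a₂ b₁ b₂ p q) : ¬ G.Adj a₁ p := by
  classical
  intro e
  -- cycle: u, rest of P cannot be used when `p` alone is inserted
  obtain ⟨P', rfl⟩ := h.sP.exists_cons
  have s : Seg G u b₂ (u :: (p :: (A ++ v :: B))) :=
    Seg.cons h.up (Seg.cons e.symm (h.sA.app h.av (Seg.cons h.vb h.sB)))
  have nd : (u :: (p :: (A ++ v :: B))).Nodup := by
    have e : List.Perm ((u :: (p :: (A ++ v :: B))) ++ P') (u :: A ++ v :: B ++ p :: P') :=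
      List.perm_iff_count.2 fun a => by simp [List.count_cons]; omega
    exact (List.nodup_append.1 (e.nodup_iff.2 h.nd)).1
  have h1 := hN _ _ _ s h.bu nd
  have h2 := h.len
  simp at h1 h2
  omega

lemma Conf.a1q (hN : CycBound G N) (h : Conf G N u A v B P a₁ a₂ b₁ b₂ p q) : ¬ G.Adj a₁ q := by
  classical
  intro e
  refine h.bad hN (Seg.cons h.up (h.sP.app e.symm (h.sA.app h.av (Seg.cons h.vb h.sB)))) h.bu
    (List.perm_iff_count.2 fun a => ?_)
  simp [List.count_cons]; omega

lemma Conf.a1b1 (hN : CycBound G N) (h : Conf G N u A v B P a₁ a₂ b₁ b₂ p q) :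
    ¬ G.Adj a₁ b₁ := by
  classical
  intro e
  refine h.bad hN (Seg.cons h.up (h.sP.app h.qv (Seg.cons h.av.symm (h.sA.rev.app e h.sB)))) h.bu
    (List.perm_iff_count.2 fun a => ?_)
  simp [List.count_cons]; omega

lemma Conf.b1p (hN : CycBound G N) (h : Conf G N u A v B P a₁ a₂ b₁ b₂ p q) :
    ¬ G.Adj b₁ p := h.swap.a1q hN

lemma Conf.b1q (hN : CycBound G N) (h : Conf G N u A v B P a₁ a₂ b₁ b₂ p q) :
    ¬ G.Adj b₁ q := h.swap.a1p hN

lemma Conf.ne_aux (h : Conf G N u A v B P a₁ a₂ b₁ b₂ p q) {x y : V} (hx : x ∈ A) (hy : y ∈ B) :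
    x ≠ y := by
  have := h.nd
  simp [List.nodup_append] at this
  grind

lemma Conf.ne_auxA (h : Conf G N u A v B P a₁ a₂ b₁ b₂ p q) {x y : V} (hx : x ∈ A) (hy : y ∈ P) :
    x ≠ y := by
  have := h.nd
  simp [List.nodup_append] at this
  grind

lemma Conf.ne_auxB (h : Conf G N u A v B P a₁ a₂ b₁ b₂ p q) {x y : V} (hx : x ∈ B) (hy : y ∈ P) :
    x ≠ y := h.swap.ne_auxA hx (by simpa using hy)

lemma Conf.a2b1 (hclaw : RFree G claw) (hN : CycBound G N)
    (h : Conf G N u A v B P a₁ a₂ b₁ b₂ p q) : G.Adj a₂ b₁ := by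
  by_contra e
  exact no_claw hclaw h.av.symm h.vb h.qv.symm (h.ne_aux h.sA.right_mem h.sB.left_mem)
    (h.ne_auxA h.sA.right_mem h.sP.right_mem) (h.ne_auxB h.sB.left_mem h.sP.right_mem)
    e (h.rev.b1q hN) (h.b1q hN)

lemma Conf.ub1 (hclaw : RFree G claw) (hN : CycBound G N)
    (h : Conf G N u A v B P a₁ a₂ b₁ b₂ p q) : ¬ G.Adj u b₁ := by
  intro e
  exact no_claw hclaw h.ua e h.up (h.ne_aux h.sA.left_mem h.sB.left_mem)
    (h.ne_auxA h.sA.left_mem h.sP.left_mem) (h.ne_auxB h.sB.left_mem h.sP.left_mem)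
    (h.a1b1 hN) (h.a1p hN) (h.b1p hN)

lemma Conf.va1 (hclaw : RFree G claw) (hN : CycBound G N)
    (h : Conf G N u A v B P a₁ a₂ b₁ b₂ p q) : ¬ G.Adj v a₁ := h.swap.ub1 hclaw hN

/-- Shift `v` forward until its second successor is not adjacent to it. -/
lemma Conf.shift (hclaw : RFree G claw) (hN : CycBound G N) :
    ∀ (n : ℕ) (A B : List V) (a₂ b₁ : V), B.length = n →
      Conf G N u A v B P a₁ a₂ b₁ b₂ p q →
      ∃ A' B' a₂' w x, Conf G N u (A ++ A') v (w :: x :: B') P a₁ a₂' w b₂ p q ∧ ¬ G.Adj v x := by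
  classical
  intro n
  induction n with
  | zero =>
    intro A B a₂ b₁ hB h
    exact absurd (List.length_eq_zero_iff.1 hB) h.sB.ne_nil
  | succ n ih =>
    intro A B a₂ b₁ hB h
    obtain ⟨B', rfl⟩ := h.sB.exists_cons
    cases B' with
    | nil =>
      have : b₁ = b₂ := by simpa using h.sB.2.2
      exact absurd (this ▸ h.bu.symm) (h.ub1 hclaw hN)
    | cons x B' =>
      by_cases hx : G.Adj v x
      · obtain ⟨-, e1, e2⟩ := h.sB.tail
        have h' : Conf G N u (A ++ [b₁]) v (x :: B') P a₁ b₁ x b₂ p q := by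
          refine ⟨h.sA.app (h.a2b1 hclaw hN) (Seg.single _), e2, h.sP, h.ua, h.vb.symm, hx,
            h.bu, h.up, h.qv, ?_, ?_⟩
          · refine perm_nodup h.nd (List.perm_iff_count.2 fun a => ?_)
            simp [List.count_cons]; omega
          · have := h.len
            simp at this ⊢; omega
        obtain ⟨A', B'', a₂', w, y, hc, hy⟩ := ih _ _ _ _ (by simpa using hB) h'
        exact ⟨b₁ :: A', B'', a₂', w, y, by simpa using hc, hy⟩
      · exact ⟨[], B', a₂, b₁, x, by simpa using h, hx⟩

section single
variable {w x : V} {B' : List V}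

lemma Conf.xt (hclaw : RFree G claw) (hN : CycBound G N)
    (h : Conf G N u A v (w :: x :: B') P a₁ a₂ w b₂ p q) : ¬ G.Adj a₁ x := by
  classical
  intro e
  obtain ⟨-, e1, e2⟩ := h.sB.tail
  refine h.bad hN (Seg.cons h.up (h.sP.app h.qv (Seg.cons h.vb (Seg.cons (h.a2b1 hclaw hN).symm
    (h.sA.rev.app e e2))))) h.bu (List.perm_iff_count.2 fun a => ?_)
  simp [List.count_cons]; omega

lemma Conf.xp (hclaw : RFree G claw) (hN : CycBound G N)
    (h : Conf G N u A v (w :: x :: B') [p] a₁ a₂ w b₂ p p) : ¬ G.Adj x p := by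
  classical
  intro e
  obtain ⟨-, e1, e2⟩ := h.sB.tail
  refine h.bad hN (Seg.cons h.ua (h.sA.app (h.a2b1 hclaw hN) (Seg.cons h.vb.symm
    (Seg.cons h.qv.symm (Seg.cons e.symm e2))))) h.bu (List.perm_iff_count.2 fun a => ?_)
  simp [List.count_cons]; omega

lemma Conf.xu (hclaw : RFree G claw) (hN : CycBound G N)
    (h : Conf G N u A v (w :: x :: B') [p] a₁ a₂ w b₂ p p) : ¬ G.Adj u x := by
  intro e
  exact no_claw hclaw h.ua e h.up (h.ne_aux h.sA.left_mem (by simp))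
    (h.ne_auxA h.sA.left_mem (by simp)) (h.ne_auxB (x := x) (by simp) (by simp))
    (h.xt hclaw hN) (h.a1p hN) (h.xp hclaw hN)

end single

/-- The core: no ear with a single interior vertex. -/
lemma Conf.false_single (hclaw : RFree G claw) (hP6 : RFree G (pathGraph 6)) (hN : CycBound G N)
    (h : Conf G N u A v B [p] a₁ a₂ b₁ b₂ p p) : False := by
  classical
  obtain ⟨A₁, B₁, a₂', w, x, h1, hvx⟩ := Conf.shift hclaw hN _ _ _ _ _ rfl h
  obtain ⟨B₂, A₂, b₂', t, s, h2, hus⟩ := Conf.shift hclaw hN _ _ _ _ _ rfl h1.swap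
  have k := h2.swap
  clear h1 h2 h
  simp only [List.cons_append, List.reverse_cons, List.reverse_nil, List.nil_append] at k
  generalize B₁ ++ B₂ = B at k
  have k' := k.swap
  simp only [List.reverse_cons, List.reverse_nil, List.nil_append] at k'
  obtain ⟨-, ewx, sx⟩ := k.sB.tail
  obtain ⟨-, ets, ss⟩ := k.sA.tail
  by_cases huv : G.Adj u v
  · by_cases hsx : G.Adj s x
    · refine k.bad hN (Seg.cons k.up (Seg.cons k.qv (Seg.cons k.vb
        (Seg.cons (k.a2b1 hclaw hN).symm (ss.rev.app hsx (sx.app (k'.a2b1 hclaw hN)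
          (Seg.single t))))))) k.ua.symm (List.perm_iff_count.2 fun a => ?_)
      simp [List.count_cons]; omega
    · exact no_P6 hP6 ets.symm k.ua.symm huv k.vb ewx (fun e => hus e.symm)
        (fun e => k'.xu hclaw hN e.symm) (fun e => k'.xt hclaw hN e.symm) hsx
        (fun e => k.va1 hclaw hN e.symm) (k.a1b1 hN) (k.xt hclaw hN)
        (k.ub1 hclaw hN) (k.xu hclaw hN) hvx
  · exact no_P6 hP6 k.ua.symm k.up k.qv k.vb ewx (k.a1p hN) (fun e => k.va1 hclaw hN e.symm)
      (k.a1b1 hN) (k.xt hclaw hN) huv (k.ub1 hclaw hN) (k.xu hclaw hN)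
      (fun e => k.b1p hN e.symm) (fun e => k.xp hclaw hN e.symm) hvx

/-- Minimality of an ear of length `n` over the vertex set `C`. -/
def EarMin (G : SimpleGraph V) (C : Set V) (n : ℕ) : Prop :=
  ∀ u v p q P, u ∈ C → v ∈ C → u ≠ v → Seg G p q P → G.Adj u p → G.Adj q v → P.Nodup →
    (∀ x ∈ P, x ∉ C) → n ≤ P.length

/-- No shortest ear exists. -/
lemma Conf.false_ear (hclaw : RFree G claw) (hP6 : RFree G (pathGraph 6)) (hN : CycBound G N)
    (hmin : EarMin G {x | x ∈ u :: A ++ v :: B} P.length)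
    (h : Conf G N u A v B P a₁ a₂ b₁ b₂ p q) : False := by
  have nd := h.nd
  have nP : P.Nodup := (List.nodup_append.1 nd).2.1
  have dis : ∀ x ∈ P, x ∉ u :: A ++ v :: B := fun x hx hx' =>
    (List.nodup_append.1 nd).2.2 x hx' x hx rfl
  have M : ∀ u' v' p' q' X, Seg G p' q' X → u' ∈ u :: A ++ v :: B → v' ∈ u :: A ++ v :: B →
      u' ≠ v' → X.Sublist P → X.length < P.length → G.Adj u' p' → ¬ G.Adj q' v' := by
    intro u' v' p' q' X hX hu hv huv hs hl h1 h2
    have := hmin u' v' p' q' X hu hv huv hX h1 h2 (hs.nodup nP)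
      (fun x hx => dis x (hs.subset hx))
    omega
  have ne1 : u ≠ v := by
    intro e
    simp [e] at nd
  have ne2 : u ≠ a₁ := h.ua.ne
  have mu : u ∈ u :: A ++ v :: B := by simp
  have mv : v ∈ u :: A ++ v :: B := by simp
  have ma : a₁ ∈ u :: A ++ v :: B := by simp [h.sA.left_mem]
  have va := h.va1 hclaw hN
  have va' : ¬ G.Adj a₁ v := fun e => va e.symm
  have ub := h.ub1 hclaw hN
  have ap := h.a1p hN
  have aq := h.a1q hN
  have ab := h.a1b1 hN
  have bp := h.b1p hN
  have bq := h.b1q hN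
  obtain ⟨P', rfl⟩ := h.sP.exists_cons
  have up := h.up
  cases P' with
  | nil =>
    have : p = q := by simpa using h.sP.2.2
    subst this
    exact h.false_single hclaw hP6 hN
  | cons p2 R =>
    obtain ⟨-, e12, s2⟩ := h.sP.tail
    have pv : ¬ G.Adj p v := M u v p p [p] (Seg.single p) mu mv ne1 (by simp) (by simp) up
    have huv : ¬ G.Adj u v := by
      intro e
      refine no_claw hclaw h.ua e up ?_ (h.ne_auxA h.sA.left_mem (by simp)) ?_ va' ap
        (fun e => pv e.symm)
      · rintro rfl
        exact (List.nodup_append.1 (List.nodup_append.1 nd).1).2.2 a₁ (by simp [h.sA.left_mem])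
          a₁ (by simp) rfl
      · rintro rfl
        exact dis _ (by simp) mv
    have up2 : ¬ G.Adj u p2 := fun e =>
      M u v p2 q (p2 :: R) s2 mu mv ne1 (by simp) (by simp) e h.qv
    cases R with
    | nil =>
      have : p2 = q := by simpa using s2.2.2
      subst this
      exact no_P6 hP6 h.ua.symm up e12 h.qv h.vb ap aq va' ab up2 huv ub pv
        (fun e => bp e.symm) (fun e => bq e.symm)
    | cons p3 R =>
      obtain ⟨-, e23, s3⟩ := s2.tail
      have up3 : ¬ G.Adj u p3 := fun e =>
        M u v p3 q (p3 :: R) s3 mu mv ne1 (by simp) (by simp only [List.length_cons]; omega) e h.qv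
      have p13 : ¬ G.Adj p p3 := fun e =>
        M u v p q (p :: p3 :: R) (Seg.cons e s3) mu mv ne1 (by simp) (by simp) up h.qv
      have s12 : Seg G p p2 [p, p2] := Seg.cons e12 (Seg.single p2)
      have p2v : ¬ G.Adj p2 v := M u v p p2 [p, p2] s12 mu mv ne1 (by simp) (by simp) up
      have p2a : ¬ G.Adj p2 a₁ := M u a₁ p p2 [p, p2] s12 mu ma ne2 (by simp) (by simp) up
      cases R with
      | nil =>
        have : p3 = q := by simpa using s3.2.2
        subst this
        exact no_P6 hP6 h.ua.symm up e12 e23 h.qv ap (fun e => p2a e.symm) aq va'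
          up2 up3 huv p13 pv p2v
      | cons p4 R =>
        obtain ⟨-, e34, s4⟩ := s3.tail
        have up4 : ¬ G.Adj u p4 := fun e =>
          M u v p4 q (p4 :: R) s4 mu mv ne1
            (List.sublist_append_right [p, p2, p3] (p4 :: R)) (by simp only [List.length_cons]; omega) e h.qv
        have p14 : ¬ G.Adj p p4 := fun e =>
          M u v p q (p :: p4 :: R) (Seg.cons e s4) mu mv ne1 (by simp) (by simp only [List.length_cons]; omega) up h.qv
        have p24 : ¬ G.Adj p2 p4 := fun e =>
          M u v p q (p :: p2 :: p4 :: R) (Seg.cons e12 (Seg.cons e s4)) mu mv ne1 (by simp)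
            (by simp) up h.qv
        have s13 : Seg G p p3 [p, p2, p3] := Seg.cons e12 (Seg.cons e23 (Seg.single p3))
        have p3a : ¬ G.Adj p3 a₁ :=
          M u a₁ p p3 [p, p2, p3] s13 mu ma ne2 (by simp) (by simp) up
        have p4a : ¬ G.Adj p4 a₁ := by
          cases R with
          | nil =>
            have : p4 = q := by simpa using s4.2.2
            subst this
            exact fun e => aq e.symm
          | cons p5 R =>
            exact M u a₁ p p4 [p, p2, p3, p4]
              (Seg.cons e12 (Seg.cons e23 (Seg.cons e34 (Seg.single p4)))) mu ma ne2 (by simp)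
              (by simp) up
        exact no_P6 hP6 h.ua.symm up e12 e23 e34 ap (fun e => p2a e.symm)
          (fun e => p3a e.symm) (fun e => p4a e.symm) up2 up3 up4 p13 p14 p24

end

/-- Follow a path from outside `C` until it hits `C`. -/
lemma ear_of_walk {C s : Set V} {a c : s} (w : (G.induce s).Walk a c) (hw : w.IsPath)
    (ha : a.1 ∉ C) (hc : c.1 ∈ C) :
    ∃ b l v, Seg G a.1 b l ∧ G.Adj b v ∧ v ∈ C ∧ v ∈ s ∧ l.Nodup ∧
      ∀ x ∈ l, x ∉ C ∧ ∃ h : x ∈ s, (⟨x, h⟩ : s) ∈ w.support := by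
  induction w with
  | nil => exact absurd hc ha
  | @cons a d c had w ih =>
    have had' : G.Adj a.1 d.1 := had
    rw [Walk.cons_isPath_iff] at hw
    by_cases hd : d.1 ∈ C
    · exact ⟨a.1, [a.1], d.1, Seg.single _, had', hd, d.2, by simp, by simp [ha]⟩
    · obtain ⟨b, l, v, h1, h2, h3, h4, h5, h6⟩ := ih hw.1 hd hc
      refine ⟨b, a.1 :: l, v, Seg.cons had' h1, h2, h3, h4, ?_, ?_⟩
      · refine List.nodup_cons.2 ⟨fun h => hw.2 ?_, h5⟩
        obtain ⟨_, _, h'⟩ := h6 _ h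
        exact h'
      · intro x hx
        rcases List.mem_cons.1 hx with rfl | hx
        · exact ⟨ha, a.2, by simp⟩
        · obtain ⟨g1, g2, g3⟩ := h6 x hx
          exact ⟨g1, g2, by simp [g3]⟩

/-- In a 2-connected graph, a set with at least two vertices missing a vertex has an ear. -/
lemma exists_ear [Fintype V] (h2 : TwoConnected G) {C : Set V} {c d z : V} (hc : c ∈ C)
    (hd : d ∈ C) (hcd : c ≠ d) (hz : z ∉ C) :
    ∃ u v p q P, u ∈ C ∧ v ∈ C ∧ u ≠ v ∧ Seg G p q P ∧ G.Adj u p ∧ G.Adj q v ∧ P.Nodup ∧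
      ∀ x ∈ P, x ∉ C := by
  classical
  have step : ∀ z ∉ C, ∀ e ∈ C, ∃ b l v, Seg G z b l ∧ G.Adj b v ∧ v ∈ C ∧ v ≠ e ∧ l.Nodup ∧
      ∀ x ∈ l, x ∉ C := by
    intro z hz e he
    obtain ⟨f, hf, hfe⟩ : ∃ f ∈ C, f ≠ e := by
      by_cases h : c = e
      · exact ⟨d, hd, fun h' => hcd (h.trans h'.symm)⟩
      · exact ⟨c, hc, h⟩
    have hze : z ≠ e := fun h => hz (h ▸ he)
    obtain ⟨w⟩ := (h2.2 e).preconnected ⟨z, hze⟩ ⟨f, hfe⟩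
    obtain ⟨b, l, v, h1, h3, h4, h5, h6, h7⟩ := ear_of_walk w.toPath.1 w.toPath.2 hz hf
    exact ⟨b, l, v, h1, h3, h4, h5, h6, fun x hx => (h7 x hx).1⟩
  obtain ⟨p, l, u, h1, h3, h4, -, -, h7⟩ := step z hz c hc
  obtain ⟨q, P, v, k1, k3, k4, k5, k6, k7⟩ := step p (h7 p h1.right_mem) u h4
  exact ⟨u, v, p, q, P, h4, k4, k5.symm, k1, h3.symm, k3, k6, k7⟩

/-- Rotate a cycle. -/
lemma rotate {a b u : V} {l : List V} (h : Seg G a b l) (hba : G.Adj b a) (hu : u ∈ l) :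
    ∃ c m, Seg G u c (u :: m) ∧ G.Adj c u ∧ List.Perm l (u :: m) := by
  obtain ⟨X, Y, rfl⟩ := List.append_of_mem hu
  by_cases hX : X = []
  · subst hX
    have := Seg.head_eq h
    subst this
    exact ⟨b, Y, h, hba, by simp⟩
  · obtain ⟨c, d, h1, h2, h3⟩ := h.split hX (by simp)
    have := Seg.head_eq h3
    subst this
    exact ⟨c, Y ++ X, h3.app hba h1, h2, List.perm_append_comm (l₁ := X) (l₂ := u :: Y)⟩

/-- Turn a cyclic vertex list into a cycle. -/
lemma cycle_of_list {a b : V} {l : List V} (h : Seg G a b l) (hba : G.Adj b a) (hn : l.Nodup)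
    (h3 : 3 ≤ l.length) : ∃ (v : V) (c : G.Walk v v), c.IsCycle ∧ ∀ x ∈ l, x ∈ c.support := by
  have key : ∀ (l : List V) (a b : V), Seg G a b l → ∃ w : G.Walk a b, w.support = l := by
    intro l
    induction l with
    | nil => intro a b h; exact absurd rfl h.ne_nil
    | cons x l ih =>
      intro a b h
      cases l with
      | nil =>
        have e1 : x = a := h.head_eq
        have e2 : x = b := by simpa using h.2.2
        subst e1; subst e2
        exact ⟨Walk.nil, by simp⟩
      | cons y l =>
        obtain ⟨rfl, e, h'⟩ := h.tail
        obtain ⟨w, hw⟩ := ih _ _ h'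
        exact ⟨Walk.cons e w, by simp [hw]⟩
  match l, h, hn, h3 with
  | x :: y :: z :: l, h, hn, _ =>
    obtain ⟨rfl, e, h'⟩ := h.tail
    obtain ⟨w, hw⟩ := key _ _ _ h'
    have hp : (Walk.cons e w).IsPath := by
      rw [Walk.isPath_def]
      simpa [hw] using hn
    refine ⟨b, Walk.cons hba (Walk.cons e w), ?_, ?_⟩
    · rw [Walk.cons_isCycle_iff]
      refine ⟨hp, fun hm => ?_⟩
      rw [Walk.edges_cons, List.mem_cons] at hm
      have hx : x ∉ w.support := by
        rw [hw]; exact (List.nodup_cons.1 hn).1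
      rcases hm with hm | hm
      · have hby : b = y := by
          rcases Sym2.eq_iff.1 hm with ⟨h1, h2⟩ | ⟨h1, h2⟩
          · rw [h1, h2]
          · exact h1
        have hb := (h'.tail).2.2.right_mem
        rw [hby] at hb
        exact (List.nodup_cons.1 (List.nodup_cons.1 hn).2).1 hb
      · exact hx (Walk.snd_mem_support_of_mem_edges _ hm)
    · intro t ht
      simp [hw] at ht ⊢
      tauto

end ClawP6

theorem hamiltonian_of_claw_P6_free {V : Type} [Fintype V] (G : SimpleGraph V)
    [DecidableRel G.Adj] (h2 : TwoConnected G)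
    (hclaw : RFree G claw) (hP6 : RFree G (pathGraph 6)) :
    IsHamiltonianGraph G := by
  classical
  have cardlt : ∀ (l : List V), l.Nodup → l.length ≤ Fintype.card V := fun l hl =>
    hl.length_le_card
  let Q : ℕ → Prop := fun n => ∃ a b l, ClawP6.Seg G a b l ∧ G.Adj b a ∧ l.Nodup ∧ l.length = n
  -- an edge
  have hQ2 : Q 2 := by
    obtain ⟨x, y, z, hxy, hxz, hyz⟩ := Fintype.two_lt_card_iff.1 h2.1
    obtain ⟨w⟩ := (h2.2 z).preconnected ⟨x, hxz⟩ ⟨y, hyz⟩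
    cases w with
    | nil => exact absurd rfl hxy
    | cons e w =>
      have e' : G.Adj x _ := e
      exact ⟨_, _, _, ClawP6.Seg.cons e' (ClawP6.Seg.single _), e'.symm,
        by simpa using e'.ne, rfl⟩
  have h2c : 2 ≤ Fintype.card V := by have := h2.1; omega
  have hQ := Nat.findGreatest_spec (P := Q) h2c hQ2
  have hN2 : 2 ≤ Nat.findGreatest Q (Fintype.card V) := Nat.le_findGreatest h2c hQ2
  have hN : ClawP6.CycBound G (Nat.findGreatest Q (Fintype.card V)) := fun a b l h1 h3 h4 =>
    Nat.le_findGreatest (cardlt l h4) ⟨a, b, l, h1, h3, h4, rfl⟩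
  generalize Nat.findGreatest Q (Fintype.card V) = N at hQ hN2 hN
  obtain ⟨a, b, l, hs, hba, hnd, hlen⟩ := hQ
  by_cases hall : ∀ x, x ∈ l
  · have hcard : Fintype.card V ≤ l.length := by
      rw [← List.toFinset_card_of_nodup hnd, ← Finset.card_univ]
      exact Finset.card_le_card (fun x _ => by simp [hall x])
    obtain ⟨v, c, hc, hc'⟩ := ClawP6.cycle_of_list hs hba hnd (h2.1.trans hcard)
    exact ⟨v, c, hc, fun u => hc' u (hall u)⟩
  exfalso
  push Not at hall
  obtain ⟨z, hz⟩ := hall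
  let C : Set V := {x | x ∈ l}
  let E : ℕ → Prop := fun n => ∃ u v p q P, u ∈ C ∧ v ∈ C ∧ u ≠ v ∧ ClawP6.Seg G p q P ∧
    G.Adj u p ∧ G.Adj q v ∧ P.Nodup ∧ (∀ x ∈ P, x ∉ C) ∧ P.length = n
  have hE : ∃ n, E n := by
    obtain ⟨u, v, p, q, P, g1, g2, g3, g4, g5, g6, g7, g8⟩ :=
      ClawP6.exists_ear (C := C) h2 hs.left_mem hs.right_mem hba.ne' hz
    exact ⟨_, u, v, p, q, P, g1, g2, g3, g4, g5, g6, g7, g8, rfl⟩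
  obtain ⟨u, v, p, q, P, g1, g2, g3, g4, g5, g6, g7, g8, g9⟩ := Nat.find_spec hE
  have hmin : ClawP6.EarMin G C P.length := by
    intro u v p q P k1 k2 k3 k4 k5 k6 k7 k8
    rw [g9]
    exact Nat.find_min' hE ⟨u, v, p, q, P, k1, k2, k3, k4, k5, k6, k7, k8, rfl⟩
  clear g9
  obtain ⟨c, m, hm, hcu, hperm⟩ := ClawP6.rotate hs hba g1
  have hvm : v ∈ m := by
    have : v ∈ u :: m := hperm.mem_iff.1 g2
    rcases List.mem_cons.1 this with h | h
    · exact absurd h.symm g3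
    · exact h
  obtain ⟨A, B, rfl⟩ := List.append_of_mem hvm
  have hC : C = {x | x ∈ u :: A ++ v :: B} := by
    ext x
    exact hperm.mem_iff
  have nd : (u :: A ++ v :: B ++ P).Nodup := by
    refine List.nodup_append.2 ⟨hperm.nodup_iff.1 hnd, g7, ?_⟩
    rintro x hx y hy rfl
    exact g8 x hy (hperm.mem_iff.2 hx)
  have len : (u :: A ++ v :: B).length = N := by
    rw [← hlen, hperm.length_eq]; rfl
  have lP := List.length_pos_of_ne_nil g4.ne_nil
  have big : ∀ x y l', ClawP6.Seg G x y l' → G.Adj y x →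
      List.Perm (u :: A ++ v :: B ++ P) l' → False := by
    intro x y l' k1 k2 k3
    have k4 := hN x y l' k1 k2 (k3.nodup_iff.1 nd)
    have k5 := k3.length_eq
    simp at k4 k5 len
    omega
  have hA : A ≠ [] := by
    rintro rfl
    obtain ⟨-, e, s⟩ := ClawP6.Seg.tail hm
    refine big _ _ _ (ClawP6.Seg.cons g5 (g4.app g6 s)) hcu (List.perm_iff_count.2 fun a => ?_)
    simp [List.count_cons]; omega
  have hB : B ≠ [] := by
    rintro rfl
    have : v = c := by
      have h := hm.2.2
      rw [← List.cons_append, List.getLast?_concat] at h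
      simpa using h
    subst this
    refine big _ _ _ (ClawP6.Seg.app hm g6.symm g4.rev) g5.symm (List.perm_iff_count.2 fun a => ?_)
    simp [List.count_cons]
  obtain ⟨a₁, a₂, sA⟩ : ∃ a₁ a₂, ClawP6.Seg G a₁ a₂ A :=
    ClawP6.Seg.of_ne_nil (List.isChain_append.1 (List.isChain_cons.1 hm.1).2).1 hA
  obtain ⟨x, y, s1, e1, s2⟩ := ClawP6.Seg.split (l := [u]) (m := A ++ v :: B) hm (by simp) (by simp)
  obtain ⟨x2, y2, s3, e2, s4⟩ := ClawP6.Seg.split s2 hA (by simp)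
  obtain ⟨x3, y3, s5, e3, s6⟩ := ClawP6.Seg.split (l := [v]) (m := B) s4 (by simp) hB
  have q1 : u = x := by simpa using s1.2.2
  have q2 : v = y2 := s4.head_eq
  have q3 : v = x3 := by simpa using s5.2.2
  subst q1 q2 q3
  have conf : ClawP6.Conf G N u A v B P y x2 y3 c p q :=
    ⟨s3, s6, g4, e1, e2, e3, hcu, g5, g6, nd, len⟩
  rw [hC] at hmin
  exact conf.false_ear hclaw hP6 hN hmin
end
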